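/- Let 𝔹 = (B_n)_{n∈ℤ} be a two-sided sequence of invertible linear operators on ℝ^d admitting a strong exponential dichotomy with respect to a sequence of norms 𝒮′ = (‖·‖_n)_{n∈ℤ}. Suppose Σ_{ED,𝔹,𝒮′} = ⋃_{i=1}^r [a_i,b_i] where a_1≤b_1<···<a_k≤b_k<1<a_{k+1}≤···<a_r≤b_r, a_{k+1}/b_k > max{b_r, a_1^{-1}}, b_i/a_i < b_k^{-1} for i=1,…,k, and b_j/a_j < a_{k+1} for j=k+1,…,r. Let f_n : ℝ^d → ℝ^d, n∈ℤ, be C¹ maps with f_n(0)=0, Df_n(0)=0, ‖Df_n(x)v‖_{n+1} ≤ η‖v‖_n and ‖(Df_n(x)−Df_n(y))v‖_{n+1} ≤ L‖x−y‖_n·‖v‖_n for all x,y,v∈ℝ^d, with constants L,η>0. Then there exists η₀>0 such that if η≤η₀, there exists a sequence of C¹-diffeomorphisms h_n : ℝ^d → ℝ^d, n∈ℤ, with h_{n+1}∘(B_n+f_n) = B_n∘h_n for all n∈ℤ, and there exist M,ρ>0 such that ‖Dh_n(v)z‖_n ≤ M‖z‖_n and ‖Dh_n^{-1}(v)z‖_n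 ≤ M‖z‖_n for all n∈ℤ, all z∈ℝ^d, and all v∈ℝ^d with ‖v‖_n ≤ ρ. -/

import Mathlib

noncomputable section

namespace NonautLin

variable {E : Type*} [NormedAddCommGroup E] [NormedSpace ℝ E]

/-- `N : E → ℝ` is a norm on the real vector space `E`. -/
def IsNormOn (N : E → ℝ) : Prop :=
  (∀ x, 0 ≤ N x) ∧ (∀ x, N x = 0 ↔ x = 0) ∧
  (∀ (c : ℝ) (x : E), N (c • x) = |c| * N x) ∧
  (∀ x y : E, N (x + y) ≤ N x + N y)

/-- Multiplication by the scalar `c` as a continuous linear equivalence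
(junk value `id` for `c = 0`). -/
def smulCLE (c : ℝ) : E ≃L[ℝ] E :=
  if hc : c = 0 then ContinuousLinearEquiv.refl ℝ E
  else
    { toFun := fun x => c • x
      invFun := fun x => c⁻¹ • x
      map_add' := fun x y => smul_add c x y
      map_smul' := fun a x => smul_comm c a x
      left_inv := fun x => by simp [smul_smul, inv_mul_cancel₀ hc]
      right_inv := fun x => by simp [smul_smul, mul_inv_cancel₀ hc]
      continuous_toFun := continuous_const_smul c
      continuous_invFun := continuous_const_smul c⁻¹ }

/-- The operator `c • A` as a continuous linear equivalence. -/
def scale (c : ℝ) (A : E ≃L[ℝ] E) : E ≃L[ℝ] E := A.trans (smulCLE c)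

/-- `fwdZ A n k` is the composition `A (n+k-1) ∘ ⋯ ∘ A n`. -/
def fwdZ (A : ℤ → (E ≃L[ℝ] E)) (n : ℤ) : ℕ → (E ≃L[ℝ] E)
  | 0 => ContinuousLinearEquiv.refl ℝ E
  | k + 1 => (fwdZ A n k).trans (A (n + k))

/-- The cocycle `𝒜(m,n)` associated with the two-sided sequence `A`. -/
def cocZ (A : ℤ → (E ≃L[ℝ] E)) (m n : ℤ) : E ≃L[ℝ] E :=
  if n ≤ m then fwdZ A n (m - n).toNat else (fwdZ A m (n - m).toNat).symm

/-- Strong exponential dichotomy over `ℤ` with respect to a sequence of norms. -/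
def StrongExpDichotomyZWRT (B : ℤ → (E ≃L[ℝ] E)) (N : ℤ → E → ℝ) : Prop :=
  ∃ K lam a : ℝ, 0 < K ∧ 0 < lam ∧ lam ≤ a ∧
    ∃ P : ℤ → (E →L[ℝ] E),
      (∀ n, (P n).comp (P n) = P n) ∧
      (∀ n, ((B n : E →L[ℝ] E)).comp (P n) = (P (n + 1)).comp (B n : E →L[ℝ] E)) ∧
      (∀ m n : ℤ, n ≤ m → ∀ x : E,
        N m (cocZ B m n (P n x)) ≤ K * Real.exp (-lam * ((m : ℝ) - n)) * N n x ∧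
        N n (cocZ B n m (x - P m x)) ≤ K * Real.exp (-lam * ((m : ℝ) - n)) * N m x ∧
        N m (cocZ B m n x) ≤ K * Real.exp (a * ((m : ℝ) - n)) * N n x ∧
        N n (cocZ B n m x) ≤ K * Real.exp (a * ((m : ℝ) - n)) * N m x)

/-- The exponential dichotomy spectrum over `ℤ`. -/
def SigmaEDZ (B : ℤ → (E ≃L[ℝ] E)) (N : ℤ → E → ℝ) : Set ℝ :=
  {τ | 0 < τ ∧ ¬ StrongExpDichotomyZWRT (fun n => scale τ⁻¹ (B n)) N}

open Filter Topology

namespace IsNormOn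

variable {N : E → ℝ}

lemma nonneg (h : IsNormOn N) (x : E) : 0 ≤ N x := h.1 x

lemma map_zero (h : IsNormOn N) : N 0 = 0 := (h.2.1 0).2 rfl

lemma eq_zero (h : IsNormOn N) {x : E} (hx : N x = 0) : x = 0 := (h.2.1 x).1 hx

lemma eq_zero_of_le (h : IsNormOn N) {x : E} (hx : N x ≤ 0) : x = 0 :=
  h.eq_zero (le_antisymm hx (h.nonneg x))

lemma smul (h : IsNormOn N) (c : ℝ) (x : E) : N (c • x) = |c| * N x := h.2.2.1 c x

lemma add_le (h : IsNormOn N) (x y : E) : N (x + y) ≤ N x + N y := h.2.2.2 x y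

lemma map_neg (h : IsNormOn N) (x : E) : N (-x) = N x := by
  have := h.smul (-1) x
  simpa using this

lemma sub_le (h : IsNormOn N) (x y : E) : N (x - y) ≤ N x + N y := by
  have := h.add_le x (-y)
  rwa [h.map_neg, ← sub_eq_add_neg] at this

lemma sub_comm (h : IsNormOn N) (x y : E) : N (x - y) = N (y - x) := by
  rw [← h.map_neg, neg_sub]

/-- Decompose `z = x + y`. -/
lemma le_of_eq_add (h : IsNormOn N) {x y z : E} (hz : z = x + y) : N z ≤ N x + N y :=
  hz ▸ h.add_le x y

lemma le_of_eq_sub (h : IsNormOn N) {x y z : E} (hz : z = x - y) : N z ≤ N x + N y :=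
  hz ▸ h.sub_le x y

lemma abs_sub_le (h : IsNormOn N) (x y : E) : |N x - N y| ≤ N (x - y) := by
  rw [abs_le]
  constructor
  · have := h.le_of_eq_add (x := y - x) (y := x) (z := y) (by abel)
    rw [h.sub_comm] at this
    linarith
  · have := h.le_of_eq_add (x := x - y) (y := y) (z := x) (by abel)
    linarith

lemma sum_le (h : IsNormOn N) {ι : Type*} (s : Finset ι) (g : ι → E) :
    N (∑ i ∈ s, g i) ≤ ∑ i ∈ s, N (g i) := by
  classical
  induction s using Finset.induction_on with
  | empty => simp [h.map_zero]
  | insert a s ha ih =>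
    rw [Finset.sum_insert ha, Finset.sum_insert ha]
    exact (h.add_le _ _).trans (by linarith)

variable [FiniteDimensional ℝ E]

lemma exists_le_norm (h : IsNormOn N) : ∃ c : ℝ, 0 < c ∧ ∀ x, N x ≤ c * ‖x‖ := by
  let b := Module.finBasis ℝ E
  let φ : Fin (Module.finrank ℝ E) → (E →L[ℝ] ℝ) := fun i => (b.coord i).toContinuousLinearMap
  have hs : 0 ≤ ∑ i, ‖φ i‖ * N (b i) :=
    Finset.sum_nonneg fun i _ => mul_nonneg (norm_nonneg _) (h.nonneg _)
  refine ⟨∑ i, ‖φ i‖ * N (b i) + 1, by linarith, fun x => ?_⟩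
  have hx : N x ≤ ∑ i, |φ i x| * N (b i) := by
    conv_lhs => rw [← b.sum_repr x]
    refine (h.sum_le _ _).trans (Finset.sum_le_sum fun i _ => ?_)
    rw [h.smul]
    rfl
  have hx2 : ∑ i, |φ i x| * N (b i) ≤ ∑ i, ‖φ i‖ * N (b i) * ‖x‖ := by
    refine Finset.sum_le_sum fun i _ => ?_
    have h1 : |φ i x| ≤ ‖φ i‖ * ‖x‖ := (φ i).le_opNorm x
    nlinarith [h.nonneg (b i)]
  rw [← Finset.sum_mul] at hx2
  nlinarith [norm_nonneg x]

lemma continuous (h : IsNormOn N) : Continuous N := by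
  obtain ⟨c, hc, hle⟩ := h.exists_le_norm
  refine (LipschitzWith.of_dist_le_mul (K := c.toNNReal) fun x y => ?_).continuous
  rw [Real.dist_eq, dist_eq_norm, Real.coe_toNNReal _ hc.le]
  exact (h.abs_sub_le x y).trans (hle _)

lemma exists_norm_le (h : IsNormOn N) : ∃ c : ℝ, 0 < c ∧ ∀ x, ‖x‖ ≤ c * N x := by
  by_cases hne : (Metric.sphere (0 : E) 1).Nonempty
  · obtain ⟨x₀, hx₀, hmin⟩ :=
      (isCompact_sphere (0 : E) 1).exists_isMinOn hne h.continuous.continuousOn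
    have hx₀n : ‖x₀‖ = 1 := by simpa using hx₀
    have hpos : 0 < N x₀ := by
      rcases (h.nonneg x₀).eq_or_lt with h0 | h0
      · have := h.eq_zero h0.symm
        simp [this] at hx₀n
      · exact h0
    refine ⟨(N x₀)⁻¹, inv_pos.2 hpos, fun x => ?_⟩
    by_cases hx : x = 0
    · simp [hx, h.map_zero]
    · have hxn : 0 < ‖x‖ := norm_pos_iff.2 hx
      have hm : N x₀ ≤ N (‖x‖⁻¹ • x) := by
        refine isMinOn_iff.1 hmin _ ?_
        simp [norm_smul, hxn.ne']
      rw [h.smul, abs_of_pos (inv_pos.2 hxn)] at hm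
      rw [← div_eq_inv_mul, le_div_iff₀ hpos]
      rw [← div_eq_inv_mul, le_div_iff₀ hxn] at hm
      linarith
  · refine ⟨1, one_pos, fun x => ?_⟩
    by_cases hx : x = 0
    · simp [hx, h.map_zero]
    · have hxn : 0 < ‖x‖ := norm_pos_iff.2 hx
      exact absurd ⟨‖x‖⁻¹ • x, by simp [norm_smul, hxn.ne']⟩ hne

/-- Mean value inequality along a curve, for an arbitrary norm. -/
lemma image_sub_le (h : IsNormOn N) {φ φ' : ℝ → E} {C : ℝ}
    (hφ : ∀ t, HasDerivAt φ (φ' t) t) (hb : ∀ t ∈ Set.Icc (0 : ℝ) 1, N (φ' t) ≤ C) :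
    N (φ 1 - φ 0) ≤ C := by
  set v := φ 1 - φ 0 with hv
  by_cases hv0 : v = 0
  · rw [hv0, h.map_zero]
    exact (h.nonneg _).trans (hb 0 (by simp))
  let g₀ : E →ₗ.[ℝ] ℝ := LinearPMap.mkSpanSingleton v (N v) hv0
  obtain ⟨g, hg, hgN⟩ := exists_extension_of_le_sublinear g₀ N
    (fun c hc x => by rw [h.smul, abs_of_pos hc]) h.add_le (by
      rintro ⟨x, hx⟩
      obtain ⟨c, rfl⟩ := Submodule.mem_span_singleton.1 hx
      change LinearPMap.mkSpanSingleton v (N v) hv0 ⟨c • v, hx⟩ ≤ N (c • v)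
      erw [LinearPMap.mkSpanSingleton'_apply]
      rw [h.smul, smul_eq_mul]
      exact mul_le_mul_of_nonneg_right (le_abs_self c) (h.nonneg v))
  have hgv : g v = N v := by
    have h1 := hg ⟨v, Submodule.mem_span_singleton_self v⟩
    rw [h1]
    exact LinearPMap.mkSpanSingleton_apply ..
  let G : E →L[ℝ] ℝ := g.toContinuousLinearMap
  have hder : ∀ t, HasDerivAt (fun t => G (φ t)) (G (φ' t)) t := fun t =>
    G.hasFDerivAt.comp_hasDerivAt t (hφ t)
  obtain ⟨t, ht, hte⟩ := exists_hasDerivAt_eq_slope (fun t => G (φ t)) (fun t => G (φ' t))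
    (zero_lt_one) (fun t _ => (hder t).continuousAt.continuousWithinAt) (fun t _ => hder t)
  have h3 : G (φ 1) - G (φ 0) = N v := by
    rw [← map_sub]
    exact hgv
  have h4 : G (φ' t) = N v := by rw [hte, h3]; simp
  rw [← h4]
  exact (hgN _).trans (hb t ⟨ht.1.le, ht.2.le⟩)

end IsNormOn

section derivBounds

variable [FiniteDimensional ℝ E] {N M : E → ℝ}

lemma tendsto_norm_slope (hN : IsNormOn N) {φ : E → E} {φ' : E →L[ℝ] E} {ξ₀ : E}
    (hφ : HasFDerivAt φ φ' ξ₀) (ζ : E) :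
    Tendsto (fun t : ℝ => t⁻¹ * N (φ (ξ₀ + t • ζ) - φ ξ₀)) (𝓝[>] 0) (𝓝 (N (φ' ζ))) := by
  have h1 : HasDerivAt (fun t : ℝ => φ (ξ₀ + t • ζ)) (φ' ζ) 0 := hφ.hasLineDerivAt ζ
  have h2 : Tendsto (fun t : ℝ => t⁻¹ • (φ (ξ₀ + t • ζ) - φ ξ₀)) (𝓝[>] 0) (𝓝 (φ' ζ)) := by
    have := h1.tendsto_slope_zero_right
    simpa using this
  refine ((hN.continuous.tendsto _).comp h2).congr' ?_
  filter_upwards [self_mem_nhdsWithin] with t ht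
  have ht' : (0 : ℝ) < t := ht
  simp [hN.smul, abs_of_pos ht']

lemma eventually_line {p : E → Prop} {ξ₀ : E} (hp : ∀ᶠ ξ in 𝓝 ξ₀, p ξ) (ζ : E) :
    ∀ᶠ t : ℝ in 𝓝[>] 0, p (ξ₀ + t • ζ) := by
  have hc : Tendsto (fun t : ℝ => ξ₀ + t • ζ) (𝓝[>] 0) (𝓝 ξ₀) := by
    have : Continuous (fun t : ℝ => ξ₀ + t • ζ) := by fun_prop
    have := this.tendsto 0
    simp only [zero_smul, add_zero] at this
    exact this.mono_left nhdsWithin_le_nhds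
  exact hc.eventually hp

lemma fderiv_norm_le (hN : IsNormOn N) (hM : IsNormOn M) {φ : E → E} {φ' : E →L[ℝ] E} {ξ₀ : E}
    (hφ : HasFDerivAt φ φ' ξ₀) {c : ℝ}
    (hb : ∀ᶠ ξ in 𝓝 ξ₀, N (φ ξ - φ ξ₀) ≤ c * M (ξ - ξ₀)) (ζ : E) : N (φ' ζ) ≤ c * M ζ := by
  refine le_of_tendsto (tendsto_norm_slope hN hφ ζ) ?_
  filter_upwards [self_mem_nhdsWithin, eventually_line hb ζ] with t ht hbt
  have ht' : (0 : ℝ) < t := ht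
  rw [add_sub_cancel_left, hM.smul, abs_of_pos ht'] at hbt
  calc _ ≤ t⁻¹ * (c * (t * M ζ)) := mul_le_mul_of_nonneg_left hbt (inv_nonneg.2 ht'.le)
    _ = _ := by field_simp

lemma le_fderiv_norm (hN : IsNormOn N) (hM : IsNormOn M) {φ : E → E} {φ' : E →L[ℝ] E} {ξ₀ : E}
    (hφ : HasFDerivAt φ φ' ξ₀) {c : ℝ} 
    (hb : ∀ᶠ ξ in 𝓝 ξ₀, M (ξ - ξ₀) ≤ c * N (φ ξ - φ ξ₀)) (ζ : E) : M ζ ≤ c * N (φ' ζ) := by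
  refine ge_of_tendsto ((tendsto_norm_slope hN hφ ζ).const_mul c) ?_
  filter_upwards [self_mem_nhdsWithin, eventually_line hb ζ] with t ht hbt
  have ht' : (0 : ℝ) < t := ht
  rw [add_sub_cancel_left, hM.smul, abs_of_pos ht'] at hbt
  rw [mul_left_comm, ← div_eq_inv_mul, le_div_iff₀ ht']
  linarith

end derivBounds

/-- The perturbations `f n` are `C¹`, vanish to first order at `0`, and have small and Lipschitz
derivative. -/
structure Pert (N : ℤ → E → ℝ) (η L : ℝ) (f : ℤ → E → E) : Prop where
  smooth : ∀ n, ContDiff ℝ 1 (f n)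
  zero : ∀ n, f n 0 = 0
  dzero : ∀ n, fderiv ℝ (f n) 0 = 0
  dbound : ∀ n x v, N (n + 1) (fderiv ℝ (f n) x v) ≤ η * N n v
  dlip : ∀ n x y v, N (n + 1) ((fderiv ℝ (f n) x - fderiv ℝ (f n) y) v) ≤ L * N n (x - y) * N n v

lemma Pert.const_zero {N : ℤ → E → ℝ} (hN : ∀ n, IsNormOn (N n)) {η L : ℝ} (hη : 0 ≤ η)
    (hL : 0 ≤ L) : Pert N η L (fun _ _ => 0) where
  smooth _ := contDiff_const
  zero _ := rfl
  dzero _ := by simp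
  dbound n x v := by
    simp only [fderiv_fun_const, Pi.zero_apply, zero_apply, (hN _).map_zero]
    exact mul_nonneg hη ((hN _).nonneg _)
  dlip n x y v := by
    simp only [fderiv_fun_const, Pi.zero_apply, sub_self, zero_apply,
      (hN _).map_zero]
    exact mul_nonneg (mul_nonneg hL ((hN _).nonneg _)) ((hN _).nonneg _)

namespace Pert

variable [FiniteDimensional ℝ E] {N : ℤ → E → ℝ} {η L : ℝ} {f : ℤ → E → E}

lemma hasFDerivAt (hf : Pert N η L f) (n : ℤ) (x : E) :
    HasFDerivAt (f n) (fderiv ℝ (f n) x) x :=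
  ((hf.smooth n).differentiable one_ne_zero x).hasFDerivAt

lemma hasDerivAt_line (hf : Pert N η L f) (n : ℤ) (x u : E) (t : ℝ) :
    HasDerivAt (fun t : ℝ => f n (x + t • u)) (fderiv ℝ (f n) (x + t • u) u) t := by
  have h1 : HasDerivAt (fun t : ℝ => x + t • u) u t := by
    simpa using ((hasDerivAt_id t).smul_const u).const_add x
  exact (hf.hasFDerivAt n _).comp_hasDerivAt t h1

lemma lip (hN : ∀ n, IsNormOn (N n)) (hf : Pert N η L f) (n : ℤ) (x y : E) :
    N (n + 1) (f n x - f n y) ≤ η * N n (x - y) := by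
  have := (hN (n + 1)).image_sub_le (hf.hasDerivAt_line n y (x - y))
    (fun t _ => hf.dbound n _ _)
  simpa using this

lemma norm_le (hN : ∀ n, IsNormOn (N n)) (hf : Pert N η L f) (n : ℤ) (x : E) :
    N (n + 1) (f n x) ≤ η * N n x := by
  have := hf.lip hN n x 0
  simpa [hf.zero] using this

lemma lip_local (hN : ∀ n, IsNormOn (N n)) (hL : 0 ≤ L) (hf : Pert N η L f) (n : ℤ) (x y : E) :
    N (n + 1) (f n x - f n y) ≤ L * (N n x + N n y) * N n (x - y) := by
  have := (hN (n + 1)).image_sub_le (C := L * (N n x + N n y) * N n (x - y))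
    (hf.hasDerivAt_line n y (x - y)) (fun t ht => by
      have h1 := hf.dlip n (y + t • (x - y)) 0 (x - y)
      rw [hf.dzero, sub_zero, sub_zero] at h1
      refine h1.trans ?_
      have h2 : N n (y + t • (x - y)) ≤ N n x + N n y := by
        have h3 := (hN n).le_of_eq_add (x := t • x) (y := (1 - t) • y) (z := y + t • (x - y))
          (by module)
        rw [(hN n).smul, (hN n).smul, abs_of_nonneg ht.1, abs_of_nonneg (by linarith [ht.2])] at h3
        nlinarith [(hN n).nonneg x, (hN n).nonneg y, ht.1, ht.2]
      have := (hN n).nonneg (x - y)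
      gcongr)
  simpa using this

/-- Second difference estimate with a common increment. -/
lemma second_diff (hN : ∀ n, IsNormOn (N n)) (hf : Pert N η L f) (n : ℤ) (x y u : E) :
    N (n + 1) (f n (x + u) - f n x - (f n (y + u) - f n y)) ≤ L * N n (x - y) * N n u := by
  have := (hN (n + 1)).image_sub_le (C := L * N n (x - y) * N n u)
    (fun t => (hf.hasDerivAt_line n x u t).sub (hf.hasDerivAt_line n y u t)) (fun t ht => by
      have h1 := hf.dlip n (x + t • u) (y + t • u) u
      rwa [add_sub_add_right_eq_sub] at h1)
  simp only [Pi.sub_apply, one_smul, zero_smul, add_zero] at this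
  refine le_trans (le_of_eq ?_) this
  congr 1
  abel

lemma second_diff_le_left (hN : ∀ n, IsNormOn (N n)) (hf : Pert N η L f) (n : ℤ)
    (x y u : E) :
    N (n + 1) (f n (x + u) - f n x - (f n (y + u) - f n y)) ≤ 2 * η * N n (x - y) := by
  have h1 := hf.lip hN n (x + u) (y + u)
  have h2 := hf.lip hN n x y
  rw [add_sub_add_right_eq_sub] at h1
  have := (hN (n + 1)).le_of_eq_sub
    (z := f n (x + u) - f n x - (f n (y + u) - f n y)) (x := f n (x + u) - f n (y + u))
    (y := f n x - f n y) (by abel)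
  linarith

end Pert

/-! ### Two-sided orbits -/

/-- Backward iterates: the value at time `n - j` of the orbit through `x` at time `n`. -/
def backIter {X : Type*} (F : ℤ → X ≃ X) (n : ℤ) (x : X) : ℕ → X
  | 0 => x
  | j + 1 => (F (n - (j + 1))).symm (backIter F n x j)

/-- Forward iterates: the value at time `n + j` of the orbit through `x` at time `n`. -/
def fwdIter {X : Type*} (F : ℤ → X ≃ X) (n : ℤ) (x : X) : ℕ → X
  | 0 => x
  | j + 1 => F (n + j) (fwdIter F n x j)

/-- The two-sided orbit of the sequence of bijections `F` with value `x` at time `n`. -/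
def orb {X : Type*} (F : ℤ → X ≃ X) (n : ℤ) (x : X) (m : ℤ) : X :=
  if n ≤ m then fwdIter F n x (m - n).toNat else backIter F n x (n - m).toNat

lemma orb_self {X : Type*} (F : ℤ → X ≃ X) (n : ℤ) (x : X) : orb F n x n = x := by
  simp [orb, fwdIter]

lemma orb_add {X : Type*} (F : ℤ → X ≃ X) (n : ℤ) (x : X) (j : ℕ) :
    orb F n x (n + j) = fwdIter F n x j := by
  simp [orb]

lemma orb_sub {X : Type*} (F : ℤ → X ≃ X) (n : ℤ) (x : X) (j : ℕ) :
    orb F n x (n - j) = backIter F n x j := by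
  rcases j with _ | j
  · simp [orb, fwdIter, backIter]
  · have h : ¬ n ≤ n - ((j + 1 : ℕ) : ℤ) := by push_cast; omega
    have h2 : (n - (n - ((j + 1 : ℕ) : ℤ))).toNat = j + 1 := by omega
    rw [orb, if_neg h, h2]

lemma orb_succ {X : Type*} (F : ℤ → X ≃ X) (n : ℤ) (x : X) (m : ℤ) :
    orb F n x (m + 1) = F m (orb F n x m) := by
  rcases le_or_gt n m with h | h
  · obtain ⟨j, rfl⟩ : ∃ j : ℕ, m = n + j := ⟨(m - n).toNat, by omega⟩
    have h1 := orb_add F n x (j + 1)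
    push_cast at h1
    rw [add_assoc, h1, orb_add]
    rfl
  · obtain ⟨j, rfl⟩ : ∃ j : ℕ, m = n - ((j + 1 : ℕ) : ℤ) := ⟨(n - m - 1).toNat, by omega⟩
    have h1 : n - ((j + 1 : ℕ) : ℤ) + 1 = n - (j : ℤ) := by push_cast; ring
    rw [h1, orb_sub, orb_sub]
    simp [backIter]

lemma fwdZ_orbit {A : ℤ → (E ≃L[ℝ] E)} {e : ℤ → E} (he : ∀ m, e (m + 1) = A m (e m)) (n : ℤ)
    (j : ℕ) : fwdZ A n j (e n) = e (n + j) := by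
  induction j with
  | zero => simp [fwdZ]
  | succ j ih =>
    push_cast
    rw [← add_assoc, he, ← ih]
    rfl

lemma cocZ_orbit {A : ℤ → (E ≃L[ℝ] E)} {e : ℤ → E} (he : ∀ m, e (m + 1) = A m (e m)) (m n : ℤ) :
    cocZ A m n (e n) = e m := by
  unfold cocZ
  split_ifs with h
  · rw [fwdZ_orbit he]
    congr 1
    omega
  · rw [ContinuousLinearEquiv.symm_apply_eq, fwdZ_orbit he]
    congr 1
    omega

lemma cocZ_eq_orb (A : ℤ → (E ≃L[ℝ] E)) (m n : ℤ) (x : E) :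
    cocZ A m n x = orb (fun n => (A n).toEquiv) n x m := by
  have := cocZ_orbit (A := A) (e := orb (fun n => (A n).toEquiv) n x)
    (fun m => orb_succ _ n x m) m n
  rwa [orb_self] at this

lemma cocZ_succ (A : ℤ → (E ≃L[ℝ] E)) (m n : ℤ) (x : E) :
    cocZ A (m + 1) n x = A m (cocZ A m n x) := by
  rw [cocZ_eq_orb, cocZ_eq_orb, orb_succ]
  rfl

lemma cocZ_self (A : ℤ → (E ≃L[ℝ] E)) (n : ℤ) (x : E) : cocZ A n n x = x := by
  rw [cocZ_eq_orb, orb_self]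

/-! ### Dichotomies and projections -/

lemma scale_apply {c : ℝ} (hc : c ≠ 0) (A : E ≃L[ℝ] E) (x : E) : scale c A x = c • A x := by
  simp only [scale, smulCLE, dif_neg hc]
  rfl

/-- The projections `P` separate the orbits of `B` growing slower than `τ` from those growing
faster than `τ`. -/
def DichAt (B : ℤ → (E ≃L[ℝ] E)) (N : ℤ → E → ℝ) (τ : ℝ) (P : ℤ → (E →L[ℝ] E)) : Prop :=
  (∀ n x, P n (P n x) = P n x) ∧ (∀ n x, B n (P n x) = P (n + 1) (B n x)) ∧
  ∃ K σ : ℝ, 0 < K ∧ 0 < σ ∧ σ < 1 ∧ ∀ e : ℤ → E, (∀ m, e (m + 1) = B m (e m)) →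
    ∀ (n : ℤ) (j : ℕ), N (n + j) (P (n + j) (e (n + j))) ≤ K * (τ * σ) ^ j * N n (e n) ∧
      N n (e n - P n (e n)) ≤ K * (σ / τ) ^ j * N (n + j) (e (n + j))

lemma proj_orbit {B : ℤ → (E ≃L[ℝ] E)} {P : ℤ → (E →L[ℝ] E)}
    (h : ∀ n x, B n (P n x) = P (n + 1) (B n x)) {e : ℤ → E} (he : ∀ m, e (m + 1) = B m (e m))
    (m : ℤ) : P (m + 1) (e (m + 1)) = B m (P m (e m)) := by
  rw [h, he]

lemma exists_dichAt {B : ℤ → (E ≃L[ℝ] E)} {N : ℤ → E → ℝ} (hN : ∀ n, IsNormOn (N n)) {τ : ℝ}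
    (hτ : 0 < τ) (h : StrongExpDichotomyZWRT (fun n => scale τ⁻¹ (B n)) N) :
    ∃ P, DichAt B N τ P := by
  obtain ⟨K, lam, a, hK, hlam, -, P, hP, hBP, hb⟩ := h
  have hτi : τ⁻¹ ≠ 0 := inv_ne_zero hτ.ne'
  have hinv : ∀ n x, B n (P n x) = P (n + 1) (B n x) := by
    intro n x
    have := congrArg (fun T : E →L[ℝ] E => T x) (hBP n)
    simp only [ContinuousLinearMap.comp_apply, ContinuousLinearEquiv.coe_coe,
      scale_apply hτi, map_smul] at this
    exact smul_right_injective E hτi this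
  refine ⟨P, fun n x => congrArg (fun T : E →L[ℝ] E => T x) (hP n), hinv, K, Real.exp (-lam), hK,
    Real.exp_pos _, by simpa using hlam, fun e he n j => ?_⟩
  have hzs : ∀ (m : ℤ) (x : E), τ ^ (-(m + 1)) • B m x = τ⁻¹ • B m (τ ^ (-m) • x) := by
    intro m x
    rw [map_smul, smul_smul]
    congr 1
    rw [neg_add, zpow_add₀ hτ.ne', zpow_neg_one, mul_comm]
  have hPe := proj_orbit hinv he
  have hp1 : ∀ m, τ ^ (-(m + 1)) • P (m + 1) (e (m + 1))
      = scale τ⁻¹ (B m) (τ ^ (-m) • P m (e m)) := by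
    intro m
    rw [scale_apply hτi, hPe, hzs]
  have hq1 : ∀ m, τ ^ (-(m + 1)) • (e (m + 1) - P (m + 1) (e (m + 1)))
      = scale τ⁻¹ (B m) (τ ^ (-m) • (e m - P m (e m))) := by
    intro m
    rw [scale_apply hτi, hPe, he, ← map_sub, hzs]
  have c1 := cocZ_orbit (A := fun n => scale τ⁻¹ (B n)) (e := fun m => τ ^ (-m) • P m (e m))
    hp1 (n + j) n
  have c2 := cocZ_orbit (A := fun n => scale τ⁻¹ (B n))
    (e := fun m => τ ^ (-m) • (e m - P m (e m))) hq1 n (n + j)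
  have hexp : Real.exp (-lam * (((n + j : ℤ) : ℝ) - n)) = Real.exp (-lam) ^ j := by
    rw [← Real.exp_nat_mul]
    congr 1
    push_cast
    ring
  have b1 := (hb (n + j) n (by omega) (τ ^ (-n) • e n)).1
  have b2 := (hb (n + j) n (by omega) (τ ^ (-(n + j : ℤ)) • e (n + j))).2.1
  simp only [map_smul, ← smul_sub] at b1 b2 c1 c2
  rw [c1, hexp, (hN _).smul, (hN _).smul, abs_of_pos (zpow_pos hτ _),
    abs_of_pos (zpow_pos hτ _)] at b1
  rw [c2, hexp, (hN _).smul, (hN _).smul, abs_of_pos (zpow_pos hτ _),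
    abs_of_pos (zpow_pos hτ _)] at b2
  have hz : τ ^ (-(n + j : ℤ)) = τ ^ (-n) / τ ^ j := by
    rw [neg_add, zpow_add₀ hτ.ne', zpow_neg τ (j : ℤ), zpow_natCast]
    rfl
  have hnpos : 0 < τ ^ (-n) := zpow_pos hτ _
  have hjpos : 0 < τ ^ j := pow_pos hτ _
  rw [hz] at b1 b2
  constructor
  · rw [mul_pow]
    have : τ ^ (-n) / τ ^ j * N (n + j) (P (n + j) (e (n + j)))
      = τ ^ (-n) * (N (n + j) (P (n + j) (e (n + j))) / τ ^ j) := by ring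
    rw [this, show K * Real.exp (-lam) ^ j * (τ ^ (-n) * N n (e n))
      = τ ^ (-n) * (K * Real.exp (-lam) ^ j * N n (e n)) by ring] at b1
    have := le_of_mul_le_mul_left b1 hnpos
    rw [div_le_iff₀ hjpos] at this
    linarith
  · rw [div_pow]
    rw [show K * Real.exp (-lam) ^ j * (τ ^ (-n) / τ ^ j * N (n + j) (e (n + j)))
      = τ ^ (-n) * (K * (Real.exp (-lam) ^ j / τ ^ j) * N (n + j) (e (n + j))) by ring] at b2
    exact le_of_mul_le_mul_left b2 hnpos

lemma DichAt.robust {B : ℤ → (E ≃L[ℝ] E)} {N : ℤ → E → ℝ} (hN : ∀ n, IsNormOn (N n)) {τ : ℝ}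
    (hτ : 0 < τ) {P : ℤ → (E →L[ℝ] E)} (h : DichAt B N τ P) :
    ∀ᶠ τ' in 𝓝 τ, DichAt B N τ' P := by
  obtain ⟨hP, hB, K, σ, hK, hσ, hσ1, hb⟩ := h
  have h1 : τ * σ < τ := by nlinarith
  have h2 : τ < τ / σ := by rw [lt_div_iff₀ hσ]; exact h1
  filter_upwards [Ioo_mem_nhds h1 h2] with τ' hτ'
  have hp : 0 < τ' := lt_trans (by positivity) hτ'.1
  have ha : τ * σ / τ' < 1 := by rw [div_lt_one hp]; exact hτ'.1
  have hb' : σ * τ' / τ < 1 := by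
    rw [div_lt_one hτ, mul_comm, ← lt_div_iff₀ hσ]
    exact hτ'.2
  refine ⟨hP, hB, K, max (τ * σ / τ') (σ * τ' / τ), hK, lt_max_of_lt_left (by positivity),
    max_lt ha hb', fun e he n j => ⟨?_, ?_⟩⟩
  · refine (hb e he n j).1.trans ?_
    have h3 : τ * σ ≤ τ' * max (τ * σ / τ') (σ * τ' / τ) := by
      calc τ * σ = τ' * (τ * σ / τ') := by field_simp
        _ ≤ _ := by gcongr; exact le_max_left _ _
    have := (hN n).nonneg (e n)
    gcongr
  · refine (hb e he n j).2.trans ?_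
    have h3 : σ / τ ≤ max (τ * σ / τ') (σ * τ' / τ) / τ' := by
      calc σ / τ = (σ * τ' / τ) / τ' := by field_simp
        _ ≤ _ := by gcongr; exact le_max_right _ _
    have := (hN (n + j)).nonneg (e (n + j))
    gcongr

lemma eq_zero_of_geom {N : E → ℝ} (hN : IsNormOn N) {x : E} {D σ : ℝ} (hσ : 0 ≤ σ) (hσ1 : σ < 1)
    (h : ∀ j : ℕ, N x ≤ D * σ ^ j) : x = 0 := by
  apply hN.eq_zero_of_le
  have := (tendsto_pow_atTop_nhds_zero_of_lt_one hσ hσ1).const_mul D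
  rw [mul_zero] at this
  exact ge_of_tendsto' this h

lemma DichAt.unique {B : ℤ → (E ≃L[ℝ] E)} {N : ℤ → E → ℝ} (hN : ∀ n, IsNormOn (N n)) {τ : ℝ}
    (hτ : 0 < τ) {P P' : ℤ → (E →L[ℝ] E)} (h : DichAt B N τ P) (h' : DichAt B N τ P') :
    P = P' := by
  obtain ⟨hP, hB, K, σ, hK, hσ, hσ1, hb⟩ := h
  obtain ⟨hP', hB', K', σ', hK', hσ', hσ1', hb'⟩ := h'
  have hss : σ * σ' < 1 := by nlinarith
  funext n
  ext x
  set e : ℤ → E := fun m => cocZ B m n x with he_def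
  have he : ∀ m, e (m + 1) = B m (e m) := fun m => cocZ_succ B m n x
  have hen : e n = x := cocZ_self B n x
  have hPe := proj_orbit hB he
  have hQe : ∀ m, e (m + 1) - P (m + 1) (e (m + 1)) = B m (e m - P m (e m)) := by
    intro m
    rw [hPe, he, map_sub]
  have key1 : P n x - P' n (P n x) = 0 := by
    refine eq_zero_of_geom (hN n) (D := K' * K * N n x) (σ := σ * σ') (by positivity) hss
      fun j => ?_
    have h1 := (hb' (fun m => P m (e m)) hPe n j).2
    have h2 := (hb _ he n j).1
    simp only [hen] at h1 h2
    refine h1.trans ((mul_le_mul_of_nonneg_left h2 (by positivity)).trans (le_of_eq ?_))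
    rw [div_pow, mul_pow, mul_pow]
    field_simp
  have key2 : P' n (x - P n x) = 0 := by
    refine eq_zero_of_geom (hN n) (D := K' * K * N n x) (σ := σ * σ') (by positivity) hss
      fun j => ?_
    have h1 := (hb' (fun m => e m - P m (e m)) hQe (n - j) j).1
    have h2 := (hb _ he (n - j) j).2
    simp only [sub_add_cancel, hen] at h1 h2
    refine h1.trans ((mul_le_mul_of_nonneg_left h2 (by positivity)).trans (le_of_eq ?_))
    rw [div_pow, mul_pow, mul_pow]
    field_simp
  rw [map_sub, sub_eq_zero] at key2
  rw [sub_eq_zero] at key1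
  rw [key2, ← key1]

/-! ### Weights and solvability of the inhomogeneous linear equation -/

/-- Weights whose growth rate lies in `[lo, hi]`. -/
structure Adm (lo hi : ℝ) (w : ℤ → ℝ) : Prop where
  pos : ∀ m, 0 < w m
  le_succ : ∀ m, lo * w m ≤ w (m + 1)
  succ_le : ∀ m, w (m + 1) ≤ hi * w m

lemma Adm.le_add {lo hi : ℝ} {w : ℤ → ℝ} (hlo : 0 ≤ lo) (hw : Adm lo hi w) (m : ℤ) (j : ℕ) :
    lo ^ j * w m ≤ w (m + j) := by
  induction j with
  | zero => simp
  | succ j ih =>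
    have := hw.le_succ (m + j)
    push_cast
    rw [← add_assoc, pow_succ]
    nlinarith

lemma Adm.add_le {lo hi : ℝ} {w : ℤ → ℝ} (hhi : 0 ≤ hi) (hw : Adm lo hi w) (m : ℤ) (j : ℕ) :
    w (m + j) ≤ hi ^ j * w m := by
  induction j with
  | zero => simp
  | succ j ih =>
    have := hw.succ_le (m + j)
    push_cast
    rw [← add_assoc, pow_succ]
    nlinarith

/-- The equation `u (m + 1) = B m (u m) + r m` is uniquely solvable in the spaces of sequences
dominated by a weight with growth rates in `[lo, hi]`. -/
structure Solv (B : ℤ → (E ≃L[ℝ] E)) (N : ℤ → E → ℝ) (lo hi C : ℝ) : Prop where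
  ex : ∀ w, Adm lo hi w → ∀ r : ℤ → E, (∀ m, N (m + 1) (r m) ≤ w m) →
    ∃ u : ℤ → E, (∀ m, u (m + 1) = B m (u m) + r m) ∧ ∀ m, N m (u m) ≤ C * w m
  uniq : ∀ w, Adm lo hi w → ∀ (e : ℤ → E) (D : ℝ), (∀ m, e (m + 1) = B m (e m)) →
    (∀ m, N m (e m) ≤ D * w m) → ∀ m, e m = 0

lemma summable_of_geom [FiniteDimensional ℝ E] {N : E → ℝ} (hN : IsNormOn N) {g : ℕ → E}
    {D σ : ℝ} (hσ : 0 ≤ σ) (hσ1 : σ < 1) (h : ∀ j, N (g j) ≤ D * σ ^ j) :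
    Summable g ∧ N (∑' j, g j) ≤ D * (1 - σ)⁻¹ := by
  have : CompleteSpace E := FiniteDimensional.complete ℝ E
  obtain ⟨c, hc, hcN⟩ := hN.exists_norm_le
  have hD : HasSum (fun j => D * σ ^ j) (D * (1 - σ)⁻¹) :=
    (hasSum_geometric_of_lt_one hσ hσ1).mul_left D
  have hs : Summable g := by
    refine Summable.of_norm_bounded (hD.summable.mul_left c) fun j => ?_
    exact (hcN _).trans (by gcongr; exact h j)
  refine ⟨hs, ?_⟩
  refine le_of_tendsto ((hN.continuous.tendsto _).comp hs.hasSum.tendsto_sum_nat)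
    (Eventually.of_forall fun k => ?_)
  refine (hN.sum_le _ _).trans ((Finset.sum_le_sum fun j _ => h j).trans ?_)
  refine sum_le_hasSum _ (fun j _ => (hN.nonneg _).trans (h j)) hD

lemma solv_of_dichAt [FiniteDimensional ℝ E] {B : ℤ → (E ≃L[ℝ] E)} {N : ℤ → E → ℝ}
    (hN : ∀ n, IsNormOn (N n)) {lo hi : ℝ} (hlo : 0 < lo) (hhi : 0 < hi) {P : ℤ → (E →L[ℝ] E)}
    (h : DichAt B N lo P) (h' : DichAt B N hi P) : ∃ C, Solv B N lo hi C := by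
  obtain ⟨hP, hB, K, σ, hK, hσ, hσ1, hb⟩ := h
  obtain ⟨-, -, K', σ', hK', hσ', hσ1', hb'⟩ := h'
  refine ⟨K * lo⁻¹ * (1 - σ)⁻¹ + K' * hi⁻¹ * (1 - σ')⁻¹, ?_, ?_⟩
  · intro w hw r hr
    let gs : ℤ → ℕ → E := fun m j => P m (cocZ B m (m - j) (r (m - j - 1)))
    let gu : ℤ → ℕ → E := fun m j =>
      cocZ B m (m + j + 1) (r (m + j)) - P m (cocZ B m (m + j + 1) (r (m + j)))
    have hgs : ∀ m j, N m (gs m j) ≤ K * lo⁻¹ * w m * σ ^ j := by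
      intro m j
      have h1 := (hb (fun l => cocZ B l (m - j) (r (m - j - 1))) (fun l => cocZ_succ B l _ _)
        (m - j) j).1
      simp only [sub_add_cancel, cocZ_self] at h1
      have h2 := hr (m - j - 1)
      have h3 := hw.le_add hlo.le (m - j - 1) (j + 1)
      rw [show m - j - 1 + ((j + 1 : ℕ) : ℤ) = m by push_cast; ring] at h3
      rw [sub_add_cancel] at h2
      refine h1.trans ?_
      have h4 : lo ^ j * w (m - j - 1) ≤ lo⁻¹ * w m := by
        rw [pow_succ] at h3
        rw [← div_eq_inv_mul, le_div_iff₀ hlo]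
        linarith
      calc K * (lo * σ) ^ j * N (m - j) (r (m - j - 1)) ≤ K * (lo * σ) ^ j * w (m - j - 1) := by
            gcongr
        _ = K * σ ^ j * (lo ^ j * w (m - j - 1)) := by rw [mul_pow]; ring
        _ ≤ K * σ ^ j * (lo⁻¹ * w m) := by gcongr
        _ = _ := by ring
    have hgu : ∀ m j, N m (gu m j) ≤ K' * hi⁻¹ * w m * σ' ^ j := by
      intro m j
      have h1 := (hb' (fun l => cocZ B l (m + j + 1) (r (m + j))) (fun l => cocZ_succ B l _ _)
        m (j + 1)).2
      push_cast at h1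
      simp only [← add_assoc, cocZ_self] at h1
      have h2 := hr (m + j)
      have h3 := hw.add_le hhi.le m j
      refine h1.trans ?_
      calc K' * (σ' / hi) ^ (j + 1) * N (m + j + 1) (r (m + j))
          ≤ K' * (σ' / hi) ^ (j + 1) * (hi ^ j * w m) := by gcongr; linarith
        _ = K' * hi⁻¹ * w m * σ' ^ j * σ' := by
            rw [div_pow, pow_succ, pow_succ]
            field_simp
        _ ≤ K' * hi⁻¹ * w m * σ' ^ j * 1 := by
            have := (hw.pos m).le
            gcongr
        _ = _ := mul_one _
    have hss := fun m => summable_of_geom (hN m) hσ.le hσ1 (hgs m)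
    have hsu := fun m => summable_of_geom (hN m) hσ'.le hσ1' (hgu m)
    refine ⟨fun m => (∑' j, gs m j) - ∑' j, gu m j, fun m => ?_, fun m => ?_⟩
    · have e1 : ∑' j, gs (m + 1) j = P (m + 1) (r m) + B m (∑' j, gs m j) := by
        rw [(hss (m + 1)).1.tsum_eq_zero_add, ContinuousLinearEquiv.map_tsum]
        congr 1
        · simp only [gs, Nat.cast_zero, sub_zero, cocZ_self, add_sub_cancel_right]
        · congr 1
          funext j
          simp only [gs]
          push_cast
          rw [add_sub_add_right_eq_sub, cocZ_succ, hB]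
      have e2 : B m (∑' j, gu m j) = (r m - P (m + 1) (r m)) + ∑' j, gu (m + 1) j := by
        rw [(hsu m).1.tsum_eq_zero_add, map_add, ContinuousLinearEquiv.map_tsum]
        congr 1
        · simp only [gu, Nat.cast_zero, add_zero, map_sub, hB, ← cocZ_succ, cocZ_self]
        · congr 1
          funext j
          simp only [gu]
          push_cast
          rw [map_sub, hB, ← cocZ_succ]
          simp only [add_comm, add_left_comm]
      simp only [map_sub, e1, e2]
      abel
    · refine ((hN m).sub_le _ _).trans ?_
      have a1 := (hss m).2
      have a2 := (hsu m).2
      linarith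
  · intro w hw e D he hD n
    have h1 : P n (e n) = 0 := by
      refine eq_zero_of_geom (hN n) (D := K * |D| * w n) hσ.le hσ1 fun j => ?_
      have h1 := (hb e he (n - j) j).1
      have h3 := hw.le_add hlo.le (n - j) j
      rw [sub_add_cancel] at h1 h3
      refine h1.trans ?_
      have h2 : N (n - j) (e (n - j)) ≤ |D| * w (n - j) :=
        (hD _).trans (mul_le_mul_of_nonneg_right (le_abs_self D) (hw.pos _).le)
      calc K * (lo * σ) ^ j * N (n - j) (e (n - j))
          ≤ K * (lo * σ) ^ j * (|D| * w (n - j)) := by gcongr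
        _ = K * |D| * σ ^ j * (lo ^ j * w (n - j)) := by rw [mul_pow]; ring
        _ ≤ K * |D| * σ ^ j * w n := by gcongr
        _ = _ := by ring
    have h2 : e n - P n (e n) = 0 := by
      refine eq_zero_of_geom (hN n) (D := K' * |D| * w n) hσ'.le hσ1' fun j => ?_
      have h1 := (hb' e he n j).2
      have h3 := hw.add_le hhi.le n j
      refine h1.trans ?_
      have h2 : N (n + j) (e (n + j)) ≤ |D| * w (n + j) :=
        (hD _).trans (mul_le_mul_of_nonneg_right (le_abs_self D) (hw.pos _).le)
      calc K' * (σ' / hi) ^ j * N (n + j) (e (n + j))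
          ≤ K' * (σ' / hi) ^ j * (|D| * (hi ^ j * w n)) := by
            gcongr
            exact h2.trans (by gcongr)
        _ = _ := by
            rw [div_pow]
            field_simp
    rwa [h1, sub_zero] at h2

lemma exists_solv [FiniteDimensional ℝ E] {B : ℤ → (E ≃L[ℝ] E)} {N : ℤ → E → ℝ}
    (hN : ∀ n, IsNormOn (N n)) {lo hi : ℝ} (hlo : 0 < lo) (hle : lo ≤ hi)
    (h : ∀ τ ∈ Set.Icc lo hi, τ ∉ SigmaEDZ B N) : ∃ C, Solv B N lo hi C := by
  have hpos : ∀ τ ∈ Set.Icc lo hi, 0 < τ := fun τ hτ => hlo.trans_le hτ.1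
  have hex : ∀ τ ∈ Set.Icc lo hi, ∃ P, DichAt B N τ P := fun τ hτ => by
    refine exists_dichAt hN (hpos τ hτ) ?_
    by_contra hcon
    exact h τ hτ ⟨hpos τ hτ, hcon⟩
  choose! P hP using hex
  have hconst : P lo = P hi := by
    refine isPreconnected_Icc.induction₂ (fun τ τ' => P τ = P τ') ?_ (fun _ _ _ _ _ _ => Eq.trans)
      (fun _ _ _ _ => Eq.symm) (Set.left_mem_Icc.2 hle) (Set.right_mem_Icc.2 hle)
    intro τ hτ
    filter_upwards [self_mem_nhdsWithin,
      nhdsWithin_le_nhds ((hP τ hτ).robust hN (hpos τ hτ))] with τ' hτ' hr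
    exact hr.unique hN (hpos τ' hτ') (hP τ' hτ')
  refine solv_of_dichAt hN hlo (hlo.trans_le hle) (hP lo (Set.left_mem_Icc.2 hle)) ?_
  rw [hconst]
  exact hP hi (Set.right_mem_Icc.2 hle)

lemma exists_step_bound {B : ℤ → (E ≃L[ℝ] E)} {N : ℤ → E → ℝ} (hN : ∀ n, IsNormOn (N n))
    (h : StrongExpDichotomyZWRT B N) : ∃ A : ℝ, 1 ≤ A ∧ (∀ n x, N (n + 1) (B n x) ≤ A * N n x) ∧
      ∀ n x, N n x ≤ A * N (n + 1) (B n x) := by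
  obtain ⟨K, lam, a, hK, hlam, -, P, -, -, hb⟩ := h
  have key : ∀ n x, N (n + 1) (B n x) ≤ max 1 (K * Real.exp a) * N n x ∧
      N n x ≤ max 1 (K * Real.exp a) * N (n + 1) (B n x) := by
    intro n x
    have he : ∀ m, cocZ B (m + 1) n x = B m (cocZ B m n x) := fun m => cocZ_succ B m n x
    have b1 := (hb (n + 1) n (by omega) x).2.2.1
    have b2 := (hb (n + 1) n (by omega) (B n x)).2.2.2
    have c2 := cocZ_orbit (e := fun m => cocZ B m n x) he n (n + 1)
    beta_reduce at c2
    rw [he, cocZ_self] at c2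
    rw [he, cocZ_self] at b1
    rw [c2] at b2
    have hexp : Real.exp (a * (((n + 1 : ℤ) : ℝ) - n)) = Real.exp a := by
      congr 1
      push_cast
      ring
    rw [hexp] at b1 b2
    exact ⟨b1.trans (mul_le_mul_of_nonneg_right (le_max_right _ _) ((hN _).nonneg _)),
      b2.trans (mul_le_mul_of_nonneg_right (le_max_right _ _) ((hN _).nonneg _))⟩
  exact ⟨_, le_max_left _ _, fun n x => (key n x).1, fun n x => (key n x).2⟩

/-! ### Gaps: perturbation of the inhomogeneous linear equation -/

lemma Adm.mono {lo hi lo' hi' : ℝ} {w : ℤ → ℝ} (hw : Adm lo' hi' w) (hlo : lo ≤ lo')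
    (hhi : hi' ≤ hi) : Adm lo hi w where
  pos := hw.pos
  le_succ m := (mul_le_mul_of_nonneg_right hlo (hw.pos m).le).trans (hw.le_succ m)
  succ_le m := (hw.succ_le m).trans (mul_le_mul_of_nonneg_right hhi (hw.pos m).le)

lemma Adm.const_mul {lo hi : ℝ} {w : ℤ → ℝ} (hw : Adm lo hi w) {D : ℝ} (hD : 0 < D) :
    Adm lo hi (fun m => D * w m) where
  pos m := mul_pos hD (hw.pos m)
  le_succ m := by
    rw [mul_left_comm]
    exact mul_le_mul_of_nonneg_left (hw.le_succ m) hD.le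
  succ_le m := by
    rw [mul_left_comm]
    exact mul_le_mul_of_nonneg_left (hw.succ_le m) hD.le

lemma Adm.add {lo hi : ℝ} {w w' : ℤ → ℝ} (hw : Adm lo hi w) (hw' : Adm lo hi w') :
    Adm lo hi (fun m => w m + w' m) where
  pos m := add_pos (hw.pos m) (hw'.pos m)
  le_succ m := by
    rw [mul_add]
    exact add_le_add (hw.le_succ m) (hw'.le_succ m)
  succ_le m := by
    rw [mul_add]
    exact add_le_add (hw.succ_le m) (hw'.succ_le m)

/-- `Solv` together with a smallness condition on the perturbation size `η`. -/
structure Gap (B : ℤ → (E ≃L[ℝ] E)) (N : ℤ → E → ℝ) (η lo hi C : ℝ) : Prop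
    extends Solv B N lo hi C where
  C_pos : 0 < C
  eta_nonneg : 0 ≤ η
  small : 2 * C * η ≤ 1

/-- `y` is an orbit of the nonautonomous system `B n + f n`. -/
def IsOrbit (B : ℤ → (E ≃L[ℝ] E)) (f : ℤ → E → E) (y : ℤ → E) : Prop :=
  ∀ m, y (m + 1) = B m (y m) + f m (y m)

section gap

variable {B : ℤ → (E ≃L[ℝ] E)} {N : ℤ → E → ℝ} {η L lo hi C : ℝ} {f : ℤ → E → E}

lemma Gap.mono (G : Gap B N η lo hi C) {lo' hi' : ℝ} (hlo : lo ≤ lo') (hhi : hi' ≤ hi) :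
    Gap B N η lo' hi' C where
  ex w hw := G.ex w (hw.mono hlo hhi)
  uniq w hw := G.uniq w (hw.mono hlo hhi)
  C_pos := G.C_pos
  eta_nonneg := G.eta_nonneg
  small := G.small

lemma Gap.exists_bound (hN : ∀ n, IsNormOn (N n)) (G : Gap B N η lo hi C) {w : ℤ → ℝ}
    (hw : Adm lo hi w) {D : ℝ} (hD : 0 ≤ D) {r : ℤ → E} (hr : ∀ m, N (m + 1) (r m) ≤ D * w m) :
    ∃ u : ℤ → E, (∀ m, u (m + 1) = B m (u m) + r m) ∧ ∀ m, N m (u m) ≤ C * D * w m := by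
  rcases hD.eq_or_lt with rfl | hD
  · refine ⟨fun _ => 0, fun m => ?_, fun m => ?_⟩
    · have := (hN (m + 1)).eq_zero_of_le (x := r m) (by simpa using hr m)
      simp [this]
    · simp [(hN m).map_zero]
  · obtain ⟨u, hu, hub⟩ := G.ex _ (hw.const_mul hD) r hr
    exact ⟨u, hu, fun m => by rw [mul_assoc]; exact hub m⟩

/-- A sequence dominated by an admissible weight inherits the bound of its residual. -/
lemma Gap.bound_of_residual (hN : ∀ n, IsNormOn (N n)) (G : Gap B N η lo hi C) {w : ℤ → ℝ}
    (hw : Adm lo hi w) {D D' : ℝ} (hD : 0 ≤ D) {e : ℤ → E}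
    (hr : ∀ m, N (m + 1) (e (m + 1) - B m (e m)) ≤ D * w m) (he : ∀ m, N m (e m) ≤ D' * w m)
    (m : ℤ) : N m (e m) ≤ C * D * w m := by
  obtain ⟨u, hu, hub⟩ := G.exists_bound hN hw hD (r := fun m => e (m + 1) - B m (e m)) hr
  have h0 := G.uniq w hw (fun m => u m - e m) (C * D + D') (fun m => by
    simp only [hu, map_sub]
    abel) (fun m => by
    have := (hN m).sub_le (u m) (e m)
    have h1 := hub m
    have h2 := he m
    linarith) m
  have h1 : u m = e m := sub_eq_zero.1 h0
  rw [← h1]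
  exact hub m

/-- A priori estimate. -/
lemma Gap.apriori (hN : ∀ n, IsNormOn (N n)) (G : Gap B N η lo hi C) {w w₁ : ℤ → ℝ}
    (hw : Adm lo hi w) (hw₁ : Adm lo hi w₁) {D D₁ : ℝ} (hD : 0 ≤ D) {e : ℤ → E}
    (hr : ∀ m, N (m + 1) (e (m + 1) - B m (e m)) ≤ η * N m (e m) + D * w m)
    (he : ∀ m, N m (e m) ≤ D₁ * w₁ m) (m : ℤ) : N m (e m) ≤ 2 * C * D * w m := by
  have hη := G.eta_nonneg
  have hC := G.C_pos
  have key : ∀ t : ℝ, 0 < t → ∀ m, N m (e m) ≤ 2 * C * ((D + t) * w m + t * w₁ m) := by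
    intro t ht
    have hω : Adm lo hi (fun m => (D + t) * w m + t * w₁ m) :=
      (hw.const_mul (by linarith)).add (hw₁.const_mul ht)
    set ω : ℤ → ℝ := fun m => (D + t) * w m + t * w₁ m with hωd
    have hit : ∀ j : ℕ, ∀ m, N m (e m) ≤ (2 * C + |D₁| / t * (1 / 2) ^ j) * ω m := by
      intro j
      induction j with
      | zero =>
        intro m
        have h1 : N m (e m) ≤ |D₁| * w₁ m :=
          (he m).trans (mul_le_mul_of_nonneg_right (le_abs_self _) (hw₁.pos m).le)
        have h2 : |D₁| * w₁ m = |D₁| / t * (t * w₁ m) := by field_simp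
        have h3 : |D₁| / t * (t * w₁ m) ≤ |D₁| / t * ω m := by
          have := hw.pos m
          have h4 : 0 ≤ (D + t) * w m := by positivity
          gcongr
          simp only [hωd]
          linarith
        have h5 := hω.pos m
        have h6 : 0 ≤ 2 * C * ω m := by positivity
        rw [pow_zero, mul_one, add_mul]
        linarith
      | succ j ih =>
        intro m
        set s := 2 * C + |D₁| / t * (1 / 2) ^ j with hs
        have hs0 : 0 ≤ s := by positivity
        have h1 := G.bound_of_residual hN hω (D := η * s + 1) (D' := s) (by positivity) (e := e)
          (fun m => by
            refine (hr m).trans ?_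
            have h2 := mul_le_mul_of_nonneg_left (ih m) hη
            have h3 : D * w m ≤ ω m := by
              have := hw.pos m
              have := hw₁.pos m
              have : 0 ≤ t * w m + t * w₁ m := by positivity
              simp only [hωd]
              linarith
            linarith) ih m
        refine h1.trans (mul_le_mul_of_nonneg_right ?_ (hω.pos m).le)
        have h4 : C * η * s ≤ 1 / 2 * s :=
          mul_le_mul_of_nonneg_right (by linarith [G.small]) hs0
        rw [pow_succ]
        rw [hs] at h4 ⊢
        linarith
    intro m
    have hlim : Tendsto (fun j : ℕ => (2 * C + |D₁| / t * (1 / 2) ^ j) * ω m) atTop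
        (𝓝 ((2 * C + |D₁| / t * 0) * ω m)) :=
      (((tendsto_pow_atTop_nhds_zero_of_lt_one (by norm_num) (by norm_num)).const_mul _).const_add
        _).mul_const _
    rw [mul_zero, add_zero] at hlim
    exact ge_of_tendsto' hlim fun j => hit j m
  have hlim : Tendsto (fun t : ℝ => 2 * C * ((D + t) * w m + t * w₁ m)) (𝓝[>] 0)
      (𝓝 (2 * C * ((D + 0) * w m + 0 * w₁ m))) := by
    have : Continuous (fun t : ℝ => 2 * C * ((D + t) * w m + t * w₁ m)) := by fun_prop
    exact (this.tendsto 0).mono_left nhdsWithin_le_nhds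
  have := ge_of_tendsto hlim (by
    filter_upwards [self_mem_nhdsWithin] with t ht
    exact key t ht m)
  simpa [mul_assoc] using this

/-- Fixed point theorem for Lipschitz nonlinearities. -/
lemma Gap.exists_fixed [FiniteDimensional ℝ E] (hN : ∀ n, IsNormOn (N n))
    (G : Gap B N η lo hi C) {w : ℤ → ℝ} (hw : Adm lo hi w) {D : ℝ} (hD : 0 ≤ D)
    {Φ : ℤ → E → E} (hΦ : ∀ m x y, N (m + 1) (Φ m x - Φ m y) ≤ η * N m (x - y))
    (hΦ0 : ∀ m, N (m + 1) (Φ m 0) ≤ D * w m) :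
    ∃ u : ℤ → E, (∀ m, u (m + 1) = B m (u m) + Φ m (u m)) ∧ ∀ m, N m (u m) ≤ 2 * C * D * w m := by
  have : CompleteSpace E := FiniteDimensional.complete ℝ E
  have hη := G.eta_nonneg
  have hC := G.C_pos
  have hsmall := G.small
  let S := {u : ℤ → E // ∀ m, N m (u m) ≤ 2 * C * D * w m}
  have hstep : ∀ u : S, ∃ v : S, ∀ m, v.1 (m + 1) = B m (v.1 m) + Φ m (u.1 m) := by
    rintro ⟨u, hu⟩
    obtain ⟨v, hv, hvb⟩ := G.exists_bound hN hw (D := 2 * D) (by positivity)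
      (r := fun m => Φ m (u m)) (fun m => by
        have h1 := (hN (m + 1)).le_of_eq_add (x := Φ m (u m) - Φ m 0) (y := Φ m 0) (z := Φ m (u m))
          (by abel)
        have h2 := hΦ m (u m) 0
        rw [sub_zero] at h2
        have h3 := mul_le_mul_of_nonneg_left (hu m) hη
        have h4 : 2 * C * η * (D * w m) ≤ 1 * (D * w m) :=
          mul_le_mul_of_nonneg_right hsmall (mul_nonneg hD (hw.pos m).le)
        have h5 := hΦ0 m
        linarith)
    exact ⟨⟨v, fun m => by have := hvb m; linarith⟩, hv⟩
  choose step hstep using hstep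
  let U : ℕ → S := fun j => Nat.rec ⟨fun _ => 0, fun m => by
    rw [(hN m).map_zero]
    have := hw.pos m
    positivity⟩ (fun _ u => step u) j
  have hU : ∀ j m, (U (j + 1)).1 (m + 1) = B m ((U (j + 1)).1 m) + Φ m ((U j).1 m) := fun j m =>
    hstep (U j) m
  have hdiff : ∀ j m, N m ((U (j + 1)).1 m - (U j).1 m) ≤ 2 * C * D * (1 / 2) ^ j * w m := by
    intro j
    induction j with
    | zero =>
      intro m
      have h0 : (U 0).1 m = 0 := rfl
      rw [h0, sub_zero, pow_zero, mul_one]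
      exact (U (0 + 1)).2 m
    | succ j ih =>
      intro m
      have h1 := G.bound_of_residual hN hw (D := η * (2 * C * D * (1 / 2) ^ j))
        (D' := 2 * (2 * C * D)) (by positivity)
        (e := fun m => (U (j + 1 + 1)).1 m - (U (j + 1)).1 m) (fun m => by
          simp only [hU, map_sub]
          have h2 := (hΦ m ((U (j + 1)).1 m) ((U j).1 m)).trans
            (mul_le_mul_of_nonneg_left (ih m) hη)
          rw [← mul_assoc] at h2
          refine le_trans (le_of_eq ?_) h2
          congr 1
          abel) (fun m => by
          have h2 := (U (j + 1 + 1)).2 m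
          have h3 := (U (j + 1)).2 m
          have h4 := (hN m).sub_le ((U (j + 1 + 1)).1 m) ((U (j + 1)).1 m)
          linarith) m
      refine h1.trans (mul_le_mul_of_nonneg_right ?_ (hw.pos m).le)
      have h4 : 2 * C * η * (C * D * (1 / 2) ^ j) ≤ 1 * (C * D * (1 / 2) ^ j) :=
        mul_le_mul_of_nonneg_right hsmall (by positivity)
      rw [pow_succ]
      linarith
  have hcau : ∀ m, ∃ l, Tendsto (fun j => (U j).1 m) atTop (𝓝 l) := by
    intro m
    obtain ⟨c, hc, hcN⟩ := (hN m).exists_norm_le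
    refine cauchySeq_tendsto_of_complete (cauchySeq_of_le_geometric (1 / 2)
      (c * (2 * C * D * w m)) (by norm_num) fun j => ?_)
    rw [dist_comm, dist_eq_norm]
    refine (hcN _).trans ?_
    have := mul_le_mul_of_nonneg_left (hdiff j m) hc.le
    linarith
  choose u hu using hcau
  have hΦc : ∀ m, Continuous (Φ m) := by
    intro m
    obtain ⟨c, hc, hcN⟩ := (hN (m + 1)).exists_norm_le
    obtain ⟨c', hc', hcN'⟩ := (hN m).exists_le_norm
    refine (LipschitzWith.of_dist_le_mul (K := (c * (η * c')).toNNReal) fun x y => ?_).continuous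
    rw [Real.coe_toNNReal _ (by positivity), dist_eq_norm, dist_eq_norm]
    calc ‖Φ m x - Φ m y‖ ≤ c * (η * N m (x - y)) := (hcN _).trans (by gcongr; exact hΦ m x y)
      _ ≤ c * (η * (c' * ‖x - y‖)) := by gcongr; exact hcN' _
      _ = _ := by ring
  refine ⟨u, fun m => ?_, fun m => ?_⟩
  · refine tendsto_nhds_unique ((tendsto_add_atTop_iff_nat 1).2 (hu (m + 1))) ?_
    simp only [hU]
    exact (((B m).continuous.tendsto _).comp ((tendsto_add_atTop_iff_nat 1).2 (hu m))).add
      (((hΦc m).tendsto _).comp (hu m))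
  · exact le_of_tendsto' (((hN m).continuous.tendsto _).comp (hu m)) fun j => (U j).2 m

/-- Shadowing of pseudo-orbits. -/
lemma Gap.exists_shadow [FiniteDimensional ℝ E] (hN : ∀ n, IsNormOn (N n))
    (G : Gap B N η lo hi C) (hf : Pert N η L f) {w : ℤ → ℝ} (hw : Adm lo hi w) {D : ℝ}
    (hD : 0 ≤ D) {χ : ℤ → E}
    (hχ : ∀ m, N (m + 1) (χ (m + 1) - B m (χ m) - f m (χ m)) ≤ D * w m) :
    ∃ y, IsOrbit B f y ∧ ∀ m, N m (y m - χ m) ≤ 2 * C * D * w m := by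
  obtain ⟨u, hu, hub⟩ := G.exists_fixed hN hw hD
    (Φ := fun m x => f m (χ m + x) - (χ (m + 1) - B m (χ m))) (fun m x y => by
      have := hf.lip hN m (χ m + x) (χ m + y)
      rwa [add_sub_add_left_eq_sub, ← sub_sub_sub_cancel_right _ _ (χ (m + 1) - B m (χ m))] at this)
    (fun m => by
      rw [(hN _).sub_comm, add_zero]
      exact hχ m)
  refine ⟨fun m => χ m + u m, fun m => ?_, fun m => ?_⟩
  · simp only [hu, map_add]
    abel
  · rw [add_sub_cancel_left]
    exact hub m

lemma Gap.orbit_unique [FiniteDimensional ℝ E] (hN : ∀ n, IsNormOn (N n))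
    (G : Gap B N η lo hi C) (hf : Pert N η L f) {w : ℤ → ℝ} (hw : Adm lo hi w) {D : ℝ}
    {y y' : ℤ → E} (hy : IsOrbit B f y) (hy' : IsOrbit B f y')
    (h : ∀ m, N m (y m - y' m) ≤ D * w m) : y = y' := by
  funext m
  have := G.apriori hN hw hw (D := 0) le_rfl (e := fun m => y m - y' m) (fun m => by
    rw [zero_mul, add_zero]
    refine le_trans (le_of_eq ?_) (hf.lip hN m (y m) (y' m))
    simp only [hy m, hy' m, map_sub]
    congr 1
    abel) h m
  rw [mul_zero, zero_mul] at this
  exact sub_eq_zero.1 ((hN m).eq_zero_of_le this)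

/-- Lipschitz dependence of the shadowing orbit on the pseudo-orbit. -/
lemma Gap.shadow_lip [FiniteDimensional ℝ E] (hN : ∀ n, IsNormOn (N n))
    (G : Gap B N η lo hi C) (hf : Pert N η L f) {w w₁ : ℤ → ℝ} (hw : Adm lo hi w)
    (hw₁ : Adm lo hi w₁) {D₁ D₂ D₃ : ℝ} (hD₁ : 0 ≤ D₁) (hD₂ : 0 ≤ D₂) {χ χ' y y' : ℤ → E}
    (hy : IsOrbit B f y) (hy' : IsOrbit B f y')
    (h₁ : ∀ m, N (m + 1) ((χ' (m + 1) - B m (χ' m) - f m (χ' m)) -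
      (χ (m + 1) - B m (χ m) - f m (χ m))) ≤ D₁ * w m)
    (h₂ : ∀ m, N (m + 1) (f m (χ' m + (y m - χ m)) - f m (χ' m) -
      (f m (χ m + (y m - χ m)) - f m (χ m))) ≤ D₂ * w m)
    (h₃ : ∀ m, N m ((y' m - χ' m) - (y m - χ m)) ≤ D₃ * w₁ m) (m : ℤ) :
    N m ((y' m - χ' m) - (y m - χ m)) ≤ 2 * C * (D₁ + D₂) * w m := by
  refine G.apriori hN hw hw₁ (add_nonneg hD₁ hD₂) (e := fun m => (y' m - χ' m) - (y m - χ m))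
    (fun m => ?_) h₃ m
  have h4 := hf.lip hN m (y' m) (χ' m + (y m - χ m))
  have e4 : y' m - (χ' m + (y m - χ m)) = (y' m - χ' m) - (y m - χ m) := by abel
  rw [e4] at h4
  have e5 : (y' (m + 1) - χ' (m + 1)) - (y (m + 1) - χ (m + 1)) -
      B m ((y' m - χ' m) - (y m - χ m)) =
      ((f m (y' m) - f m (χ' m + (y m - χ m))) +
      (f m (χ' m + (y m - χ m)) - f m (χ' m) -
        (f m (χ m + (y m - χ m)) - f m (χ m)))) -
      ((χ' (m + 1) - B m (χ' m) - f m (χ' m)) - (χ (m + 1) - B m (χ m) - f m (χ m))) := by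
    rw [hy m, hy' m, add_sub_cancel]
    simp only [map_sub]
    abel
  have h6 := (hN (m + 1)).le_of_eq_sub e5
  have h7 := (hN (m + 1)).add_le (f m (y' m) - f m (χ' m + (y m - χ m)))
    (f m (χ' m + (y m - χ m)) - f m (χ' m) - (f m (χ m + (y m - χ m)) - f m (χ m)))
  have h8 := h₁ m
  have h9 := h₂ m
  linarith

end gap

/-! ### Differentiable dependence of shadowing orbits -/

lemma isNormOn_norm : IsNormOn (fun x : E => ‖x‖) :=
  ⟨norm_nonneg, fun _ => norm_eq_zero, fun c x => by
    simp only [norm_smul, Real.norm_eq_abs],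
    norm_add_le⟩

lemma IsNormOn.isLittleO_iff [FiniteDimensional ℝ E] {N : E → ℝ} (hN : IsNormOn N)
    {α F : Type*} [NormedAddCommGroup F] {l : Filter α} {g : α → E} {k : α → F} :
    g =o[l] k ↔ ∀ ε : ℝ, 0 < ε → ∀ᶠ p in l, N (g p) ≤ ε * ‖k p‖ := by
  obtain ⟨c, hc, hcN⟩ := hN.exists_norm_le
  obtain ⟨c', hc', hcN'⟩ := hN.exists_le_norm
  rw [Asymptotics.isLittleO_iff]
  constructor
  · intro h ε hε
    filter_upwards [h (c := ε / c') (by positivity)] with p hp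
    calc N (g p) ≤ c' * (ε / c' * ‖k p‖) := (hcN' _).trans (by gcongr)
      _ = _ := by field_simp
  · intro h ε hε
    filter_upwards [h (ε / c) (by positivity)] with p hp
    calc ‖g p‖ ≤ c * (ε / c * ‖k p‖) := (hcN _).trans (by gcongr)
      _ = _ := by field_simp

/-- Strict differentiability at `ξ` of every component of a family of sequences. -/
def StrictDiff (χ : E → ℤ → E) (ξ : E) : Prop :=
  ∀ m, ∃ χ' : E →L[ℝ] E, HasStrictFDerivAt (fun ζ => χ ζ m) χ' ξ

lemma StrictDiff.add {χ ψ : E → ℤ → E} {ξ : E} (hχ : StrictDiff χ ξ) (hψ : StrictDiff ψ ξ) :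
    StrictDiff (fun ζ m => χ ζ m + ψ ζ m) ξ := fun m => by
  obtain ⟨a, ha⟩ := hχ m
  obtain ⟨b, hb⟩ := hψ m
  exact ⟨a + b, ha.add hb⟩

lemma StrictDiff.sub {χ ψ : E → ℤ → E} {ξ : E} (hχ : StrictDiff χ ξ) (hψ : StrictDiff ψ ξ) :
    StrictDiff (fun ζ m => χ ζ m - ψ ζ m) ξ := fun m => by
  obtain ⟨a, ha⟩ := hχ m
  obtain ⟨b, hb⟩ := hψ m
  exact ⟨a - b, ha.sub hb⟩

lemma StrictDiff.lip [FiniteDimensional ℝ E] {N : ℤ → E → ℝ} (hN : ∀ n, IsNormOn (N n))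
    {χ : E → ℤ → E} {ξ : E} (hχ : StrictDiff χ ξ) (m : ℤ) :
    ∃ c : ℝ, 0 ≤ c ∧ ∀ᶠ p : E × E in 𝓝 (ξ, ξ), N m (χ p.1 m - χ p.2 m) ≤ c * ‖p.1 - p.2‖ := by
  obtain ⟨χ', h⟩ := hχ m
  obtain ⟨c, hc, hcN⟩ := (hN m).exists_le_norm
  have h1 := h.isBigO_sub
  obtain ⟨K, hK, hb⟩ := h1.exists_nonneg
  refine ⟨c * K, by positivity, ?_⟩
  filter_upwards [hb.bound] with p hp
  calc _ ≤ c * (K * ‖p.1 - p.2‖) := (hcN _).trans (by gcongr)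
    _ = _ := by ring

section decay

variable {lo hi κ : ℝ} {w : ℤ → ℝ}

lemma Adm.mul_decay (hκ : 0 < κ) (hκ1 : κ < 1) (hw : Adm lo hi w) :
    Adm (κ * lo) (hi / κ) (fun m => w m * (κ⁻¹) ^ m.natAbs) := by
  have hκi : 1 < κ⁻¹ := (one_lt_inv₀ hκ).2 hκ1
  have hκ' : κ⁻¹ * κ = 1 := inv_mul_cancel₀ hκ.ne'
  have h1 : ∀ m : ℤ, κ * (κ⁻¹) ^ m.natAbs ≤ (κ⁻¹) ^ (m + 1).natAbs := by
    intro m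
    have hle : m.natAbs ≤ (m + 1).natAbs + 1 := by omega
    calc κ * (κ⁻¹) ^ m.natAbs ≤ κ * (κ⁻¹) ^ ((m + 1).natAbs + 1) := by
          gcongr
          exact hκi.le
      _ = (κ⁻¹) ^ (m + 1).natAbs * (κ⁻¹ * κ) := by rw [pow_succ]; ring
      _ = _ := by rw [hκ', mul_one]
  have h2 : ∀ m : ℤ, (κ⁻¹) ^ (m + 1).natAbs ≤ κ⁻¹ * (κ⁻¹) ^ m.natAbs := by
    intro m
    rw [← pow_succ']
    exact pow_le_pow_right₀ hκi.le (by omega)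
  refine ⟨fun m => mul_pos (hw.pos m) (by positivity), fun m => ?_, fun m => ?_⟩
  · calc κ * lo * (w m * κ⁻¹ ^ m.natAbs) = (lo * w m) * (κ * κ⁻¹ ^ m.natAbs) := by ring
      _ ≤ _ := mul_le_mul (hw.le_succ m) (h1 m) (by positivity) (hw.pos _).le
  · calc _ ≤ (hi * w m) * (κ⁻¹ * κ⁻¹ ^ m.natAbs) :=
          mul_le_mul (hw.succ_le m) (h2 m) (by positivity)
            ((hw.pos _).le.trans (hw.succ_le m))
      _ = _ := by ring

/-- A uniform bound together with pointwise smallness gives smallness in a decaying weight. -/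
lemma eventually_decay (hκ : 0 < κ) (hκ1 : κ < 1) (hw : ∀ m, 0 < w m) {α : Type*} {l : Filter α}
    {g : α → ℤ → ℝ} {k : α → ℝ} (hk : ∀ p, 0 ≤ k p) {c : ℝ}
    (hb : ∀ᶠ p in l, ∀ m, g p m ≤ c * w m * k p)
    (hs : ∀ m, ∀ ε : ℝ, 0 < ε → ∀ᶠ p in l, g p m ≤ ε * k p) {ε : ℝ} (hε : 0 < ε) :
    ∀ᶠ p in l, ∀ m, g p m ≤ ε * (w m * (κ⁻¹) ^ m.natAbs) * k p := by
  have hκi : 1 < κ⁻¹ := (one_lt_inv₀ hκ).2 hκ1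
  obtain ⟨J, hJ⟩ := pow_unbounded_of_one_lt (c / ε) hκi
  have hfin : ∀ᶠ p in l, ∀ m ∈ Finset.Icc (-(J : ℤ)) J, g p m ≤ ε * w m * k p := by
    rw [Filter.eventually_all_finset]
    intro m _
    exact hs m _ (mul_pos hε (hw m))
  filter_upwards [hb, hfin] with p hp hpf m
  by_cases hm : m ∈ Finset.Icc (-(J : ℤ)) J
  · refine (hpf m hm).trans (mul_le_mul_of_nonneg_right ?_ (hk p))
    have := hw m
    have h1 : 1 ≤ κ⁻¹ ^ m.natAbs := one_le_pow₀ hκi.le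
    gcongr
    nlinarith
  · refine (hp m).trans (mul_le_mul_of_nonneg_right ?_ (hk p))
    have hJm : J ≤ m.natAbs := by
      rw [Finset.mem_Icc] at hm
      omega
    have h1 : c / ε ≤ κ⁻¹ ^ m.natAbs := hJ.le.trans (pow_le_pow_right₀ hκi.le hJm)
    rw [div_le_iff₀ hε] at h1
    have := hw m
    nlinarith

end decay

variable {B : ℤ → (E ≃L[ℝ] E)} {N : ℤ → E → ℝ} {η L lo hi C κ A : ℝ} {f : ℤ → E → E}

/-- Bounded linear solution operators for a bounded family of inhomogeneities. -/
lemma Gap.exists_linear_solution [FiniteDimensional ℝ E] (hN : ∀ n, IsNormOn (N n))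
    (G : Gap B N η lo hi C) {w : ℤ → ℝ} (hw : Adm lo hi w) {a : ℤ → E →L[ℝ] E}
    (ha : ∀ m x, N (m + 1) (a m x) ≤ η * N m x) {b : ℤ → E →L[ℝ] E} {D : ℝ} (hD : 0 ≤ D)
    (hb : ∀ m x, N (m + 1) (b m x) ≤ D * ‖x‖ * w m) :
    ∃ u : ℤ → E →L[ℝ] E, (∀ m ζ, u (m + 1) ζ = B m (u m ζ) + (a m (u m ζ) + b m ζ)) ∧
      ∀ m ζ, N m (u m ζ) ≤ 2 * C * (D * ‖ζ‖) * w m := by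
  have hex := fun ζ : E => G.exists_fixed hN hw (D := D * ‖ζ‖) (by positivity)
    (Φ := fun m x => a m x + b m ζ) (fun m x y => by
      rw [add_sub_add_right_eq_sub, ← map_sub]
      exact ha m _) (fun m => by
      rw [map_zero, zero_add]
      exact hb m ζ)
  choose u hu hub using hex
  have hzero : ∀ (e : ℤ → E) (D' : ℝ), (∀ m, e (m + 1) = B m (e m) + a m (e m)) →
      (∀ m, N m (e m) ≤ D' * w m) → ∀ m, e m = 0 := by
    intro e D' he heb m
    have := G.apriori hN hw hw le_rfl (e := e) (D := 0) (fun m => by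
      rw [he, add_sub_cancel_left, zero_mul, add_zero]
      exact ha m _) heb m
    rw [mul_zero, zero_mul] at this
    exact (hN m).eq_zero_of_le this
  have hadd : ∀ m ζ ζ', u (ζ + ζ') m = u ζ m + u ζ' m := by
    intro m ζ ζ'
    have := hzero (fun m => u (ζ + ζ') m - (u ζ m + u ζ' m))
      (2 * C * (D * ‖ζ + ζ'‖) + 2 * C * (D * ‖ζ‖) + 2 * C * (D * ‖ζ'‖)) (fun m => by
        simp only [hu, map_add, map_sub]
        abel) (fun m => by
        have h1 := (hN m).sub_le (u (ζ + ζ') m) (u ζ m + u ζ' m)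
        have h2 := (hN m).add_le (u ζ m) (u ζ' m)
        have h3 := hub (ζ + ζ') m
        have h4 := hub ζ m
        have h5 := hub ζ' m
        linarith) m
    exact sub_eq_zero.1 this
  have hsmul : ∀ m (c : ℝ) ζ, u (c • ζ) m = c • u ζ m := by
    intro m c ζ
    have := hzero (fun m => u (c • ζ) m - c • u ζ m)
      (2 * C * (D * ‖c • ζ‖) + |c| * (2 * C * (D * ‖ζ‖))) (fun m => by
        simp only [hu, map_smul, map_sub, smul_add]
        abel) (fun m => by
        have h1 := (hN m).sub_le (u (c • ζ) m) (c • u ζ m)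
        rw [(hN m).smul] at h1
        have h3 := hub (c • ζ) m
        have h4 := mul_le_mul_of_nonneg_left (hub ζ m) (abs_nonneg c)
        linarith) m
    exact sub_eq_zero.1 this
  let U : ℤ → E →ₗ[ℝ] E := fun m =>
    { toFun := fun ζ => u ζ m
      map_add' := hadd m
      map_smul' := fun c ζ => hsmul m c ζ }
  exact ⟨fun m => (U m).toContinuousLinearMap, fun m ζ => hu ζ m, fun m ζ => hub ζ m⟩

lemma Gap.shadow_diff [FiniteDimensional ℝ E] (hN : ∀ n, IsNormOn (N n)) (hlo : 0 < lo)
    (hhi : 0 < hi) (hκ : 0 < κ) (hκ1 : κ < 1) (G : Gap B N η (κ * lo) (hi / κ) C) (hA : 0 ≤ A)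
    (hBA : ∀ m x, N (m + 1) (B m x) ≤ A * N m x) (hf : Pert N η L f) {w : ℤ → ℝ}
    (hw : Adm lo hi w) {χ y : E → ℤ → E} {ξ : E} {c : ℝ} (hc : 0 ≤ c)
    (hy : ∀ ζ, IsOrbit B f (y ζ))
    (hlip : ∀ᶠ p : E × E in 𝓝 (ξ, ξ), ∀ m,
      N m ((y p.1 m - χ p.1 m) - (y p.2 m - χ p.2 m)) ≤ c * w m * ‖p.1 - p.2‖)
    (hχ : StrictDiff χ ξ) : StrictDiff y ξ := by
  have hη := G.eta_nonneg
  have hC := G.C_pos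
  have hw' : Adm (κ * lo) (hi / κ) w := hw.mono (by nlinarith) (by
    rw [le_div_iff₀ hκ]; nlinarith)
  have hwκ := hw.mul_decay hκ hκ1
  choose χ' hχ' using hχ
  set a : ℤ → E →L[ℝ] E := fun m => fderiv ℝ (f m) (y ξ m) with ha_def
  have ha : ∀ m x, N (m + 1) (a m x) ≤ η * N m x := fun m x => hf.dbound m _ x
  have hfs : ∀ m x, HasStrictFDerivAt (f m) (fderiv ℝ (f m) x) x := fun m x =>
    (hf.smooth m).contDiffAt.hasStrictFDerivAt one_ne_zero
  -- derivative of the linear defect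
  set d' : ℤ → E →L[ℝ] E := fun m => χ' (m + 1) - (B m : E →L[ℝ] E).comp (χ' m) with hd'_def
  have hd' : ∀ m, HasStrictFDerivAt (fun ζ => χ ζ (m + 1) - B m (χ ζ m)) (d' m) ξ := fun m =>
    (hχ' (m + 1)).sub ((B m : E →L[ℝ] E).hasStrictFDerivAt.comp ξ (hχ' m))
  set b : ℤ → E →L[ℝ] E := fun m => (a m).comp (χ' m) - d' m with hb_def
  have hpt : ∀ᶠ ζ in 𝓝 ξ, ∀ m,
      N m ((y ζ m - χ ζ m) - (y ξ m - χ ξ m)) ≤ c * w m * ‖ζ - ξ‖ := by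
    have : Tendsto (fun ζ : E => (ζ, ξ)) (𝓝 ξ) (𝓝 (ξ, ξ)) :=
      tendsto_id.prodMk_nhds tendsto_const_nhds
    exact this.eventually hlip
  set D : ℝ := c * (hi / κ + A + η) with hD_def
  have hD : 0 ≤ D := by positivity
  have hb : ∀ m x, N (m + 1) (b m x) ≤ D * ‖x‖ * w m := by
    intro m x
    have hder : HasFDerivAt (fun ζ => f m (χ ζ m + (y ξ m - χ ξ m)) -
        (χ ζ (m + 1) - B m (χ ζ m))) (b m) ξ := by
      refine HasFDerivAt.sub ?_ (hd' m).hasFDerivAt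
      have h1 : HasFDerivAt (fun ζ => χ ζ m + (y ξ m - χ ξ m)) (χ' m) ξ :=
        (hχ' m).hasFDerivAt.add_const _
      have h2 : HasFDerivAt (f m) (a m) (χ ξ m + (y ξ m - χ ξ m)) := by
        rw [add_sub_cancel]
        exact hf.hasFDerivAt m _
      exact h2.comp ξ h1
    have := fderiv_norm_le (hN (m + 1)) isNormOn_norm hder (c := D * w m) (by
      filter_upwards [hpt] with ζ hζ
      have h1 := hζ (m + 1)
      have h2 := hζ m
      have h3 := hf.lip hN m (y ζ m) (χ ζ m + (y ξ m - χ ξ m))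
      rw [show y ζ m - (χ ζ m + (y ξ m - χ ξ m)) = (y ζ m - χ ζ m) - (y ξ m - χ ξ m) by abel] at h3
      have h4 := hBA m ((y ζ m - χ ζ m) - (y ξ m - χ ξ m))
      have e : f m (χ ζ m + (y ξ m - χ ξ m)) - (χ ζ (m + 1) - B m (χ ζ m)) -
          (f m (χ ξ m + (y ξ m - χ ξ m)) - (χ ξ (m + 1) - B m (χ ξ m))) =
          (((y ζ (m + 1) - χ ζ (m + 1)) - (y ξ (m + 1) - χ ξ (m + 1))) -
          B m ((y ζ m - χ ζ m) - (y ξ m - χ ξ m))) -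
          (f m (y ζ m) - f m (χ ζ m + (y ξ m - χ ξ m))) := by
        rw [hy ζ m, hy ξ m, add_sub_cancel]
        simp only [map_sub]
        abel
      have h5 := (hN (m + 1)).le_of_eq_sub e
      have h6 := (hN (m + 1)).sub_le
        ((y ζ (m + 1) - χ ζ (m + 1)) - (y ξ (m + 1) - χ ξ (m + 1)))
        (B m ((y ζ m - χ ζ m) - (y ξ m - χ ξ m)))
      have h7 : c * w (m + 1) * ‖ζ - ξ‖ ≤ c * (hi / κ * w m) * ‖ζ - ξ‖ := by
        gcongr
        exact hw'.succ_le m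
      have h8 := mul_le_mul_of_nonneg_left h2 hA
      have h9 := mul_le_mul_of_nonneg_left h2 hη
      rw [hD_def]
      linarith) x
    linarith
  obtain ⟨u', hu', hub'⟩ := G.exists_linear_solution hN hw' ha hD hb
  -- the remainder
  set R : E × E → ℤ → E := fun p m =>
    ((y p.1 m - χ p.1 m) - (y p.2 m - χ p.2 m)) - u' m (p.1 - p.2) with hR_def
  set S : E × E → ℤ → E := fun p m => R p (m + 1) - B m (R p m) - a m (R p m) with hS_def
  set c₂ : ℝ := c + 2 * C * D with hc₂_def
  have hc₂ : 0 ≤ c₂ := by positivity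
  have hRb : ∀ᶠ p : E × E in 𝓝 (ξ, ξ), ∀ m, N m (R p m) ≤ c₂ * w m * ‖p.1 - p.2‖ := by
    filter_upwards [hlip] with p hp m
    have h1 := (hN m).sub_le ((y p.1 m - χ p.1 m) - (y p.2 m - χ p.2 m)) (u' m (p.1 - p.2))
    have h2 := hp m
    have h3 := hub' m (p.1 - p.2)
    rw [hc₂_def]
    linarith
  have hSb : ∀ᶠ p : E × E in 𝓝 (ξ, ξ), ∀ m,
      N (m + 1) (S p m) ≤ c₂ * (hi / κ + A + η) * w m * ‖p.1 - p.2‖ := by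
    filter_upwards [hRb] with p hp m
    have h1 := (hN (m + 1)).sub_le (R p (m + 1) - B m (R p m)) (a m (R p m))
    have h2 := (hN (m + 1)).sub_le (R p (m + 1)) (B m (R p m))
    have h3 := hBA m (R p m)
    have h4 := ha m (R p m)
    have h5 := hp (m + 1)
    have h6 := hp m
    have h7 : c₂ * w (m + 1) * ‖p.1 - p.2‖ ≤ c₂ * (hi / κ * w m) * ‖p.1 - p.2‖ := by
      gcongr
      exact hw'.succ_le m
    have h8 := mul_le_mul_of_nonneg_left h6 hA
    have h9 := mul_le_mul_of_nonneg_left h6 hη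
    have : N (m + 1) (S p m) ≤ N (m + 1) (R p (m + 1) - B m (R p m)) + N (m + 1) (a m (R p m)) := h1
    linarith
  have hSo : ∀ m, (fun p => S p m) =o[𝓝 (ξ, ξ)] fun p : E × E => p.1 - p.2 := by
    intro m
    have hyO : (fun p : E × E => y p.1 m - y p.2 m) =O[𝓝 (ξ, ξ)] fun p : E × E => p.1 - p.2 := by
      obtain ⟨k, hk, hkN⟩ := (hN m).exists_norm_le
      have h1 : (fun p : E × E => (y p.1 m - χ p.1 m) - (y p.2 m - χ p.2 m)) =O[𝓝 (ξ, ξ)]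
          fun p : E × E => p.1 - p.2 := by
        refine Asymptotics.IsBigO.of_bound (k * (c * w m)) ?_
        filter_upwards [hlip] with p hp
        calc _ ≤ k * (c * w m * ‖p.1 - p.2‖) := (hkN _).trans (by gcongr; exact hp m)
          _ = _ := by ring
      refine ((hχ' m).isBigO_sub.add h1).congr_left fun p => ?_
      abel
    have hycont : Tendsto (fun ζ => y ζ m) (𝓝 ξ) (𝓝 (y ξ m)) := by
      have h1 : Tendsto (fun ζ : E => (ζ, ξ)) (𝓝 ξ) (𝓝 (ξ, ξ)) :=
        tendsto_id.prodMk_nhds tendsto_const_nhds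
      have h2 := hyO.comp_tendsto h1
      have h3 : Tendsto (fun ζ : E => ζ - ξ) (𝓝 ξ) (𝓝 0) := by
        have : Continuous (fun ζ : E => ζ - ξ) := by fun_prop
        simpa using this.tendsto ξ
      have h4 := h2.trans_tendsto h3
      have := h4.add_const (y ξ m)
      simpa using this
    have hyt : Tendsto (fun p : E × E => (y p.1 m, y p.2 m)) (𝓝 (ξ, ξ)) (𝓝 (y ξ m, y ξ m)) := by
      rw [nhds_prod_eq, nhds_prod_eq]
      exact hycont.prodMap hycont
    have o1 := ((hfs m (y ξ m)).isLittleO.comp_tendsto hyt).trans_isBigO hyO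
    have o2 := ((a m).isBigO_comp (fun p : E × E => χ p.1 m - χ p.2 m - χ' m (p.1 - p.2))
      (𝓝 (ξ, ξ))).trans_isLittleO (hχ' m).isLittleO
    have o3 := (hd' m).isLittleO
    refine ((o1.add o2).sub o3).congr_left fun p => ?_
    simp only [hS_def, hR_def, Function.comp_apply, hu', hb_def, hy p.1 m, hy p.2 m, map_sub,
      hd'_def, sub_apply, ContinuousLinearMap.comp_apply,
      ContinuousLinearEquiv.coe_coe, ha_def]
    abel
  intro m
  refine ⟨χ' m + u' m, ?_⟩
  have hRo : (fun p => R p m) =o[𝓝 (ξ, ξ)] fun p : E × E => p.1 - p.2 := by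
    rw [(hN m).isLittleO_iff]
    intro ε hε
    have hwκm := hwκ.pos m
    set ε' : ℝ := ε / (2 * C * (w m * κ⁻¹ ^ m.natAbs)) with hε'
    have hε'0 : 0 < ε' := by positivity
    have h1 := eventually_decay hκ hκ1 hw.pos (l := 𝓝 (ξ, ξ))
      (g := fun p m => N (m + 1) (S p m)) (k := fun p => ‖p.1 - p.2‖) (fun p => norm_nonneg _)
      (c := c₂ * (hi / κ + A + η)) hSb
      (fun m => ((hN (m + 1)).isLittleO_iff).1 (hSo m)) hε'0
    filter_upwards [h1, hRb] with p hp hpR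
    have h2 := G.apriori hN hwκ hw' (D := ε' * ‖p.1 - p.2‖) (by positivity) (e := R p) (fun m => by
      have h3 := (hN (m + 1)).le_of_eq_add (z := R p (m + 1) - B m (R p m)) (x := a m (R p m))
        (y := S p m) (by simp only [hS_def]; abel)
      have h4 := ha m (R p m)
      have h5 := hp m
      linarith) (D₁ := c₂ * ‖p.1 - p.2‖) (fun m => by
      have := hpR m
      linarith) m
    refine h2.trans (le_of_eq ?_)
    have hwm := (hw.pos m).ne'
    rw [hε']
    field_simp
  refine HasStrictFDerivAt.of_isLittleO (((hχ' m).isLittleO.add hRo).congr_left fun p => ?_)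
  simp only [hR_def, add_apply]
  abel

/-! ### Half-lines, cut-offs and splittings -/

lemma Adm.shift {lo hi : ℝ} {w : ℤ → ℝ} (hw : Adm lo hi w) (n : ℤ) :
    Adm lo hi (fun m => w (m - n)) where
  pos m := hw.pos _
  le_succ m := by
    rw [add_sub_right_comm]
    exact hw.le_succ _
  succ_le m := by
    rw [add_sub_right_comm]
    exact hw.succ_le _

/-- A set of offsets which is a union of half-lines with boundary between `-1` and `0`. -/
def HalfLine (T : Set ℤ) : Prop := ∀ l, l ≠ -1 → (l ∈ T ↔ l + 1 ∈ T)

lemma HalfLine.compl {T : Set ℤ} (hT : HalfLine T) : HalfLine Tᶜ := fun l hl =>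
  not_congr (hT l hl)

lemma halfLine_neg : HalfLine {l | l < 0} := fun l hl => by
  simp only [Set.mem_ofPred_eq]
  omega

/-- `u` is dominated by the weight `w` centred at `n`, on the offsets in `T`. -/
def MemT (N : ℤ → E → ℝ) (T : Set ℤ) (w : ℤ → ℝ) (n : ℤ) (u : ℤ → E) : Prop :=
  ∃ D : ℝ, 0 ≤ D ∧ ∀ m, m - n ∈ T → N m (u m) ≤ D * w (m - n)

section MemT

variable {N : ℤ → E → ℝ} {T : Set ℤ} {w w' : ℤ → ℝ} {n : ℤ} {u u' : ℤ → E}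

lemma MemT.add (hN : ∀ n, IsNormOn (N n)) (hu : MemT N T w n u) (hu' : MemT N T w n u') :
    MemT N T w n (fun m => u m + u' m) := by
  obtain ⟨D, hD, h⟩ := hu
  obtain ⟨D', hD', h'⟩ := hu'
  refine ⟨D + D', by positivity, fun m hm => ?_⟩
  have h1 := (hN m).add_le (u m) (u' m)
  have h2 := h m hm
  have h3 := h' m hm
  linarith

lemma MemT.sub (hN : ∀ n, IsNormOn (N n)) (hu : MemT N T w n u) (hu' : MemT N T w n u') :
    MemT N T w n (fun m => u m - u' m) := by
  obtain ⟨D, hD, h⟩ := hu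
  obtain ⟨D', hD', h'⟩ := hu'
  refine ⟨D + D', by positivity, fun m hm => ?_⟩
  have h1 := (hN m).sub_le (u m) (u' m)
  have h2 := h m hm
  have h3 := h' m hm
  linarith

lemma MemT.mono (hu : MemT N T w n u) (h : ∀ l ∈ T, w l ≤ w' l) : MemT N T w' n u := by
  obtain ⟨D, hD, hb⟩ := hu
  exact ⟨D, hD, fun m hm => (hb m hm).trans (mul_le_mul_of_nonneg_left (h _ hm) hD)⟩

lemma MemT.zero (hN : ∀ n, IsNormOn (N n)) : MemT N T w n (fun _ => 0) :=
  ⟨0, le_rfl, fun m _ => by rw [(hN m).map_zero, zero_mul]⟩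

lemma MemT.congr (hu : MemT N T w n u) (h : ∀ m, m - n ∈ T → u' m = u m) : MemT N T w n u' := by
  obtain ⟨D, hD, hb⟩ := hu
  exact ⟨D, hD, fun m hm => by rw [h m hm]; exact hb m hm⟩

lemma MemT.of_full {D : ℝ} (hD : 0 ≤ D) (h : ∀ m, N m (u m) ≤ D * w (m - n)) : MemT N T w n u :=
  ⟨D, hD, fun m _ => h m⟩

lemma MemT.full (hw : ∀ l, 0 < w l) (h : MemT N T w n u) (h' : MemT N Tᶜ w n u) :
    ∃ D : ℝ, 0 ≤ D ∧ ∀ m, N m (u m) ≤ D * w (m - n) := by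
  obtain ⟨D, hD, hb⟩ := h
  obtain ⟨D', hD', hb'⟩ := h'
  refine ⟨D + D', by positivity, fun m => ?_⟩
  have := (hw (m - n)).le
  by_cases hm : m - n ∈ T
  · have := hb m hm
    nlinarith
  · have := hb' m hm
    nlinarith

lemma memT_succ (hN : ∀ n, IsNormOn (N n)) (hT : HalfLine T) {lo hi : ℝ} (hlo : 0 < lo)
    (hw : Adm lo hi w) (n : ℤ) : MemT N T w n u ↔ MemT N T w (n + 1) u := by
  have hhi : 0 ≤ hi := by
    have h1 := hw.succ_le 0
    have h2 := hw.pos 0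
    have h3 := hw.pos (0 + 1)
    by_contra hcon
    push Not at hcon
    nlinarith
  constructor
  · rintro ⟨D, hD, h⟩
    have hw1 := hw.pos (-1)
    have hn0 := (hN n).nonneg (u n)
    refine ⟨D * hi + N n (u n) / w (-1), by positivity, fun m hm => ?_⟩
    have hwm := hw.pos (m - (n + 1))
    by_cases hmn : m - (n + 1) = -1
    · obtain rfl : m = n := by omega
      rw [hmn, add_mul, div_mul_cancel₀ _ hw1.ne']
      have : 0 ≤ D * hi * w (-1) := by positivity
      linarith
    · have h1 := h m (by
        have := (hT _ hmn).1 hm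
        rwa [show m - (n + 1) + 1 = m - n by ring] at this)
      have h2 := hw.succ_le (m - (n + 1))
      rw [show m - (n + 1) + 1 = m - n by ring] at h2
      have h3 : 0 ≤ N n (u n) / w (-1) * w (m - (n + 1)) := by positivity
      have h4 := mul_le_mul_of_nonneg_left h2 hD
      linarith
  · rintro ⟨D, hD, h⟩
    have hw1 := hw.pos 0
    have hn0 := (hN n).nonneg (u n)
    refine ⟨D * lo⁻¹ + N n (u n) / w 0, by positivity, fun m hm => ?_⟩
    have hwm := hw.pos (m - n)
    by_cases hmn : m - (n + 1) = -1
    · obtain rfl : m = n := by omega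
      rw [sub_self, add_mul, div_mul_cancel₀ _ hw1.ne']
      have : 0 ≤ D * lo⁻¹ * w 0 := by positivity
      linarith
    · have h1 := h m (by
        refine (hT _ hmn).2 ?_
        rwa [show m - (n + 1) + 1 = m - n by ring])
      have h2 := hw.le_succ (m - (n + 1))
      rw [show m - (n + 1) + 1 = m - n by ring] at h2
      have h3 : 0 ≤ N n (u n) / w 0 * w (m - n) := by positivity
      have h5 : w (m - (n + 1)) ≤ lo⁻¹ * w (m - n) := by
        rw [← div_eq_inv_mul, le_div_iff₀ hlo]
        linarith
      have h4 := mul_le_mul_of_nonneg_left h5 hD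
      linarith

lemma MemT.recenter (hN : ∀ n, IsNormOn (N n)) (hT : HalfLine T) {lo hi : ℝ} (hlo : 0 < lo)
    (hw : Adm lo hi w) (n' : ℤ) (h : MemT N T w n u) : MemT N T w n' u := by
  have h0 : ∀ k : ℤ, MemT N T w k u ↔ MemT N T w 0 u := by
    intro k
    induction k using Int.induction_on with
    | zero => rfl
    | succ i ih => rw [← memT_succ hN hT hlo hw, ih]
    | pred i ih => rw [memT_succ hN hT hlo hw, sub_add_cancel, ih]
  rwa [h0, ← h0 n]

end MemT

/-- The standing assumptions on the system. -/
structure Ctx (B : ℤ → (E ≃L[ℝ] E)) (N : ℤ → E → ℝ) (η L A κ : ℝ) (f : ℤ → E → E) : Prop where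
  hN : ∀ n, IsNormOn (N n)
  hf : Pert N η L f
  hη : 0 ≤ η
  hL : 0 ≤ L
  hA : 0 ≤ A
  hBA : ∀ m x, N (m + 1) (B m x) ≤ A * N m x
  hκ : 0 < κ
  hκ1 : κ < 1

/-- A gap with room on both sides. -/
structure SGap (B : ℤ → (E ≃L[ℝ] E)) (N : ℤ → E → ℝ) (η κ C lo hi : ℝ) : Prop where
  gap : Gap B N η (κ * lo) (hi / κ) C
  lo_pos : 0 < lo
  hi_pos : 0 < hi

variable {B : ℤ → (E ≃L[ℝ] E)} {N : ℤ → E → ℝ} {η L A κ C lo hi : ℝ} {f : ℤ → E → E}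

lemma Ctx.linear (X : Ctx B N η L A κ f) : Ctx B N η L A κ (fun _ _ => 0) :=
  { X with hf := Pert.const_zero X.hN X.hη X.hL }

lemma SGap.toGap (X : Ctx B N η L A κ f) (S : SGap B N η κ C lo hi) : Gap B N η lo hi C := by
  have h1 := X.hκ
  have h2 := X.hκ1
  have h3 := S.lo_pos
  have h4 := S.hi_pos
  exact S.gap.mono (by nlinarith) (by rw [le_div_iff₀ h1]; nlinarith)

lemma isOrbit_zero (X : Ctx B N η L A κ f) : IsOrbit B f (fun _ => 0) := fun m => by
  simp [X.hf.zero]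

lemma IsOrbit.sub_linear {y y' : ℤ → E} (hy : IsOrbit B (fun _ _ => 0) y)
    (hy' : IsOrbit B (fun _ _ => 0) y') : IsOrbit B (fun _ _ => 0) (fun m => y m - y' m) :=
  fun m => by simp [hy m, hy' m]

lemma IsOrbit.add_linear {y y' : ℤ → E} (hy : IsOrbit B (fun _ _ => 0) y)
    (hy' : IsOrbit B (fun _ _ => 0) y') : IsOrbit B (fun _ _ => 0) (fun m => y m + y' m) :=
  fun m => by simp [hy m, hy' m]

lemma IsOrbit.diff_residual [FiniteDimensional ℝ E] (X : Ctx B N η L A κ f) {y y' : ℤ → E}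
    (hy : IsOrbit B f y) (hy' : IsOrbit B f y') (m : ℤ) :
    N (m + 1) ((y (m + 1) - y' (m + 1)) - B m (y m - y' m)) ≤ η * N m (y m - y' m) := by
  refine le_trans (le_of_eq ?_) (X.hf.lip X.hN m (y m) (y' m))
  rw [hy m, hy' m, map_sub]
  congr 1
  abel

open Classical in
/-- The restriction of a sequence to offsets in `T` from the centre `n`. -/
def cut (T : Set ℤ) (n : ℤ) (x : ℤ → E) (m : ℤ) : E := if m - n ∈ T then x m else 0

lemma cut_of_mem {T : Set ℤ} {n m : ℤ} {x : ℤ → E} (h : m - n ∈ T) : cut T n x m = x m := if_pos h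

lemma cut_of_notMem {T : Set ℤ} {n m : ℤ} {x : ℤ → E} (h : m - n ∉ T) : cut T n x m = 0 :=
  if_neg h

lemma cut_sub {T : Set ℤ} {n : ℤ} {x y : ℤ → E} (m : ℤ) :
    cut T n x m - cut T n y m = cut T n (fun m => x m - y m) m := by
  by_cases h : m - n ∈ T
  · simp [cut_of_mem h]
  · simp [cut_of_notMem h]

/-- Exponential bounds on a half-line in terms of the value at the boundary. -/
lemma exists_halfBound (X : Ctx B N η L A κ f) (S : SGap B N η κ C lo hi)
    {w w₁ : ℤ → ℝ} (hw : Adm lo hi w) (hw₁ : Adm lo hi w₁) {T : Set ℤ} (hT : HalfLine T) :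
    ∃ K : ℝ, 0 ≤ K ∧ ∀ (n₀ n : ℤ) (e : ℤ → E),
      (∀ m, N (m + 1) (e (m + 1) - B m (e m)) ≤ η * N m (e m)) → MemT N T w₁ n₀ e →
      ∀ m, m - n ∈ T → N m (e m) ≤ K * N n (e n) * w (m - n) := by
  have hN := X.hN
  have G := S.toGap X
  have hC := G.C_pos
  have hη := X.hη
  have hw1 := hw.pos (-1)
  refine ⟨2 * C / w (-1), by positivity, fun n₀ n e he hm m hmT => ?_⟩
  obtain ⟨D, hD, hb⟩ := hm.recenter hN hT S.lo_pos hw₁ n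
  have hen := (hN n).nonneg (e n)
  have := G.apriori hN (hw.shift n) (hw₁.shift n) (e := cut T n e) (D := N n (e n) / w (-1))
    (by positivity) (fun m => by
      have hwm := hw.pos (m - n)
      have hadd : 0 ≤ N n (e n) / w (-1) * w (m - n) := by positivity
      by_cases hmn : m - n = -1
      · have h1 : N n (e n) / w (-1) * w (m - n) = N n (e n) := by
          rw [hmn, div_mul_cancel₀ _ hw1.ne']
        rw [h1]
        obtain rfl : n = m + 1 := by omega
        have hr := he m
        by_cases a : m - (m + 1) ∈ T <;> by_cases b : m + 1 - (m + 1) ∈ T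
        · rw [cut_of_mem a, cut_of_mem b]
          linarith
        · rw [cut_of_mem a, cut_of_notMem b]
          have := (hN (m + 1)).le_of_eq_sub (z := 0 - B m (e m)) (x := e (m + 1) - B m (e m))
            (y := e (m + 1)) (by abel)
          linarith
        · rw [cut_of_notMem a, cut_of_mem b, map_zero, sub_zero, (hN m).map_zero]
          linarith
        · rw [cut_of_notMem a, cut_of_notMem b, map_zero, sub_zero, (hN m).map_zero,
            (hN (m + 1)).map_zero]
          linarith
      · have hiff := hT _ hmn
        rw [show m - n + 1 = m + 1 - n by ring] at hiff
        by_cases a : m - n ∈ T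
        · rw [cut_of_mem a, cut_of_mem (hiff.1 a)]
          have := he m
          linarith
        · rw [cut_of_notMem a, cut_of_notMem (fun h => a (hiff.2 h)), map_zero, sub_zero,
            (hN m).map_zero, (hN (m + 1)).map_zero]
          linarith) (D₁ := D) (fun m => by
      by_cases a : m - n ∈ T
      · rw [cut_of_mem a]
        exact hb m a
      · rw [cut_of_notMem a, (hN m).map_zero]
        exact mul_nonneg hD (hw₁.pos _).le) m
  rw [cut_of_mem hmT] at this
  refine this.trans (le_of_eq ?_)
  ring

/-- `Y` is the orbit asymptotic to `Z` on `T` and to `0` on the complement of `T`, in the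
weight `W`. -/
structure Split (B : ℤ → (E ≃L[ℝ] E)) (N : ℤ → E → ℝ) (f : ℤ → E → E) (T : Set ℤ) (W : ℤ → ℝ)
    (Z Y : ℤ → E) : Prop where
  orbit : IsOrbit B f Y
  mem : MemT N T W 0 (fun m => Y m - Z m)
  mem_compl : MemT N Tᶜ W 0 Y

section split

variable [FiniteDimensional ℝ E] {T : Set ℤ} {W : ℤ → ℝ}

lemma Split.full (X : Ctx B N η L A κ f) (S : SGap B N η κ C lo hi) (hW : Adm lo hi W)
    (hT : HalfLine T) {Z Y : ℤ → E} (h : Split B N f T W Z Y) (n : ℤ) :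
    ∃ D : ℝ, 0 ≤ D ∧ ∀ m, N m (Y m - cut T n Z m) ≤ D * W (m - n) := by
  refine MemT.full hW.pos ((h.mem.recenter X.hN hT S.lo_pos hW n).congr fun m hm => ?_)
    ((h.mem_compl.recenter X.hN hT.compl S.lo_pos hW n).congr fun m hm => ?_)
  · rw [cut_of_mem hm]
  · rw [cut_of_notMem hm, sub_zero]

lemma Split.of_full {Z Y : ℤ → E} (hY : IsOrbit B f Y) {D : ℝ}
    (hD : 0 ≤ D) (h : ∀ m, N m (Y m - cut T 0 Z m) ≤ D * W (m - 0)) : Split B N f T W Z Y := by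
  refine ⟨hY, (MemT.of_full hD h).congr fun m hm => ?_, (MemT.of_full hD h).congr fun m hm => ?_⟩
  · rw [cut_of_mem hm]
  · rw [cut_of_notMem hm, sub_zero]

lemma cut_defect (X : Ctx B N η L A κ f) (hT : HalfLine T) {Z : ℤ → E} (hZ : IsOrbit B f Z)
    {n m : ℤ} (hm : m - n ≠ -1) :
    cut T n Z (m + 1) - B m (cut T n Z m) - f m (cut T n Z m) = 0 := by
  have hiff := hT _ hm
  rw [show m - n + 1 = m + 1 - n by ring] at hiff
  by_cases a : m - n ∈ T
  · rw [cut_of_mem a, cut_of_mem (hiff.1 a), hZ m]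
    abel
  · rw [cut_of_notMem a, cut_of_notMem (fun h => a (hiff.2 h)), X.hf.zero]
    simp

lemma cut_defect_diff (X : Ctx B N η L A κ f) {Z Z' : ℤ → E} (hZ : IsOrbit B f Z)
    (hZ' : IsOrbit B f Z') (m : ℤ) :
    N (m + 1) ((cut T (m + 1) Z' (m + 1) - B m (cut T (m + 1) Z' m) - f m (cut T (m + 1) Z' m)) -
      (cut T (m + 1) Z (m + 1) - B m (cut T (m + 1) Z m) - f m (cut T (m + 1) Z m))) ≤
      N (m + 1) (Z' (m + 1) - Z (m + 1)) := by
  have hN := X.hN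
  by_cases a : m - (m + 1) ∈ T <;> by_cases b : m + 1 - (m + 1) ∈ T
  · simp only [cut_of_mem a, cut_of_mem b]
    have h1 : Z' (m + 1) - B m (Z' m) - f m (Z' m) - (Z (m + 1) - B m (Z m) - f m (Z m)) = 0 := by
      rw [hZ m, hZ' m]
      abel
    rw [h1, (hN _).map_zero]
    exact (hN _).nonneg _
  · simp only [cut_of_mem a, cut_of_notMem b]
    rw [(hN _).sub_comm, hZ m, hZ' m]
    refine le_of_eq ?_
    congr 1
    abel
  · simp only [cut_of_notMem a, cut_of_mem b, X.hf.zero, map_zero, sub_zero]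
    rfl
  · simp only [cut_of_notMem a, cut_of_notMem b, X.hf.zero, map_zero, sub_zero, (hN _).map_zero]
    exact (hN _).nonneg _

lemma exists_split (X : Ctx B N η L A κ f) (S : SGap B N η κ C lo hi) (hW : Adm lo hi W)
    (hT : HalfLine T) {Z : ℤ → E} (hZ : IsOrbit B f Z) : ∃ Y, Split B N f T W Z Y := by
  have hN := X.hN
  have G := S.toGap X
  have hC := G.C_pos
  have hw1 := hW.pos (-1)
  have h0 := (hN 0).nonneg (Z 0)
  obtain ⟨Y, hY, hYb⟩ := G.exists_shadow hN X.hf (hW.shift 0) (D := N 0 (Z 0) / W (-1))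
    (by positivity) (χ := cut T 0 Z) (fun m => by
      have hwm := hW.pos (m - 0)
      by_cases hm : m - 0 = -1
      · obtain rfl : m = -1 := by omega
        rw [hm, div_mul_cancel₀ _ hw1.ne']
        have := cut_defect_diff (T := T) X (isOrbit_zero X) hZ (-1)
        rw [show (-1 : ℤ) + 1 = 0 by norm_num] at this ⊢
        have hc : ∀ m, cut T 0 (fun _ => (0 : E)) m = 0 := fun m => by simp [cut]
        simpa [hc, X.hf.zero] using this
      · rw [cut_defect X hT hZ hm, (hN _).map_zero]
        positivity)
  exact ⟨Y, Split.of_full hY (by positivity) hYb⟩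

lemma Split.unique (X : Ctx B N η L A κ f) (S : SGap B N η κ C lo hi) (hW : Adm lo hi W)
    (hT : HalfLine T) {Z Y Y' : ℤ → E} (h : Split B N f T W Z Y) (h' : Split B N f T W Z Y') :
    Y = Y' := by
  have hN := X.hN
  obtain ⟨D, hD, hb⟩ := h.full X S hW hT 0
  obtain ⟨D', hD', hb'⟩ := h'.full X S hW hT 0
  refine (S.toGap X).orbit_unique hN X.hf (hW.shift 0) (D := D + D') h.orbit h'.orbit fun m => ?_
  have h1 := (hN m).le_of_eq_sub (z := Y m - Y' m) (x := Y m - cut T 0 Z m)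
    (y := Y' m - cut T 0 Z m) (by abel)
  have := hb m
  have := hb' m
  linarith

/-- Lipschitz dependence of the splitting. -/
lemma exists_split_lip (X : Ctx B N η L A κ f) (S : SGap B N η κ C lo hi) (hW : Adm lo hi W)
    (hT : HalfLine T) : ∃ K : ℝ, 0 ≤ K ∧ ∀ (n : ℤ) (Z Y Z' Y' : ℤ → E), IsOrbit B f Z →
      IsOrbit B f Z' → Split B N f T W Z Y → Split B N f T W Z' Y' → ∀ D : ℝ, 0 ≤ D →
      (∀ m, m - n ∈ T → N (m + 1) (f m (Z' m + (Y m - Z m)) - f m (Z' m) -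
        (f m (Z m + (Y m - Z m)) - f m (Z m))) ≤ D * W (m - n)) →
      ∀ m, N m ((Y' m - cut T n Z' m) - (Y m - cut T n Z m)) ≤
        K * (N n (Z' n - Z n) + D) * W (m - n) := by
  have hN := X.hN
  have G := S.toGap X
  have hC := G.C_pos
  have hw1 := hW.pos (-1)
  refine ⟨2 * C * ((W (-1))⁻¹ + 1), by positivity,
    fun n Z Y Z' Y' hZ hZ' hY hY' D hD hsd m => ?_⟩
  have hδ := (hN n).nonneg (Z' n - Z n)
  obtain ⟨D₁, hD₁, hb⟩ := hY.full X S hW hT n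
  obtain ⟨D₁', hD₁', hb'⟩ := hY'.full X S hW hT n
  have := G.shadow_lip hN X.hf (hW.shift n) (hW.shift n) (D₁ := N n (Z' n - Z n) / W (-1))
    (D₂ := D) (D₃ := D₁ + D₁') (by positivity) hD (χ := cut T n Z) (χ' := cut T n Z')
    hY.orbit hY'.orbit (fun m => by
      have hwm := hW.pos (m - n)
      by_cases hm : m - n = -1
      · obtain rfl : n = m + 1 := by omega
        rw [hm, div_mul_cancel₀ _ hw1.ne']
        exact cut_defect_diff X hZ hZ' m
      · rw [cut_defect X hT hZ hm, cut_defect X hT hZ' hm, sub_zero, (hN _).map_zero]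
        positivity) (fun m => by
      by_cases hm : m - n ∈ T
      · rw [cut_of_mem hm, cut_of_mem hm]
        exact hsd m hm
      · rw [cut_of_notMem hm, cut_of_notMem hm, sub_self, (hN _).map_zero]
        exact mul_nonneg hD (hW.pos _).le) (fun m => by
      have h1 := (hN m).sub_le (Y' m - cut T n Z' m) (Y m - cut T n Z m)
      have := hb m
      have := hb' m
      linarith) m
  refine this.trans (mul_le_mul_of_nonneg_right ?_ (hW.pos _).le)
  have h3 : 0 ≤ (W (-1))⁻¹ := by positivity
  have h4 : N n (Z' n - Z n) / W (-1) + D ≤ ((W (-1))⁻¹ + 1) * (N n (Z' n - Z n) + D) := by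
    rw [div_eq_inv_mul]
    nlinarith [mul_nonneg h3 hD]
  have h5 := mul_le_mul_of_nonneg_left h4 (by positivity : 0 ≤ 2 * C)
  linarith

lemma exists_split_bound (X : Ctx B N η L A κ f) (S : SGap B N η κ C lo hi) (hW : Adm lo hi W)
    (hT : HalfLine T) : ∃ K : ℝ, 0 ≤ K ∧ ∀ (n : ℤ) (Z Y : ℤ → E), IsOrbit B f Z →
      Split B N f T W Z Y → ∀ m, N m (Y m - cut T n Z m) ≤ K * N n (Z n) * W (m - n) := by
  have hN := X.hN
  obtain ⟨K, hK, h⟩ := exists_split_lip X S hW hT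
  refine ⟨K, hK, fun n Z Y hZ hY m => ?_⟩
  have hc : ∀ m, cut T n (fun _ => (0 : E)) m = 0 := fun m => by simp [cut]
  have h0 : Split B N f T W (fun _ => 0) (fun _ => (0 : E)) :=
    ⟨isOrbit_zero X, (MemT.zero hN).congr fun m _ => sub_zero _, MemT.zero hN⟩
  have := h n (fun _ => 0) (fun _ => 0) Z Y (isOrbit_zero X) hZ h0 hY 0 le_rfl (fun m _ => by
    simp [X.hf.zero, (hN _).map_zero]) m
  simpa [hc] using this

lemma StrictDiff.cut {Z : E → ℤ → E} {ξ : E} (hZ : StrictDiff Z ξ) (n : ℤ) :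
    StrictDiff (fun ζ => cut T n (Z ζ)) ξ := fun m => by
  by_cases h : m - n ∈ T
  · simp only [cut_of_mem h]
    exact hZ m
  · simp only [cut_of_notMem h]
    exact ⟨0, hasStrictFDerivAt_const _ _⟩

lemma split_diff (X : Ctx B N η L A κ f) (S : SGap B N η κ C lo hi) (hW : Adm lo hi W)
    {Z Y : E → ℤ → E} {ξ : E} (hY : ∀ ζ, Split B N f T W (Z ζ) (Y ζ))
    {c : ℝ} (hc : 0 ≤ c) (hlip : ∀ᶠ p : E × E in 𝓝 (ξ, ξ), ∀ m,
      N m ((Y p.1 m - NonautLin.cut T 0 (Z p.1) m) - (Y p.2 m - NonautLin.cut T 0 (Z p.2) m)) ≤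
        c * W (m - 0) * ‖p.1 - p.2‖)
    (hZ : StrictDiff Z ξ) : StrictDiff Y ξ :=
  S.gap.shadow_diff X.hN S.lo_pos S.hi_pos X.hκ X.hκ1 X.hA X.hBA X.hf (hW.shift 0) hc
    (fun ζ => (hY ζ).orbit) hlip (hZ.cut 0)

end split

/-! ### Removing one spectral interval -/

/-- The weight `w` is admissible for some gap of the spectrum. -/
def Good (B : ℤ → (E ≃L[ℝ] E)) (N : ℤ → E → ℝ) (η κ C : ℝ) (w : ℤ → ℝ) : Prop :=
  ∃ lo hi, SGap B N η κ C lo hi ∧ Adm lo hi w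

lemma Good.pos {B : ℤ → (E ≃L[ℝ] E)} {N : ℤ → E → ℝ} {η κ C : ℝ} {w : ℤ → ℝ}
    (h : Good B N η κ C w) (l : ℤ) : 0 < w l := by
  obtain ⟨_, _, _, h⟩ := h
  exact h.pos l

/-- Orbits dominated by `P` on `T` and by `W` on the complement of `T`. -/
structure Cls (B : ℤ → (E ≃L[ℝ] E)) (N : ℤ → E → ℝ) (f : ℤ → E → E) (T : Set ℤ) (P W : ℤ → ℝ)
    (y : ℤ → E) : Prop where
  orbit : IsOrbit B f y
  mem : MemT N T P 0 y
  mem_compl : MemT N Tᶜ W 0 y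

/-- The weights needed to remove one spectral interval from an invariant class of orbits. -/
structure StepData (B : ℤ → (E ≃L[ℝ] E)) (N : ℤ → E → ℝ) (η κ C : ℝ) (T : Set ℤ)
    (P W W₀ V : ℤ → ℝ) : Prop where
  half : HalfLine T
  goodP : Good B N η κ C P
  goodW : Good B N η κ C W
  goodW₀ : Good B N η κ C W₀
  goodV : Good B N η κ C V
  P_le : ∀ l ∈ T, P l ≤ 1
  W_le : ∀ l ∈ T, W l ≤ P l
  V_le : ∀ l ∈ T, V l ≤ W l
  PW_le : ∀ l ∈ T, P l * W l ≤ V l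
  W_le_compl : ∀ l ∉ T, W l ≤ W₀ l
  V_le_compl : ∀ l ∉ T, V l ≤ W₀ l
  le_V_compl : ∀ l ∉ T, W₀ l ≤ V l

/-- `Z'` is the part of the orbit `Z` with the smaller weight and `v` is the linear orbit
shadowing the remainder `Z - Z'`. -/
structure Link (B : ℤ → (E ≃L[ℝ] E)) (N : ℤ → E → ℝ) (f : ℤ → E → E) (T : Set ℤ) (W V : ℤ → ℝ)
    (Z Z' v : ℤ → E) : Prop where
  split : Split B N f T W Z Z'
  orbit : IsOrbit B (fun _ _ => 0) v
  near : ∃ D : ℝ, 0 ≤ D ∧ ∀ m, N m (v m - (Z m - Z' m)) ≤ D * V m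

section step

variable [FiniteDimensional ℝ E] {B : ℤ → (E ≃L[ℝ] E)} {N : ℤ → E → ℝ} {η L A κ C : ℝ}
  {f : ℤ → E → E} {T : Set ℤ} {P W W₀ V : ℤ → ℝ}

lemma exists_orbit_halfBound (X : Ctx B N η L A κ f) {w : ℤ → ℝ} (hw : Good B N η κ C w)
    (hT : HalfLine T) : ∃ K : ℝ, 0 ≤ K ∧ ∀ (n : ℤ) (Z Z₁ : ℤ → E), IsOrbit B f Z →
      IsOrbit B f Z₁ → MemT N T w 0 Z → MemT N T w 0 Z₁ →
      ∀ m, m - n ∈ T → N m (Z₁ m - Z m) ≤ K * N n (Z₁ n - Z n) * w (m - n) := by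
  obtain ⟨lo, hi, S, hw⟩ := hw
  obtain ⟨K, hK, h⟩ := exists_halfBound X S hw hw hT
  exact ⟨K, hK, fun n Z Z₁ hZ hZ₁ hm hm₁ m hmT => h 0 n (fun m => Z₁ m - Z m)
    (fun m => hZ₁.diff_residual X hZ m) (hm₁.sub X.hN hm) m hmT⟩

lemma norm_cut_le (hN : ∀ n, IsNormOn (N n)) (n : ℤ) (Z Z₁ : ℤ → E) :
    N n (cut T n Z₁ n - cut T n Z n) ≤ N n (Z₁ n - Z n) := by
  rw [cut_sub]
  by_cases h : n - n ∈ T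
  · rw [cut_of_mem h]
  · rw [cut_of_notMem h, (hN n).map_zero]
    exact (hN n).nonneg _

lemma Cls.zero (X : Ctx B N η L A κ f) : Cls B N f T P W (fun _ => 0) :=
  ⟨isOrbit_zero X, MemT.zero X.hN, MemT.zero X.hN⟩

lemma Link.zero (X : Ctx B N η L A κ f) (H : StepData B N η κ C T P W W₀ V) :
    Link B N f T W V (fun _ => 0) (fun _ => 0) (fun _ => 0) :=
  ⟨⟨isOrbit_zero X, (MemT.zero X.hN).congr fun m _ => sub_zero _, MemT.zero X.hN⟩,
    fun m => by simp, 0, le_rfl, fun m => by simp [(X.hN m).map_zero]⟩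

lemma Link.exists (X : Ctx B N η L A κ f) (H : StepData B N η κ C T P W W₀ V) {Z : ℤ → E}
    (hZ : Cls B N f T P W₀ Z) : ∃ Z' v, Link B N f T W V Z Z' v := by
  have hN := X.hN
  have hη := X.hη
  obtain ⟨lo, hi, S, hW⟩ := H.goodW
  obtain ⟨lo', hi', S', hV⟩ := H.goodV
  obtain ⟨Z', hZ'⟩ := exists_split X S hW H.half hZ.orbit
  obtain ⟨D₁, hD₁, h₁⟩ := hZ.mem
  obtain ⟨D₂, hD₂, h₂⟩ := hZ.mem_compl
  obtain ⟨D₃, hD₃, h₃⟩ := hZ'.mem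
  obtain ⟨D₄, hD₄, h₄⟩ := hZ'.mem_compl
  have G := S'.toGap X.linear
  have hC := G.C_pos
  have hL := X.hL
  have key : ∀ m, N (m + 1) (f m (Z m) - f m (Z' m)) ≤
      (L * (2 * D₁ + D₃) * D₃ + η * (D₂ + D₄)) * V m := by
    intro m
    have hVm := hV.pos m
    by_cases hm : m - 0 ∈ T
    · have hPm := (H.goodP.pos m).le
      have hWm := (H.goodW.pos m).le
      have e1 := h₁ m hm
      have e3 := h₃ m hm
      have e5 := H.W_le _ hm
      have e6 := H.PW_le _ hm
      rw [sub_zero] at e1 e3 e5 e6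
      have e7 : N m (Z' m) ≤ D₁ * P m + D₃ * P m := by
        have := (hN m).le_of_eq_add (z := Z' m) (x := Z m) (y := Z' m - Z m) (by abel)
        have := mul_le_mul_of_nonneg_left e5 hD₃
        linarith
      rw [(hN m).sub_comm] at e3
      have n1 := (hN m).nonneg (Z m)
      have n2 := (hN m).nonneg (Z' m)
      have n3 := (hN m).nonneg (Z m - Z' m)
      calc N (m + 1) (f m (Z m) - f m (Z' m))
          ≤ L * (N m (Z m) + N m (Z' m)) * N m (Z m - Z' m) := X.hf.lip_local hN X.hL m _ _
        _ ≤ L * (D₁ * P m + (D₁ * P m + D₃ * P m)) * (D₃ * W m) := by gcongr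
        _ = L * (2 * D₁ + D₃) * D₃ * (P m * W m) := by ring
        _ ≤ L * (2 * D₁ + D₃) * D₃ * V m := by gcongr
        _ ≤ _ := by
          have : 0 ≤ η * (D₂ + D₄) * V m := by positivity
          linarith
    · have e2 := h₂ m hm
      have e4 := h₄ m hm
      have e5 := H.W_le_compl _ hm
      have e6 := H.le_V_compl _ hm
      rw [sub_zero] at e2 e4 e5 e6
      have := X.hf.lip hN m (Z m) (Z' m)
      have e7 := (hN m).sub_le (Z m) (Z' m)
      calc N (m + 1) (f m (Z m) - f m (Z' m)) ≤ η * N m (Z m - Z' m) := this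
        _ ≤ η * (D₂ * V m + D₄ * V m) := by
          have a1 := mul_le_mul_of_nonneg_left e6 hD₂
          have a2 := mul_le_mul_of_nonneg_left (e5.trans e6) hD₄
          gcongr
          linarith
        _ ≤ _ := by
          have : 0 ≤ L * (2 * D₁ + D₃) * D₃ * V m := by positivity
          linarith
  obtain ⟨v, hv, hvb⟩ := G.exists_shadow hN X.linear.hf hV
    (D := L * (2 * D₁ + D₃) * D₃ + η * (D₂ + D₄)) (by positivity) (χ := fun m => Z m - Z' m)
    (fun m => by
      refine le_trans (le_of_eq ?_) (key m)
      congr 1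
      rw [hZ.orbit m, hZ'.orbit m, map_sub]
      abel)
  exact ⟨Z', v, hZ', hv, _, by positivity, hvb⟩

lemma Link.unique (X : Ctx B N η L A κ f) (H : StepData B N η κ C T P W W₀ V)
    {Z Z' v Z₁' v₁ : ℤ → E} (h : Link B N f T W V Z Z' v) (h₁ : Link B N f T W V Z Z₁' v₁) :
    Z' = Z₁' ∧ v = v₁ := by
  have hN := X.hN
  obtain ⟨lo, hi, S, hW⟩ := H.goodW
  obtain ⟨lo', hi', S', hV⟩ := H.goodV
  obtain rfl := h.split.unique X S hW H.half h₁.split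
  refine ⟨rfl, ?_⟩
  obtain ⟨D, hD, hb⟩ := h.near
  obtain ⟨D₁, hD₁, hb₁⟩ := h₁.near
  refine (S'.toGap X.linear).orbit_unique hN X.linear.hf hV (D := D + D₁) h.orbit h₁.orbit
    fun m => ?_
  have h1 := (hN m).le_of_eq_sub (z := v m - v₁ m) (x := v m - (Z m - Z' m))
    (y := v₁ m - (Z m - Z' m)) (by abel)
  have := hb m
  have := hb₁ m
  linarith

/-- Membership of the two parts of an orbit. -/
lemma Link.cls (X : Ctx B N η L A κ f) (H : StepData B N η κ C T P W W₀ V) {Z Z' v : ℤ → E}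
    (hZ : Cls B N f T P W₀ Z) (h : Link B N f T W V Z Z' v) : Cls B N f T P W Z' := by
  refine ⟨h.split.orbit, ?_, h.split.mem_compl⟩
  exact ((h.split.mem.mono H.W_le).add X.hN hZ.mem).congr fun m _ => by abel

lemma Link.mem (X : Ctx B N η L A κ f) (H : StepData B N η κ C T P W W₀ V) {Z Z' v : ℤ → E}
    (h : Link B N f T W V Z Z' v) : MemT N T W 0 v := by
  obtain ⟨D, hD, hb⟩ := h.near
  refine (((MemT.of_full (w := V) (n := 0) (T := T) hD fun m => by
    rw [sub_zero]; exact hb m).mono H.V_le).sub X.hN h.split.mem).congr fun m _ => ?_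
  abel

lemma Link.mem_compl (X : Ctx B N η L A κ f) (H : StepData B N η κ C T P W W₀ V) {Z Z' v : ℤ → E}
    (hZ : Cls B N f T P W₀ Z) (h : Link B N f T W V Z Z' v) : MemT N Tᶜ W₀ 0 v := by
  obtain ⟨D, hD, hb⟩ := h.near
  refine (((MemT.of_full (w := V) (n := 0) (T := Tᶜ) hD fun m => by
    rw [sub_zero]; exact hb m).mono H.V_le_compl).add X.hN (hZ.mem_compl.sub X.hN
      (h.split.mem_compl.mono H.W_le_compl))).congr fun m _ => ?_
  abel

/-- Lipschitz dependence of the two parts of an orbit, locally uniformly. -/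
lemma StepData.upper (X : Ctx B N η L A κ f) (H : StepData B N η κ C T P W W₀ V) {R : ℝ}
    (hR : 0 ≤ R) : ∃ K : ℝ, 0 ≤ K ∧ ∀ (n : ℤ) (Z Z' v Z₁ Z₁' v₁ : ℤ → E),
      Cls B N f T P W₀ Z → Cls B N f T P W₀ Z₁ → Link B N f T W V Z Z' v →
      Link B N f T W V Z₁ Z₁' v₁ → N n (Z n) ≤ R → N n (Z₁ n) ≤ R →
      (∀ m, N m ((Z₁' m - cut T n Z₁ m) - (Z' m - cut T n Z m)) ≤
        K * N n (Z₁ n - Z n) * W (m - n)) ∧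
      ∀ m, N m ((v₁ m - (Z₁ m - Z₁' m)) - (v m - (Z m - Z' m))) ≤
        K * N n (Z₁ n - Z n) * V (m - n) := by
  have hN := X.hN
  have hη := X.hη
  have hL := X.hL
  obtain ⟨K₁, hK₁, b₁⟩ := exists_orbit_halfBound X H.goodP H.half
  obtain ⟨K₂, hK₂, b₂⟩ := exists_orbit_halfBound X H.goodW₀ H.half.compl
  obtain ⟨K₅, hK₅, b₅⟩ := exists_orbit_halfBound X H.goodW H.half.compl
  obtain ⟨lo, hi, S, hW⟩ := H.goodW
  obtain ⟨lo', hi', S', hV⟩ := H.goodV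
  obtain ⟨K₃, hK₃, b₃⟩ := exists_split_bound X S hW H.half
  obtain ⟨K₄, hK₄, b₄⟩ := exists_split_lip X S hW H.half
  have G := S'.toGap X.linear
  have hC := G.C_pos
  set Ka : ℝ := K₄ * (1 + L * K₁ * K₃ * R) with hKa
  have hKa0 : 0 ≤ Ka := by positivity
  set Kb : ℝ := L * K₁ * K₃ * R + L * (2 * (K₁ + K₃) * R) * Ka + η * (K₂ + Ka) with hKb
  have hKb0 : 0 ≤ Kb := by positivity
  refine ⟨Ka + 2 * C * Kb, by positivity,
    fun n Z Z' v Z₁ Z₁' v₁ hZ hZ₁ h h₁ hr hr₁ => ?_⟩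
  set δ : ℝ := N n (Z₁ n - Z n) with hδ
  have hδ0 : 0 ≤ δ := (hN n).nonneg _
  have bZ : ∀ {Z : ℤ → E}, Cls B N f T P W₀ Z → N n (Z n) ≤ R → ∀ m, m - n ∈ T →
      N m (Z m) ≤ K₁ * R * P (m - n) := fun {Z} hZ hr m hm => by
    have := b₁ n (fun _ => 0) Z (isOrbit_zero X) hZ.orbit (MemT.zero hN) hZ.mem m hm
    simp only [sub_zero] at this
    refine this.trans ?_
    have := (H.goodP.pos (m - n)).le
    gcongr
  have bU : ∀ {Z Z' v : ℤ → E}, Cls B N f T P W₀ Z → Link B N f T W V Z Z' v → N n (Z n) ≤ R →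
      ∀ m, m - n ∈ T → N m (Z' m - Z m) ≤ K₃ * R * W (m - n) := fun {Z Z' v} hZ h hr m hm => by
    have := b₃ n Z Z' hZ.orbit h.split m
    rw [cut_of_mem hm] at this
    refine this.trans ?_
    have := (hW.pos (m - n)).le
    gcongr
  have bD : ∀ m, m - n ∈ T → N m (Z₁ m - Z m) ≤ K₁ * δ * P (m - n) :=
    b₁ n Z Z₁ hZ.orbit hZ₁.orbit hZ.mem hZ₁.mem
  -- second differences of `f` along the two orbits
  have sd : ∀ m, m - n ∈ T → N (m + 1) (f m (Z₁ m + (Z' m - Z m)) - f m (Z₁ m) -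
      (f m (Z m + (Z' m - Z m)) - f m (Z m))) ≤
        L * K₁ * K₃ * R * δ * (P (m - n) * W (m - n)) := fun m hm => by
    have e1 := bD m hm
    have e2 := bU hZ h hr m hm
    have n1 := (hN m).nonneg (Z₁ m - Z m)
    have n2 := (hN m).nonneg (Z' m - Z m)
    have n3 := (H.goodP.pos (m - n)).le
    calc _ ≤ L * N m (Z₁ m - Z m) * N m (Z' m - Z m) := X.hf.second_diff hN m _ _ _
      _ ≤ L * (K₁ * δ * P (m - n)) * (K₃ * R * W (m - n)) := by gcongr
      _ = _ := by ring
  have hA : ∀ m, N m ((Z₁' m - cut T n Z₁ m) - (Z' m - cut T n Z m)) ≤ Ka * δ * W (m - n) := by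
    intro m
    refine (b₄ n Z Z' Z₁ Z₁' hZ.orbit hZ₁.orbit h.split h₁.split (L * K₁ * K₃ * R * δ)
      (by positivity) (fun m hm => (sd m hm).trans ?_) m).trans (le_of_eq ?_)
    · have e1 := H.P_le _ hm
      have e2 := (hW.pos (m - n)).le
      have : P (m - n) * W (m - n) ≤ W (m - n) := by nlinarith
      gcongr
    · rw [hKa]
      ring
  obtain ⟨D, hD, hb⟩ := h.near
  obtain ⟨D₁, hD₁, hb₁⟩ := h₁.near
  have key : ∀ m, N (m + 1) ((f m (Z₁ m) - f m (Z₁' m)) - (f m (Z m) - f m (Z' m))) ≤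
      Kb * δ * V (m - n) := by
    intro m
    have hVm := hV.pos (m - n)
    by_cases hm : m - n ∈ T
    · have hPm := (H.goodP.pos (m - n)).le
      have hWm := (hW.pos (m - n)).le
      have hPW := H.PW_le _ hm
      have e1 := sd m hm
      have e2 := hA m
      rw [cut_of_mem hm, cut_of_mem hm] at e2
      have e3 := bU hZ h hr m hm
      have e4 := bU hZ₁ h₁ hr₁ m hm
      have e5 := bZ hZ₁ hr₁ m hm
      have e6 := mul_le_mul_of_nonneg_left (H.W_le _ hm) (by positivity : 0 ≤ K₃ * R)
      have e7 : N m (Z₁ m + (Z' m - Z m)) ≤ (K₁ + K₃) * R * P (m - n) := by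
        have := (hN m).add_le (Z₁ m) (Z' m - Z m)
        linarith
      have e8 : N m (Z₁' m) ≤ (K₁ + K₃) * R * P (m - n) := by
        have := (hN m).le_of_eq_add (z := Z₁' m) (x := Z₁ m) (y := Z₁' m - Z₁ m) (by abel)
        linarith
      have e9 : N m (Z₁ m + (Z' m - Z m) - Z₁' m) ≤ Ka * δ * W (m - n) := by
        rw [(hN m).sub_comm]
        refine le_trans (le_of_eq ?_) e2
        congr 1
        abel
      have e10 : N (m + 1) (f m (Z₁ m + (Z' m - Z m)) - f m (Z₁' m)) ≤
          L * (2 * (K₁ + K₃) * R) * Ka * δ * (P (m - n) * W (m - n)) := by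
        have n1 := (hN m).nonneg (Z₁ m + (Z' m - Z m))
        have n2 := (hN m).nonneg (Z₁' m)
        have n3 := (hN m).nonneg (Z₁ m + (Z' m - Z m) - Z₁' m)
        calc _ ≤ L * (N m (Z₁ m + (Z' m - Z m)) + N m (Z₁' m)) *
              N m (Z₁ m + (Z' m - Z m) - Z₁' m) := X.hf.lip_local hN hL m _ _
          _ ≤ L * ((K₁ + K₃) * R * P (m - n) + (K₁ + K₃) * R * P (m - n)) *
              (Ka * δ * W (m - n)) := by gcongr
          _ = _ := by ring
      have e11 := (hN (m + 1)).le_of_eq_sub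
        (z := (f m (Z₁ m) - f m (Z₁' m)) - (f m (Z m) - f m (Z' m)))
        (x := f m (Z₁ m + (Z' m - Z m)) - f m (Z₁' m))
        (y := f m (Z₁ m + (Z' m - Z m)) - f m (Z₁ m) -
          (f m (Z m + (Z' m - Z m)) - f m (Z m))) (by
            rw [add_sub_cancel (Z m) (Z' m)]
            abel)
      have e12 := mul_le_mul_of_nonneg_left hPW (by positivity :
        0 ≤ (L * K₁ * K₃ * R + L * (2 * (K₁ + K₃) * R) * Ka) * δ)
      have e13 : 0 ≤ η * (K₂ + Ka) * δ * V (m - n) := by positivity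
      rw [hKb]
      linarith
    · have e1 := b₂ n Z Z₁ hZ.orbit hZ₁.orbit hZ.mem_compl hZ₁.mem_compl m hm
      have e2 := hA m
      rw [cut_of_notMem hm, cut_of_notMem hm, sub_zero, sub_zero] at e2
      have e3 := X.hf.lip hN m (Z₁ m) (Z m)
      have e4 := X.hf.lip hN m (Z₁' m) (Z' m)
      have e5 := H.W_le_compl _ hm
      have e6 := H.le_V_compl _ hm
      have e7 := mul_le_mul_of_nonneg_left e6 (by positivity : 0 ≤ K₂ * δ)
      have e8 := mul_le_mul_of_nonneg_left (e5.trans e6) (by positivity : 0 ≤ Ka * δ)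
      have e9 := mul_le_mul_of_nonneg_left (e1.trans e7) hη
      have e10 := mul_le_mul_of_nonneg_left (e2.trans e8) hη
      have e11 := (hN (m + 1)).le_of_eq_sub
        (z := (f m (Z₁ m) - f m (Z₁' m)) - (f m (Z m) - f m (Z' m)))
        (x := f m (Z₁ m) - f m (Z m)) (y := f m (Z₁' m) - f m (Z' m)) (by abel)
      have e13 : 0 ≤ (L * K₁ * K₃ * R + L * (2 * (K₁ + K₃) * R) * Ka) * δ * V (m - n) := by
        positivity
      rw [hKb]
      linarith
  refine ⟨fun m => (hA m).trans ?_, fun m => ?_⟩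
  · have := (hW.pos (m - n)).le
    have : 0 ≤ 2 * C * Kb * δ * W (m - n) := by positivity
    linarith
  · have e1 := G.shadow_lip hN X.linear.hf (hV.shift n) hV (D₁ := Kb * δ) (D₂ := 0)
      (D₃ := D + D₁) (by positivity) le_rfl (χ := fun m => Z m - Z' m)
      (χ' := fun m => Z₁ m - Z₁' m) h.orbit h₁.orbit (fun m => by
        refine le_trans (le_of_eq ?_) (key m)
        congr 1
        rw [hZ.orbit m, h.split.orbit m, hZ₁.orbit m, h₁.split.orbit m, map_sub, map_sub]
        abel) (fun m => by simp [(hN _).map_zero]) (fun m => by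
        have a1 := (hN m).sub_le (v₁ m - (Z₁ m - Z₁' m)) (v m - (Z m - Z' m))
        have := hb m
        have := hb₁ m
        linarith) m
    have := (hV.pos (m - n)).le
    have : 0 ≤ Ka * δ * V (m - n) := by positivity
    linarith

end step

/-- A map between orbits of the nonlinear and of the linear system, which is locally uniformly
bi-Lipschitz and preserves strict differentiability in parameters. -/
structure Conj (B : ℤ → (E ≃L[ℝ] E)) (N : ℤ → E → ℝ) (f : ℤ → E → E) (T : Set ℤ) (P W : ℤ → ℝ)
    (Ψ : (ℤ → E) → (ℤ → E)) : Prop where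
  zero : Ψ (fun _ => 0) = fun _ => 0
  maps : ∀ y, Cls B N f T P W y → Cls B N (fun _ _ => 0) T P W (Ψ y)
  surj : ∀ s, Cls B N (fun _ _ => 0) T P W s → ∃ y, Cls B N f T P W y ∧ Ψ y = s
  upper : ∀ R : ℝ, 0 ≤ R → ∃ K : ℝ, 0 ≤ K ∧ ∀ (n : ℤ) (y y₁ : ℤ → E), Cls B N f T P W y →
    Cls B N f T P W y₁ → N n (y n) ≤ R → N n (y₁ n) ≤ R →
    N n (Ψ y₁ n - Ψ y n) ≤ K * N n (y₁ n - y n)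
  lower : ∀ R : ℝ, 0 ≤ R → ∃ K : ℝ, 0 ≤ K ∧ ∀ (n : ℤ) (y y₁ : ℤ → E), Cls B N f T P W y →
    Cls B N f T P W y₁ → N n (y n) ≤ R → N n (y₁ n) ≤ R →
    N n (y₁ n - y n) ≤ K * N n (Ψ y₁ n - Ψ y n)
  diff : ∀ (ξ : E) (y : E → ℤ → E), (∀ ζ, Cls B N f T P W (y ζ)) → StrictDiff y ξ →
    StrictDiff (fun ζ => Ψ (y ζ)) ξ

section step

variable [FiniteDimensional ℝ E] {B : ℤ → (E ≃L[ℝ] E)} {N : ℤ → E → ℝ} {η L A κ C : ℝ}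
  {f : ℤ → E → E} {T : Set ℤ} {P W W₀ V : ℤ → ℝ}

/-- The bounds at the centre which follow from `StepData.upper`. -/
lemma StepData.upper_centre (X : Ctx B N η L A κ f) (H : StepData B N η κ C T P W W₀ V) {R : ℝ}
    (hR : 0 ≤ R) : ∃ K : ℝ, 0 ≤ K ∧ ∀ (n : ℤ) (Z Z' v Z₁ Z₁' v₁ : ℤ → E),
      Cls B N f T P W₀ Z → Cls B N f T P W₀ Z₁ → Link B N f T W V Z Z' v →
      Link B N f T W V Z₁ Z₁' v₁ → N n (Z n) ≤ R → N n (Z₁ n) ≤ R →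
      N n (Z₁' n - Z' n) ≤ K * N n (Z₁ n - Z n) ∧ N n (v₁ n - v n) ≤ K * N n (Z₁ n - Z n) := by
  have hN := X.hN
  obtain ⟨K, hK, hb⟩ := H.upper X hR
  have hW0 := H.goodW.pos 0
  have hV0 := H.goodV.pos 0
  refine ⟨(1 + K * W 0) + (1 + (1 + K * W 0) + K * V 0), by positivity,
    fun n Z Z' v Z₁ Z₁' v₁ hZ hZ₁ h h₁ hr hr₁ => ?_⟩
  obtain ⟨ha, hv⟩ := hb n Z Z' v Z₁ Z₁' v₁ hZ hZ₁ h h₁ hr hr₁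
  have e1 := ha n
  have e2 := hv n
  rw [sub_self] at e1 e2
  have e3 := norm_cut_le (T := T) hN n Z Z₁
  have hδ0 : 0 ≤ N n (Z₁ n - Z n) := (hN n).nonneg _
  have e4 : N n (Z₁' n - Z' n) ≤ (1 + K * W 0) * N n (Z₁ n - Z n) := by
    have := (hN n).le_of_eq_add (z := Z₁' n - Z' n)
      (x := (Z₁' n - cut T n Z₁ n) - (Z' n - cut T n Z n)) (y := cut T n Z₁ n - cut T n Z n)
      (by abel)
    linarith
  have e5 : N n (v₁ n - v n) ≤ (1 + (1 + K * W 0) + K * V 0) * N n (Z₁ n - Z n) := by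
    have a1 := (hN n).le_of_eq_add (z := v₁ n - v n)
      (x := (v₁ n - (Z₁ n - Z₁' n)) - (v n - (Z n - Z' n)))
      (y := (Z₁ n - Z n) - (Z₁' n - Z' n)) (by abel)
    have a2 := (hN n).sub_le (Z₁ n - Z n) (Z₁' n - Z' n)
    linarith
  have p1 : 0 ≤ (1 + K * W 0) * N n (Z₁ n - Z n) := by positivity
  have p2 : 0 ≤ (1 + (1 + K * W 0) + K * V 0) * N n (Z₁ n - Z n) := by positivity
  constructor <;> linarith

/-- The bounds for the two parts of a single orbit. -/
lemma StepData.bounds (X : Ctx B N η L A κ f) (H : StepData B N η κ C T P W W₀ V) {R : ℝ}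
    (hR : 0 ≤ R) : ∃ K : ℝ, 0 ≤ K ∧ ∀ (n : ℤ) (Z Z' v : ℤ → E),
      Cls B N f T P W₀ Z → Link B N f T W V Z Z' v → N n (Z n) ≤ R →
      N n (Z' n) ≤ K ∧ (∀ m, N m (Z m - (Z' m + v m)) ≤ K * V (m - n)) ∧
      (∀ m, m - n ∈ T → N m (v m) ≤ K * W (m - n)) ∧
      ∀ m, m - n ∈ T → N m (Z' m) ≤ K * P (m - n) := by
  have hN := X.hN
  obtain ⟨K, hK, hb⟩ := H.upper X hR
  obtain ⟨K₀, hK₀, hb₀⟩ := H.upper_centre X hR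
  obtain ⟨K₁, hK₁, b₁⟩ := exists_orbit_halfBound X H.goodP H.half
  refine ⟨K₀ * R + (K * R + K * R) + K₁ * R, by positivity, fun n Z Z' v hZ h hr => ?_⟩
  have hc : ∀ m, cut T n (fun _ => (0 : E)) m = 0 := fun m => by simp [cut]
  have z0 : N n (0 : E) ≤ R := by rw [(hN n).map_zero]; exact hR
  have n0 : 0 ≤ N n (Z n) := (hN n).nonneg _
  obtain ⟨ha, hv⟩ := hb n _ _ _ Z Z' v (Cls.zero X) hZ (Link.zero X H) h z0 hr
  have hz := (hb₀ n _ _ _ Z Z' v (Cls.zero X) hZ (Link.zero X H) h z0 hr).1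
  simp only [sub_zero, hc] at ha hv hz
  have kR : K * N n (Z n) ≤ K * R := by gcongr
  have k0R : K₀ * N n (Z n) ≤ K₀ * R := by gcongr
  have k1R : K₁ * N n (Z n) ≤ K₁ * R := by gcongr
  have p0 : 0 ≤ K * R := by positivity
  have p1 : 0 ≤ K₀ * R := by positivity
  have p2 : 0 ≤ K₁ * R := by positivity
  have eA : ∀ m, m - n ∈ T → N m (Z' m - Z m) ≤ K * R * W (m - n) := fun m hm => by
    have e1 := ha m
    rw [cut_of_mem hm] at e1
    have := (H.goodW.pos (m - n)).le
    exact e1.trans (by gcongr)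
  have eV : ∀ m, N m (v m - (Z m - Z' m)) ≤ K * R * V (m - n) := fun m => by
    have := (H.goodV.pos (m - n)).le
    exact (hv m).trans (by gcongr)
  refine ⟨by linarith, fun m => ?_, fun m hm => ?_, fun m hm => ?_⟩
  · have e1 := eV m
    rw [(hN m).sub_comm] at e1
    have := (H.goodV.pos (m - n)).le
    have e2 : Z m - Z' m - v m = Z m - (Z' m + v m) := by abel
    rw [e2] at e1
    refine e1.trans ?_
    gcongr
    linarith
  · have e1 := eV m
    have e2 := eA m hm
    have e3 := (hN m).le_of_eq_sub (z := v m) (x := v m - (Z m - Z' m)) (y := Z' m - Z m)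
      (by abel)
    have e4 := mul_le_mul_of_nonneg_left (H.V_le _ hm) p0
    have := (H.goodW.pos (m - n)).le
    calc _ ≤ (K * R + K * R) * W (m - n) := by linarith
      _ ≤ _ := mul_le_mul_of_nonneg_right (by linarith) this
  · have e1 := b₁ n (fun _ => 0) Z (isOrbit_zero X) hZ.orbit (MemT.zero hN) hZ.mem m hm
    simp only [sub_zero] at e1
    have e2 := eA m hm
    have e3 := (hN m).le_of_eq_add (z := Z' m) (x := Z m) (y := Z' m - Z m) (by abel)
    have e4 := mul_le_mul_of_nonneg_left (H.W_le _ hm) p0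
    have := (H.goodP.pos (m - n)).le
    have e5 : K₁ * N n (Z n) * P (m - n) ≤ K₁ * R * P (m - n) := by gcongr
    calc _ ≤ (K * R + K₁ * R) * P (m - n) := by linarith
      _ ≤ _ := mul_le_mul_of_nonneg_right (by linarith) this

lemma Link.linear_split (X : Ctx B N η L A κ f) (H : StepData B N η κ C T P W W₀ V)
    {Z Z' v ψ : ℤ → E} (h : Link B N f T W V Z Z' v) (hψ : Cls B N (fun _ _ => 0) T P W ψ) :
    Split B N (fun _ _ => 0) T W (fun m => v m + ψ m) ψ := by
  refine ⟨hψ.orbit, ?_, hψ.mem_compl⟩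
  refine ((MemT.zero (w := W) (T := T) (n := 0) X.hN).sub X.hN (h.mem X H)).congr fun m _ => ?_
  abel

/-- The inverse estimate: the orbit is controlled by its linearised image. -/
lemma StepData.lower (X : Ctx B N η L A κ f) (H : StepData B N η κ C T P W W₀ V) {R : ℝ}
    (hR : 0 ≤ R) {KΨ : ℝ} (hKΨ : 0 ≤ KΨ) : ∃ K : ℝ, 0 ≤ K ∧
      ∀ (n : ℤ) (Z Z' v ψ Z₁ Z₁' v₁ ψ₁ : ℤ → E),
      Cls B N f T P W₀ Z → Cls B N f T P W₀ Z₁ → Link B N f T W V Z Z' v →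
      Link B N f T W V Z₁ Z₁' v₁ → Cls B N (fun _ _ => 0) T P W ψ →
      Cls B N (fun _ _ => 0) T P W ψ₁ → N n (Z n) ≤ R → N n (Z₁ n) ≤ R →
      N n (Z₁' n - Z' n) ≤ KΨ * N n (ψ₁ n - ψ n) →
      N n (Z₁ n - Z n) ≤ K * N n ((v₁ n + ψ₁ n) - (v n + ψ n)) := by
  have hN := X.hN
  have hη := X.hη
  have hL := X.hL
  obtain ⟨M, hM, bM⟩ := H.bounds X hR
  obtain ⟨K₁, hK₁, b₁⟩ := exists_orbit_halfBound X H.goodP H.half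
  obtain ⟨K₂, hK₂, b₂⟩ := exists_orbit_halfBound X.linear H.goodW₀ H.half.compl
  obtain ⟨K₅, hK₅, b₅⟩ := exists_orbit_halfBound X H.goodW H.half.compl
  obtain ⟨lo, hi, S, hW⟩ := H.goodW
  obtain ⟨lo', hi', S', hV⟩ := H.goodV
  obtain ⟨K₄, hK₄, b₄⟩ := exists_split_lip X.linear S hW H.half
  have G := S'.toGap X
  have hC := G.C_pos
  have hW0 := hW.pos 0
  have hV0 := hV.pos 0
  -- constants for the differences of `ψ` and `v` at the centre, of `Z'` at the centre
  set k₁ : ℝ := 1 + K₄ * W 0 with hk₁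
  have hk₁0 : 0 ≤ k₁ := by positivity
  set k₂ : ℝ := 1 + k₁ with hk₂
  have hk₂0 : 0 ≤ k₂ := by positivity
  set k₃ : ℝ := KΨ * k₁ with hk₃
  have hk₃0 : 0 ≤ k₃ := by positivity
  set kT : ℝ := K₁ * k₃ + K₄ with hkT
  have hkT0 : 0 ≤ kT := by positivity
  set kN : ℝ := K₅ * k₃ + K₂ * k₂ with hkN
  have hkN0 : 0 ≤ kN := by positivity
  set D₁ : ℝ := L * (K₁ * k₃) * M + L * (2 * (M + M)) * K₄ + η * (kN + K₅ * k₃) with hD₁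
  have hD₁0 : 0 ≤ D₁ := by positivity
  set D₂ : ℝ := L * kT * M + 2 * η * kN with hD₂
  have hD₂0 : 0 ≤ D₂ := by positivity
  refine ⟨k₃ + k₂ + 2 * C * (D₁ + D₂) * V 0, by positivity,
    fun n Z Z' v ψ Z₁ Z₁' v₁ ψ₁ hZ hZ₁ h h₁ hψ hψ₁ hr hr₁ hind => ?_⟩
  obtain ⟨-, mE, mv, mZ'⟩ := bM n Z Z' v hZ h hr
  obtain ⟨-, mE₁, mv₁, mZ₁'⟩ := bM n Z₁ Z₁' v₁ hZ₁ h₁ hr₁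
  set δ : ℝ := N n ((v₁ n + ψ₁ n) - (v n + ψ n)) with hδ
  have hδ0 : 0 ≤ δ := (hN n).nonneg _
  have cZ' := h.cls X H hZ
  have cZ₁' := h₁.cls X H hZ₁
  have hs : IsOrbit B (fun _ _ => 0) (fun m => v m + ψ m) := h.orbit.add_linear hψ.orbit
  have hs₁ : IsOrbit B (fun _ _ => 0) (fun m => v₁ m + ψ₁ m) := h₁.orbit.add_linear hψ₁.orbit
  have hψb : ∀ m, N m ((ψ₁ m - cut T n (fun m => v₁ m + ψ₁ m) m) -
      (ψ m - cut T n (fun m => v m + ψ m) m)) ≤ K₄ * δ * W (m - n) := fun m => by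
    have := b₄ n _ _ _ _ hs hs₁ (h.linear_split X H hψ) (h₁.linear_split X H hψ₁) 0 le_rfl
      (fun m _ => by simp [(hN _).map_zero]) m
    rwa [add_zero] at this
  have cψ : N n (ψ₁ n - ψ n) ≤ k₁ * δ := by
    have e1 := hψb n
    have e2 := norm_cut_le (T := T) hN n (fun m => v m + ψ m) (fun m => v₁ m + ψ₁ m)
    have e3 := (hN n).le_of_eq_add (z := ψ₁ n - ψ n)
      (x := (ψ₁ n - cut T n (fun m => v₁ m + ψ₁ m) n) - (ψ n - cut T n (fun m => v m + ψ m) n))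
      (y := cut T n (fun m => v₁ m + ψ₁ m) n - cut T n (fun m => v m + ψ m) n) (by abel)
    rw [sub_self] at e1
    rw [hk₁]
    linarith
  have cv : N n (v₁ n - v n) ≤ k₂ * δ := by
    have e3 := (hN n).le_of_eq_sub (z := v₁ n - v n)
      (x := (v₁ n + ψ₁ n) - (v n + ψ n)) (y := ψ₁ n - ψ n) (by abel)
    rw [hk₂]
    linarith
  have cZ : N n (Z₁' n - Z' n) ≤ k₃ * δ := by
    have := mul_le_mul_of_nonneg_left cψ hKΨ
    rw [hk₃]
    linarith
  have tv : ∀ m, m - n ∈ T → N m (v₁ m - v m) ≤ K₄ * δ * W (m - n) := fun m hm => by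
    have e1 := hψb m
    rw [cut_of_mem hm, cut_of_mem hm, (hN m).sub_comm] at e1
    refine le_trans (le_of_eq ?_) e1
    congr 1
    abel
  have tZ : ∀ m, m - n ∈ T → N m (Z₁' m - Z' m) ≤ K₁ * k₃ * δ * P (m - n) := fun m hm => by
    have e1 := b₁ n Z' Z₁' cZ'.orbit cZ₁'.orbit cZ'.mem cZ₁'.mem m hm
    have e2 := (H.goodP.pos (m - n)).le
    calc _ ≤ K₁ * (k₃ * δ) * P (m - n) := e1.trans (by gcongr)
      _ = _ := by ring
  have ov : ∀ m, m - n ∉ T → N m (v₁ m - v m) ≤ K₂ * k₂ * δ * V (m - n) := fun m hm => by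
    have e1 := b₂ n v v₁ h.orbit h₁.orbit (h.mem_compl X H hZ) (h₁.mem_compl X H hZ₁) m hm
    have e2 := (H.goodW₀.pos (m - n)).le
    have e3 := H.le_V_compl _ hm
    calc _ ≤ K₂ * (k₂ * δ) * V (m - n) := e1.trans (by gcongr)
      _ = _ := by ring
  have oZ : ∀ m, m - n ∉ T → N m (Z₁' m - Z' m) ≤ K₅ * k₃ * δ * V (m - n) := fun m hm => by
    have e1 := b₅ n Z' Z₁' cZ'.orbit cZ₁'.orbit cZ'.mem_compl cZ₁'.mem_compl m hm
    have e2 := (hW.pos (m - n)).le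
    have e3 := (H.W_le_compl _ hm).trans (H.le_V_compl _ hm)
    calc _ ≤ K₅ * (k₃ * δ) * V (m - n) := e1.trans (by gcongr)
      _ = _ := by ring
  have tχ : ∀ m, m - n ∈ T → N m ((Z₁' m + v₁ m) - (Z' m + v m)) ≤ kT * δ := fun m hm => by
    have e1 := tv m hm
    have e2 := tZ m hm
    have e3 := H.P_le _ hm
    have e4 := (H.W_le _ hm).trans e3
    have e5 := mul_le_mul_of_nonneg_left e4 (by positivity : 0 ≤ K₄ * δ)
    have e6 := mul_le_mul_of_nonneg_left e3 (by positivity : 0 ≤ K₁ * k₃ * δ)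
    have e7 := (hN m).le_of_eq_add (z := (Z₁' m + v₁ m) - (Z' m + v m))
      (x := Z₁' m - Z' m) (y := v₁ m - v m) (by abel)
    rw [hkT]
    linarith
  have oχ : ∀ m, m - n ∉ T → N m ((Z₁' m + v₁ m) - (Z' m + v m)) ≤ kN * δ * V (m - n) :=
    fun m hm => by
    have e1 := ov m hm
    have e2 := oZ m hm
    have e7 := (hN m).le_of_eq_add (z := (Z₁' m + v₁ m) - (Z' m + v m))
      (x := Z₁' m - Z' m) (y := v₁ m - v m) (by abel)
    rw [hkN]
    linarith
  have key₁ : ∀ m, N (m + 1) ((f m (Z₁' m) - f m (Z₁' m + v₁ m)) -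
      (f m (Z' m) - f m (Z' m + v m))) ≤ D₁ * δ * V (m - n) := by
    intro m
    have hVm := hV.pos (m - n)
    by_cases hm : m - n ∈ T
    · have hPm := (H.goodP.pos (m - n)).le
      have hWm := (hW.pos (m - n)).le
      have hPW := H.PW_le _ hm
      have n1 := (hN m).nonneg (Z₁' m - Z' m)
      have n2 := (hN m).nonneg (v m)
      have e1 : N (m + 1) (f m (Z₁' m + v m) - f m (Z₁' m) - (f m (Z' m + v m) - f m (Z' m))) ≤
          L * (K₁ * k₃) * M * δ * (P (m - n) * W (m - n)) := by
        calc _ ≤ L * N m (Z₁' m - Z' m) * N m (v m) := X.hf.second_diff hN m _ _ _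
          _ ≤ L * (K₁ * k₃ * δ * P (m - n)) * (M * W (m - n)) := by
            have := tZ m hm
            have := mv m hm
            gcongr
          _ = _ := by ring
      have e2 : N (m + 1) (f m (Z₁' m + v m) - f m (Z₁' m + v₁ m)) ≤
          L * (2 * (M + M)) * K₄ * δ * (P (m - n) * W (m - n)) := by
        have a1 := (hN m).add_le (Z₁' m) (v m)
        have a2 := (hN m).add_le (Z₁' m) (v₁ m)
        have a3 := mZ₁' m hm
        have a4 := mul_le_mul_of_nonneg_left (H.W_le _ hm) hM
        have a5 := mv m hm
        have a6 := mv₁ m hm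
        have a7 : N m (Z₁' m + v m) ≤ (M + M) * P (m - n) := by linarith
        have a8 : N m (Z₁' m + v₁ m) ≤ (M + M) * P (m - n) := by linarith
        have a9 := tv m hm
        rw [(hN m).sub_comm] at a9
        have a10 : Z₁' m + v m - (Z₁' m + v₁ m) = v m - v₁ m := by abel
        have n3 := (hN m).nonneg (v m - v₁ m)
        have n4 := (hN m).nonneg (Z₁' m + v m)
        have n5 := (hN m).nonneg (Z₁' m + v₁ m)
        calc _ ≤ L * (N m (Z₁' m + v m) + N m (Z₁' m + v₁ m)) *
              N m (Z₁' m + v m - (Z₁' m + v₁ m)) := X.hf.lip_local hN hL m _ _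
          _ = L * (N m (Z₁' m + v m) + N m (Z₁' m + v₁ m)) * N m (v m - v₁ m) := by rw [a10]
          _ ≤ L * ((M + M) * P (m - n) + (M + M) * P (m - n)) * (K₄ * δ * W (m - n)) := by
            gcongr
          _ = _ := by ring
      have e3 := (hN (m + 1)).le_of_eq_sub (z := (f m (Z₁' m) - f m (Z₁' m + v₁ m)) -
        (f m (Z' m) - f m (Z' m + v m))) (x := f m (Z₁' m + v m) - f m (Z₁' m + v₁ m))
        (y := f m (Z₁' m + v m) - f m (Z₁' m) - (f m (Z' m + v m) - f m (Z' m))) (by abel)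
      have e4 := mul_le_mul_of_nonneg_left hPW (by positivity :
        0 ≤ (L * (K₁ * k₃) * M + L * (2 * (M + M)) * K₄) * δ)
      have e5 : 0 ≤ η * (kN + K₅ * k₃) * δ * V (m - n) := by positivity
      rw [hD₁]
      linarith
    · have e1 := mul_le_mul_of_nonneg_left (oχ m hm) hη
      have e2 := mul_le_mul_of_nonneg_left (oZ m hm) hη
      have e3 := X.hf.lip hN m (Z₁' m + v₁ m) (Z' m + v m)
      have e4 := X.hf.lip hN m (Z₁' m) (Z' m)
      have e5 := (hN (m + 1)).le_of_eq_sub (z := (f m (Z₁' m) - f m (Z₁' m + v₁ m)) -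
        (f m (Z' m) - f m (Z' m + v m))) (x := f m (Z₁' m) - f m (Z' m))
        (y := f m (Z₁' m + v₁ m) - f m (Z' m + v m)) (by abel)
      have e6 : 0 ≤ (L * (K₁ * k₃) * M + L * (2 * (M + M)) * K₄) * δ * V (m - n) := by
        positivity
      rw [hD₁]
      linarith
  have key₂ : ∀ m, N (m + 1) (f m (Z₁' m + v₁ m + (Z m - (Z' m + v m))) - f m (Z₁' m + v₁ m) -
      (f m (Z' m + v m + (Z m - (Z' m + v m))) - f m (Z' m + v m))) ≤ D₂ * δ * V (m - n) := by
    intro m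
    have hVm := (hV.pos (m - n)).le
    by_cases hm : m - n ∈ T
    · have n1 := (hN m).nonneg ((Z₁' m + v₁ m) - (Z' m + v m))
      have n2 := (hN m).nonneg (Z m - (Z' m + v m))
      have e5 : 0 ≤ 2 * η * kN * δ * V (m - n) := by positivity
      calc _ ≤ L * N m ((Z₁' m + v₁ m) - (Z' m + v m)) * N m (Z m - (Z' m + v m)) :=
            X.hf.second_diff hN m _ _ _
        _ ≤ L * (kT * δ) * (M * V (m - n)) := by
            have := tχ m hm
            have := mE m
            gcongr
        _ ≤ _ := by
            rw [hD₂]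
            linarith
    · have e1 := mul_le_mul_of_nonneg_left (oχ m hm) (by positivity : 0 ≤ 2 * η)
      have e5 : 0 ≤ L * kT * M * δ * V (m - n) := by positivity
      refine (X.hf.second_diff_le_left hN m _ _ _).trans (e1.trans ?_)
      rw [hD₂]
      linarith
  have fin := G.shadow_lip hN X.hf (hV.shift n) (hV.shift n) (D₁ := D₁ * δ) (D₂ := D₂ * δ)
    (D₃ := M + M) (by positivity) (by positivity) (χ := fun m => Z' m + v m)
    (χ' := fun m => Z₁' m + v₁ m) hZ.orbit hZ₁.orbit (fun m => by
      refine le_trans (le_of_eq ?_) (key₁ m)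
      congr 1
      rw [h.split.orbit m, h₁.split.orbit m, h.orbit m, h₁.orbit m, map_add, map_add]
      abel) key₂ (fun m => by
      have a1 := (hN m).sub_le (Z₁ m - (Z₁' m + v₁ m)) (Z m - (Z' m + v m))
      have := mE m
      have := mE₁ m
      linarith) n
  rw [sub_self] at fin
  have e1 := (hN n).le_of_eq_add (z := Z₁ n - Z n)
    (x := (Z₁ n - (Z₁' n + v₁ n)) - (Z n - (Z' n + v n)))
    (y := (Z₁' n + v₁ n) - (Z' n + v n)) (by abel)
  have e2 := (hN n).le_of_eq_add (z := (Z₁' n + v₁ n) - (Z' n + v n))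
      (x := Z₁' n - Z' n) (y := v₁ n - v n) (by abel)
  linarith

end step

section step

variable [FiniteDimensional ℝ E] {B : ℤ → (E ≃L[ℝ] E)} {N : ℤ → E → ℝ} {η L A κ C : ℝ}
  {f : ℤ → E → E} {T : Set ℤ} {P W W₀ V : ℤ → ℝ}

lemma StrictDiff.eventually_norm_le {N : E → ℝ} (hN : IsNormOn N) {Z : E → ℤ → E} {ξ : E}
    (hZ : StrictDiff Z ξ) (m : ℤ) :
    ∀ᶠ p : E × E in 𝓝 (ξ, ξ), N (Z p.1 m) ≤ N (Z ξ m) + 1 ∧ N (Z p.2 m) ≤ N (Z ξ m) + 1 := by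
  obtain ⟨a, ha⟩ := hZ m
  have h1 : ∀ᶠ ζ in 𝓝 ξ, N (Z ζ m) ≤ N (Z ξ m) + 1 := by
    have h2 : Tendsto (fun ζ => N (Z ζ m)) (𝓝 ξ) (𝓝 (N (Z ξ m))) :=
      (hN.continuous.tendsto _).comp ha.continuousAt
    filter_upwards [h2.eventually (gt_mem_nhds (lt_add_one _))] with ζ hζ using hζ.le
  rw [nhds_prod_eq]
  exact h1.prod_mk h1

lemma StepData.exists_preimage (X : Ctx B N η L A κ f) (H : StepData B N η κ C T P W W₀ V)
    {Y v : ℤ → E} (hY : Cls B N f T P W Y) (hv : IsOrbit B (fun _ _ => 0) v)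
    (hvT : MemT N T W 0 v) (hvT' : MemT N Tᶜ W₀ 0 v) :
    ∃ Z, Cls B N f T P W₀ Z ∧ Link B N f T W V Z Y v := by
  have hN := X.hN
  have hη := X.hη
  have hL := X.hL
  obtain ⟨lo', hi', S', hV⟩ := H.goodV
  have G := S'.toGap X
  have hC := G.C_pos
  obtain ⟨D₁, hD₁, b₁⟩ := hY.mem
  obtain ⟨D₂, hD₂, b₂⟩ := hvT
  obtain ⟨D₃, hD₃, b₃⟩ := hvT'
  obtain ⟨Z, hZ, hZb⟩ := G.exists_shadow hN X.hf hV (D := L * (2 * D₁ + D₂) * D₂ + η * D₃)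
    (by positivity) (χ := fun m => Y m + v m) (fun m => by
      have e0 : Y (m + 1) + v (m + 1) - B m (Y m + v m) - f m (Y m + v m) =
          f m (Y m) - f m (Y m + v m) := by
        rw [hY.orbit m, hv m, map_add]
        beta_reduce
        abel
      rw [e0]
      have hVm := hV.pos m
      have e00 : Y m - (Y m + v m) = -v m := by abel
      by_cases hm : m - 0 ∈ T
      · have hPm := (H.goodP.pos m).le
        have hWm := (H.goodW.pos m).le
        have e1 := b₁ m hm
        have e2 := b₂ m hm
        have e3 := H.W_le _ hm
        have e4 := H.PW_le _ hm
        rw [sub_zero] at e1 e2 e3 e4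
        have e5 := (hN m).add_le (Y m) (v m)
        have e6 := mul_le_mul_of_nonneg_left e3 hD₂
        have e7 : N m (Y m + v m) ≤ (D₁ + D₂) * P m := by linarith
        have n1 := (hN m).nonneg (Y m)
        have n2 := (hN m).nonneg (v m)
        have n3 := (hN m).nonneg (Y m + v m)
        have e8 := X.hf.lip_local hN hL m (Y m) (Y m + v m)
        rw [e00, (hN m).map_neg] at e8
        have e9 : 0 ≤ η * D₃ * V m := by positivity
        calc _ ≤ L * (N m (Y m) + N m (Y m + v m)) * N m (v m) := e8
          _ ≤ L * (D₁ * P m + (D₁ + D₂) * P m) * (D₂ * W m) := by gcongr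
          _ = L * (2 * D₁ + D₂) * D₂ * (P m * W m) := by ring
          _ ≤ L * (2 * D₁ + D₂) * D₂ * V m := by gcongr
          _ ≤ _ := by linarith
      · have e3 := b₃ m hm
        have e4 := H.le_V_compl _ hm
        rw [sub_zero] at e3 e4
        have e8 := X.hf.lip hN m (Y m) (Y m + v m)
        rw [e00, (hN m).map_neg] at e8
        have e9 : 0 ≤ L * (2 * D₁ + D₂) * D₂ * V m := by positivity
        have e10 := mul_le_mul_of_nonneg_left (e3.trans (mul_le_mul_of_nonneg_left e4 hD₃)) hη
        linarith)
  have mE : ∀ S : Set ℤ, MemT N S V 0 (fun m => Z m - (Y m + v m)) := fun S =>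
    MemT.of_full (D := 2 * C * (L * (2 * D₁ + D₂) * D₂ + η * D₃)) (by positivity) fun m => by
      rw [sub_zero]
      exact hZb m
  have hvT : MemT N T W 0 v := ⟨D₂, hD₂, b₂⟩
  have hvT' : MemT N Tᶜ W₀ 0 v := ⟨D₃, hD₃, b₃⟩
  have mZY : MemT N T W 0 (fun m => Y m - Z m) :=
    ((MemT.zero hN).sub hN (((mE T).mono H.V_le).add hN hvT)).congr fun m _ => by abel
  refine ⟨Z, ⟨hZ, (hY.mem.sub hN (mZY.mono H.W_le)).congr fun m _ => by abel,
    (((mE Tᶜ).mono H.V_le_compl).add hN ((hY.mem_compl.mono H.W_le_compl).add hN hvT')).congr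
      fun m _ => by abel⟩, ⟨hY.orbit, mZY, hY.mem_compl⟩, hv,
    2 * C * (L * (2 * D₁ + D₂) * D₂ + η * D₃), ?_, fun m => ?_⟩
  · positivity
  · refine le_trans (le_of_eq ?_) (hZb m)
    rw [(hN m).sub_comm]
    congr 1
    abel

lemma StepData.exists_conj (X : Ctx B N η L A κ f) (H : StepData B N η κ C T P W W₀ V)
    {Ψ : (ℤ → E) → (ℤ → E)} (hΨ : Conj B N f T P W Ψ) : ∃ Ψ₀, Conj B N f T P W₀ Ψ₀ := by
  have hN := X.hN
  have hex : ∀ Z, ∃ Z' v, Cls B N f T P W₀ Z → Link B N f T W V Z Z' v := fun Z => by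
    by_cases hZ : Cls B N f T P W₀ Z
    · obtain ⟨Z', v, h⟩ := Link.exists X H hZ
      exact ⟨Z', v, fun _ => h⟩
    · exact ⟨0, 0, fun h => absurd h hZ⟩
  choose z v hzv using hex
  refine ⟨fun Z m => v Z m + Ψ (z Z) m, ⟨?_, fun Z hZ => ?_, fun s hs => ?_, fun R hR => ?_,
    fun R hR => ?_, fun ξ Z hZ hd => ?_⟩⟩
  · obtain ⟨h1, h2⟩ := (hzv _ (Cls.zero X)).unique X H (Link.zero X H)
    funext m
    rw [h1, h2, hΨ.zero]
    exact add_zero _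
  · have h := hzv Z hZ
    have hc := hΨ.maps _ (h.cls X H hZ)
    exact ⟨h.orbit.add_linear hc.orbit, ((h.mem X H).mono H.W_le).add hN hc.mem,
      (h.mem_compl X H hZ).add hN (hc.mem_compl.mono H.W_le_compl)⟩
  · obtain ⟨lo, hi, S, hW⟩ := H.goodW
    obtain ⟨ψ, hψ⟩ := exists_split X.linear S hW H.half hs.orbit
    have hψc : Cls B N (fun _ _ => 0) T P W ψ :=
      ⟨hψ.orbit, ((hψ.mem.mono H.W_le).add hN hs.mem).congr fun m _ => by abel, hψ.mem_compl⟩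
    obtain ⟨Y, hY, rfl⟩ := hΨ.surj ψ hψc
    obtain ⟨Z, hZ, hl⟩ := H.exists_preimage X hY (hs.orbit.sub_linear hψ.orbit)
      (((MemT.zero hN).sub hN hψ.mem).congr fun m _ => by abel)
      (hs.mem_compl.sub hN (hψ.mem_compl.mono H.W_le_compl))
    refine ⟨Z, hZ, ?_⟩
    obtain ⟨h1, h2⟩ := (hzv Z hZ).unique X H hl
    funext m
    rw [h1, h2]
    exact sub_add_cancel _ _
  · obtain ⟨K, hK, hb⟩ := H.upper_centre X hR
    obtain ⟨M, hM, bM⟩ := H.bounds X hR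
    obtain ⟨K', hK', hb'⟩ := hΨ.upper M hM
    refine ⟨K + K' * K, by positivity, fun n Z Z₁ hZ hZ₁ hr hr₁ => ?_⟩
    have h := hzv Z hZ
    have h₁ := hzv Z₁ hZ₁
    obtain ⟨e1, e2⟩ := hb n _ _ _ _ _ _ hZ hZ₁ h h₁ hr hr₁
    have e3 := hb' n _ _ (h.cls X H hZ) (h₁.cls X H hZ₁) (bM n _ _ _ hZ h hr).1
      (bM n _ _ _ hZ₁ h₁ hr₁).1
    have e4 := mul_le_mul_of_nonneg_left e1 hK'
    have e5 := (hN n).le_of_eq_add (z := v Z₁ n + Ψ (z Z₁) n - (v Z n + Ψ (z Z) n))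
      (x := v Z₁ n - v Z n) (y := Ψ (z Z₁) n - Ψ (z Z) n) (by abel)
    linarith
  · obtain ⟨M, hM, bM⟩ := H.bounds X hR
    obtain ⟨K', hK', hb'⟩ := hΨ.lower M hM
    obtain ⟨K, hK, hb⟩ := H.lower X hR hK'
    refine ⟨K, hK, fun n Z Z₁ hZ hZ₁ hr hr₁ => ?_⟩
    have h := hzv Z hZ
    have h₁ := hzv Z₁ hZ₁
    exact hb n _ _ _ _ _ _ _ _ hZ hZ₁ h h₁ (hΨ.maps _ (h.cls X H hZ))
      (hΨ.maps _ (h₁.cls X H hZ₁)) hr hr₁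
      (hb' n _ _ (h.cls X H hZ) (h₁.cls X H hZ₁) (bM n _ _ _ hZ h hr).1 (bM n _ _ _ hZ₁ h₁ hr₁).1)
  · have h : ∀ ζ, Link B N f T W V (Z ζ) (z (Z ζ)) (v (Z ζ)) := fun ζ => hzv _ (hZ ζ)
    have hR : 0 ≤ N 0 (Z ξ 0) + 1 := by
      have := (hN 0).nonneg (Z ξ 0)
      linarith
    obtain ⟨K, hK, hb⟩ := H.upper X hR
    obtain ⟨c, hc, hlip⟩ := hd.lip hN 0
    have hev := hd.eventually_norm_le (hN 0) 0
    obtain ⟨lo, hi, S, hW⟩ := H.goodW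
    obtain ⟨lo', hi', S', hV⟩ := H.goodV
    have hdz : StrictDiff (fun ζ => z (Z ζ)) ξ := by
      refine split_diff X S hW (fun ζ => (h ζ).split) (c := K * c) (by positivity) ?_ hd
      filter_upwards [hlip, hev] with p hp hpR m
      have e1 := (hb 0 _ _ _ _ _ _ (hZ p.2) (hZ p.1) (h p.2) (h p.1) hpR.2 hpR.1).1 m
      have e2 := mul_le_mul_of_nonneg_left hp (mul_nonneg hK (hW.pos (m - 0)).le)
      linarith
    have hdv : StrictDiff (fun ζ => v (Z ζ)) ξ := by
      refine S'.gap.shadow_diff hN S'.lo_pos S'.hi_pos X.hκ X.hκ1 X.hA X.hBA X.linear.hf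
        (hV.shift 0) (c := K * c) (by positivity) (χ := fun ζ m => Z ζ m - z (Z ζ) m)
        (fun ζ => (h ζ).orbit) ?_ (hd.sub hdz)
      filter_upwards [hlip, hev] with p hp hpR m
      have e1 := (hb 0 _ _ _ _ _ _ (hZ p.2) (hZ p.1) (h p.2) (h p.1) hpR.2 hpR.1).2 m
      have e2 := mul_le_mul_of_nonneg_left hp (mul_nonneg hK (hV.pos (m - 0)).le)
      linarith
    exact hdv.add (hΨ.diff ξ _ (fun ζ => (h ζ).cls X H (hZ ζ)) hdz)

lemma Conj.of_trivial (X : Ctx B N η L A κ f) (hW : Good B N η κ C W) (hPW : ∀ l ∈ T, P l ≤ W l) :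
    Conj B N f T P W id := by
  have hN := X.hN
  obtain ⟨lo, hi, S, hW⟩ := hW
  have key : ∀ {g : ℤ → E → E}, Ctx B N η L A κ g → ∀ y, Cls B N g T P W y → y = fun _ => 0 := by
    intro g X y hy
    obtain ⟨D, hD, hb⟩ := MemT.full hW.pos (hy.mem.mono hPW) hy.mem_compl
    refine (S.toGap X).orbit_unique hN X.hf (hW.shift 0) (D := D) hy.orbit (isOrbit_zero X)
      fun m => ?_
    rw [sub_zero]
    exact hb m
  refine ⟨rfl, fun y hy => ?_, fun s hs => ?_,
    fun R _ => ⟨1, zero_le_one, fun n y y₁ _ _ _ _ => ?_⟩,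
    fun R _ => ⟨1, zero_le_one, fun n y y₁ _ _ _ _ => ?_⟩, fun ξ y _ hd => hd⟩
  · rw [key X y hy]
    exact Cls.zero X.linear
  · refine ⟨s, ?_, rfl⟩
    rw [key X.linear s hs]
    exact Cls.zero X
  · rw [one_mul]
    rfl
  · rw [one_mul]
    rfl

end step

/-! ### Gluing the stable and the unstable conjugacies -/

/-- A transformation `H` of the orbits of `B + f` into the orbits of `B`, which together with its
inverse is locally uniformly Lipschitz, and which preserves strict differentiability. -/
structure OrbitConj (B : ℤ → (E ≃L[ℝ] E)) (N : ℤ → E → ℝ) (f : ℤ → E → E)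
    (H : (ℤ → E) → (ℤ → E)) : Prop where
  zero : H (fun _ => 0) = fun _ => 0
  maps : ∀ x, IsOrbit B f x → IsOrbit B (fun _ _ => 0) (H x)
  surj : ∀ s, IsOrbit B (fun _ _ => 0) s → ∃ x, IsOrbit B f x ∧ H x = s
  upper : ∀ R : ℝ, 0 ≤ R → ∃ K : ℝ, 0 ≤ K ∧ ∀ (n : ℤ) (x x₁ : ℤ → E), IsOrbit B f x →
    IsOrbit B f x₁ → N n (x n) ≤ R → N n (x₁ n) ≤ R → N n (H x₁ n - H x n) ≤ K * N n (x₁ n - x n)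
  lower : ∀ R : ℝ, 0 ≤ R → ∃ K : ℝ, 0 ≤ K ∧ ∀ (n : ℤ) (x x₁ : ℤ → E), IsOrbit B f x →
    IsOrbit B f x₁ → N n (x n) ≤ R → N n (x₁ n) ≤ R → N n (x₁ n - x n) ≤ K * N n (H x₁ n - H x n)
  diff : ∀ (ξ : E) (x : E → ℤ → E), (∀ ζ, IsOrbit B f (x ζ)) → StrictDiff x ξ →
    StrictDiff (fun ζ => H (x ζ)) ξ

/-- Weights for splitting off the part of an orbit along the half-line `T`: `P` and `Q` belong to
the central gap and `W` dominates all orbits on `T`. -/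
structure Side (B : ℤ → (E ≃L[ℝ] E)) (N : ℤ → E → ℝ) (η κ C : ℝ) (f : ℤ → E → E) (T : Set ℤ)
    (P Q W : ℤ → ℝ) : Prop where
  half : HalfLine T
  goodP : Good B N η κ C P
  goodQ : Good B N η κ C Q
  goodW : Good B N η κ C W
  P_le_Q : ∀ l, P l ≤ Q l
  P_le : ∀ l ∈ T, P l ≤ W l
  WP_le : ∀ l ∈ T, W l * P l ≤ Q l
  mem : ∀ x, IsOrbit B f x → MemT N T W 0 x

section glue

variable [FiniteDimensional ℝ E] {B : ℤ → (E ≃L[ℝ] E)} {N : ℤ → E → ℝ} {η L A κ C : ℝ}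
  {f : ℤ → E → E} {T : Set ℤ} {P Q W W' : ℤ → ℝ}

lemma Split.cls (X : Ctx B N η L A κ f) (H : Side B N η κ C f T P Q W) {x y : ℤ → E}
    (hx : IsOrbit B f x) (h : Split B N f T P x y) : Cls B N f Tᶜ P W y := by
  refine ⟨h.orbit, h.mem_compl, ?_⟩
  rw [compl_compl]
  exact ((h.mem.mono H.P_le).add X.hN (H.mem x hx)).congr fun m _ => by abel

lemma Split.weaken (H : Side B N η κ C f T P Q W) {x y : ℤ → E}
    (h : Split B N f T P x y) : Split B N f T Q x y :=
  ⟨h.orbit, h.mem.mono fun l _ => H.P_le_Q l, h.mem_compl.mono fun l _ => H.P_le_Q l⟩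

lemma Side.upper (X : Ctx B N η L A κ f) (H : Side B N η κ C f T P Q W) {R : ℝ} (hR : 0 ≤ R) :
    ∃ K : ℝ, 0 ≤ K ∧ ∀ (n : ℤ) (x x₁ y y₁ : ℤ → E), IsOrbit B f x → IsOrbit B f x₁ →
      Split B N f T P x y → Split B N f T P x₁ y₁ → N n (x n) ≤ R → N n (x₁ n) ≤ R →
      ∀ m, N m ((y₁ m - cut T n x₁ m) - (y m - cut T n x m)) ≤
        K * N n (x₁ n - x n) * Q (m - n) := by
  have hN := X.hN
  have hL := X.hL
  obtain ⟨K₁, hK₁, b₁⟩ := exists_orbit_halfBound X H.goodW H.half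
  obtain ⟨lo, hi, S, hP⟩ := H.goodP
  obtain ⟨lo', hi', S', hQ⟩ := H.goodQ
  obtain ⟨K₂, hK₂, b₂⟩ := exists_split_bound X S hP H.half
  obtain ⟨K₃, hK₃, b₃⟩ := exists_split_lip X S' hQ H.half
  refine ⟨K₃ * (1 + L * K₁ * (K₂ * R)), by positivity,
    fun n x x₁ y y₁ hx hx₁ h h₁ hr hr₁ m => ?_⟩
  have hδ : 0 ≤ N n (x₁ n - x n) := (hN n).nonneg _
  refine (b₃ n x y x₁ y₁ hx hx₁ (h.weaken H) (h₁.weaken H)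
    (L * K₁ * (K₂ * R) * N n (x₁ n - x n)) (by positivity) (fun m hm => ?_) m).trans
    (le_of_eq (by ring))
  have e1 := b₁ n x x₁ hx hx₁ (H.mem x hx) (H.mem x₁ hx₁) m hm
  have e2 := b₂ n x y hx h m
  rw [cut_of_mem hm] at e2
  have p1 := (hP.pos (m - n)).le
  have p2 := (H.goodW.pos (m - n)).le
  have n1 := (hN m).nonneg (x₁ m - x m)
  have n2 := (hN m).nonneg (y m - x m)
  have e3 : N m (y m - x m) ≤ K₂ * R * P (m - n) := e2.trans (by gcongr)
  calc _ ≤ L * N m (x₁ m - x m) * N m (y m - x m) := X.hf.second_diff hN m _ _ _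
    _ ≤ L * (K₁ * N n (x₁ n - x n) * W (m - n)) * (K₂ * R * P (m - n)) := by gcongr
    _ = L * K₁ * (K₂ * R) * N n (x₁ n - x n) * (W (m - n) * P (m - n)) := by ring
    _ ≤ _ := by
      have := H.WP_le _ hm
      gcongr

lemma Side.upper_centre (X : Ctx B N η L A κ f) (H : Side B N η κ C f T P Q W) {R : ℝ}
    (hR : 0 ≤ R) : ∃ K : ℝ, 0 ≤ K ∧ ∀ (n : ℤ) (x x₁ y y₁ : ℤ → E), IsOrbit B f x →
      IsOrbit B f x₁ → Split B N f T P x y → Split B N f T P x₁ y₁ → N n (x n) ≤ R →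
      N n (x₁ n) ≤ R → N n (y₁ n - y n) ≤ K * N n (x₁ n - x n) := by
  have hN := X.hN
  obtain ⟨K, hK, hb⟩ := H.upper X hR
  have hQ := H.goodQ.pos 0
  refine ⟨K * Q 0 + 1, by positivity, fun n x x₁ y y₁ hx hx₁ h h₁ hr hr₁ => ?_⟩
  have e1 := hb n x x₁ y y₁ hx hx₁ h h₁ hr hr₁ n
  rw [sub_self] at e1
  have e2 := norm_cut_le hN n x x₁ (T := T)
  have e3 := (hN n).le_of_eq_add (z := y₁ n - y n)
    (x := (y₁ n - cut T n x₁ n) - (y n - cut T n x n)) (y := cut T n x₁ n - cut T n x n) (by abel)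
  linarith

lemma Split.zero (X : Ctx B N η L A κ f) : Split B N f T P (fun _ => 0) (fun _ => 0) :=
  ⟨isOrbit_zero X, (MemT.zero X.hN).congr fun _ _ => sub_zero _, MemT.zero X.hN⟩

lemma Side.bound (X : Ctx B N η L A κ f) (H : Side B N η κ C f T P Q W) :
    ∃ K : ℝ, 0 ≤ K ∧ ∀ (n : ℤ) (x y : ℤ → E), IsOrbit B f x → Split B N f T P x y →
      (∀ m, N m (y m - cut T n x m) ≤ K * N n (x n) * P (m - n)) ∧ N n (y n) ≤ K * N n (x n) := by
  have hN := X.hN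
  obtain ⟨lo, hi, S, hP⟩ := H.goodP
  obtain ⟨K, hK, b⟩ := exists_split_bound X S hP H.half
  have hP0 := (hP.pos 0).le
  refine ⟨K + (K * P 0 + 1), by positivity, fun n x y hx h => ⟨fun m => ?_, ?_⟩⟩
  · refine (b n x y hx h m).trans ?_
    have := (hN n).nonneg (x n)
    have := (hP.pos (m - n)).le
    gcongr
    have : 0 ≤ K * P 0 + 1 := by positivity
    linarith
  · have e1 := b n x y hx h n
    rw [sub_self] at e1
    have e2 : N n (cut T n x n) ≤ N n (x n) := by
      have := norm_cut_le hN n (fun _ => 0) x (T := T)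
      have hc : cut T n (fun _ => (0 : E)) n = 0 := by simp [cut]
      rwa [hc, sub_zero, sub_zero] at this
    have e3 := (hN n).le_of_eq_add (z := y n) (x := y n - cut T n x n) (y := cut T n x n) (by abel)
    have := mul_nonneg hK ((hN n).nonneg (x n))
    linarith

lemma Side.diff (X : Ctx B N η L A κ f) (H : Side B N η κ C f T P Q W) {x y : E → ℤ → E} {ξ : E}
    (hx : ∀ ζ, IsOrbit B f (x ζ)) (hy : ∀ ζ, Split B N f T P (x ζ) (y ζ)) (hd : StrictDiff x ξ) :
    StrictDiff y ξ := by
  have hN := X.hN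
  have hR : 0 ≤ N 0 (x ξ 0) + 1 := by
    have := (hN 0).nonneg (x ξ 0)
    linarith
  obtain ⟨K, hK, hb⟩ := H.upper X hR
  obtain ⟨c, hc, hlip⟩ := hd.lip hN 0
  have hev := hd.eventually_norm_le (hN 0) 0
  obtain ⟨lo, hi, S, hQ⟩ := H.goodQ
  refine split_diff X S hQ (fun ζ => (hy ζ).weaken H) (c := K * c) (by positivity) ?_ hd
  filter_upwards [hlip, hev] with p hp hpR m
  have e1 := hb 0 _ _ _ _ (hx p.2) (hx p.1) (hy p.2) (hy p.1) hpR.2 hpR.1 m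
  have e2 := mul_le_mul_of_nonneg_left hp (mul_nonneg hK (hQ.pos (m - 0)).le)
  linarith

/-- The defect of additivity of a perturbation. -/
lemma Pert.additivity_defect (hN : ∀ n, IsNormOn (N n)) (hf : Pert N η L f) (m : ℤ)
    (u v u₁ v₁ : E) :
    N (m + 1) ((f m u₁ + f m v₁ - f m (u₁ + v₁)) - (f m u + f m v - f m (u + v))) ≤
      2 * η * N m (u₁ - u) + L * N m (v₁ - v) * N m u := by
  have h1 := hf.lip hN m u₁ u
  have h2 := hf.lip hN m (u₁ + v₁) (u + v₁)
  rw [add_sub_add_right_eq_sub] at h2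
  have h3 := hf.second_diff hN m v₁ v u
  have e1 := (hN (m + 1)).le_of_eq_sub (z := (f m u₁ - f m u) - (f m (u₁ + v₁) - f m (u + v₁)))
    (x := f m u₁ - f m u) (y := f m (u₁ + v₁) - f m (u + v₁)) rfl
  have e2 := (hN (m + 1)).le_of_eq_sub
    (z := (f m u₁ + f m v₁ - f m (u₁ + v₁)) - (f m u + f m v - f m (u + v)))
    (x := (f m u₁ - f m u) - (f m (u₁ + v₁) - f m (u + v₁)))
    (y := f m (v₁ + u) - f m v₁ - (f m (v + u) - f m v)) (by
      rw [add_comm v₁ u, add_comm v u]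
      abel)
  linarith

end glue

section glue

variable [FiniteDimensional ℝ E] {B : ℤ → (E ≃L[ℝ] E)} {N : ℤ → E → ℝ} {η L A κ C : ℝ}
  {f : ℤ → E → E} {T : Set ℤ} {P Q W W' : ℤ → ℝ}

lemma cut_add_compl (T : Set ℤ) (n : ℤ) (x : ℤ → E) (m : ℤ) : cut T n x m + cut Tᶜ n x m = x m := by
  by_cases h : m - n ∈ T
  · rw [cut_of_mem h, cut_of_notMem (not_not_intro h), add_zero]
  · rw [cut_of_notMem h, cut_of_mem h, zero_add]

lemma Pert.glue_local (hN : ∀ n, IsNormOn (N n)) (hL : 0 ≤ L) (hη : 0 ≤ η) (hf : Pert N η L f)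
    {m : ℤ} {u v u₁ v₁ g : E} {a b δ p q w : ℝ} (ha : 0 ≤ a) (hb : 0 ≤ b) (hδ : 0 ≤ δ)
    (hp : 0 ≤ p) (hw : 0 ≤ w) (hu : N m u ≤ a * p) (hg : N m g ≤ a * p)
    (hu₁ : N m (u₁ - u) ≤ b * δ * p) (hv₁ : N m (v₁ - v) ≤ b * δ * w) (hpw : p ≤ w) (hpq : p ≤ q)
    (hwp : w * p ≤ q) :
    N (m + 1) ((f m u₁ + f m v₁ - f m (u₁ + v₁)) - (f m u + f m v - f m (u + v))) ≤
        (2 * η * b + L * b * a) * δ * q ∧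
      N (m + 1) (f m (u₁ + v₁ + g) - f m (u₁ + v₁) - (f m (u + v + g) - f m (u + v))) ≤
        2 * L * b * a * δ * q := by
  have n1 := (hN m).nonneg u
  have n2 := (hN m).nonneg (v₁ - v)
  have n3 := (hN m).nonneg (u₁ + v₁ - (u + v))
  have n4 := (hN m).nonneg g
  constructor
  · calc _ ≤ 2 * η * N m (u₁ - u) + L * N m (v₁ - v) * N m u := hf.additivity_defect hN m u v u₁ v₁
      _ ≤ 2 * η * (b * δ * p) + L * (b * δ * w) * (a * p) := by gcongr
      _ = 2 * η * b * δ * p + L * b * a * δ * (w * p) := by ring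
      _ ≤ 2 * η * b * δ * q + L * b * a * δ * q := by gcongr
      _ = _ := by ring
  · have e1 := (hN m).le_of_eq_add (z := u₁ + v₁ - (u + v)) (x := u₁ - u) (y := v₁ - v) (by abel)
    have e2 : N m (u₁ + v₁ - (u + v)) ≤ 2 * b * δ * w := by
      have := mul_le_mul_of_nonneg_left hpw (mul_nonneg hb hδ)
      linarith
    calc _ ≤ L * N m (u₁ + v₁ - (u + v)) * N m g := hf.second_diff hN m _ _ _
      _ ≤ L * (2 * b * δ * w) * (a * p) := by gcongr
      _ = 2 * L * b * a * δ * (w * p) := by ring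
      _ ≤ _ := by gcongr

/-- An orbit is controlled by its stable and unstable parts. -/
lemma Side.exists_glue_bound (X : Ctx B N η L A κ f) (H : Side B N η κ C f T P Q W)
    (H' : Side B N η κ C f Tᶜ P Q W') {R : ℝ} (hR : 0 ≤ R) : ∃ K : ℝ, 0 ≤ K ∧
      ∀ (n : ℤ) (x x₁ y y₁ z z₁ : ℤ → E), IsOrbit B f x → IsOrbit B f x₁ →
      Split B N f T P x y → Split B N f T P x₁ y₁ → Split B N f Tᶜ P x z →
      Split B N f Tᶜ P x₁ z₁ → N n (x n) ≤ R → N n (x₁ n) ≤ R →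
      N n (x₁ n - x n) ≤ K * (N n (y₁ n - y n) + N n (z₁ n - z n)) := by
  have hN := X.hN
  have hη := X.hη
  have hL := X.hL
  obtain ⟨K₁, hK₁, b₁⟩ := H.bound X
  obtain ⟨K₂, hK₂, b₂⟩ := H'.bound X
  obtain ⟨k₁, hk₁, c₁⟩ := exists_orbit_halfBound X H.goodP H.half.compl
  obtain ⟨k₂, hk₂, c₂⟩ := exists_orbit_halfBound X H.goodW H.half
  obtain ⟨k₃, hk₃, c₃⟩ := exists_orbit_halfBound X H'.goodP H'.half.compl
  obtain ⟨k₄, hk₄, c₄⟩ := exists_orbit_halfBound X H'.goodW H'.half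
  obtain ⟨lo, hi, S, hQ⟩ := H.goodQ
  have G := S.toGap X
  have hC := G.C_pos
  set a : ℝ := (K₁ + K₂) * R with ha
  have ha0 : 0 ≤ a := by positivity
  set b : ℝ := k₁ + k₂ + k₃ + k₄ with hb
  have hb0 : 0 ≤ b := by positivity
  have hQ0 := (hQ.pos 0).le
  refine ⟨1 + 2 * C * ((2 * η * b + L * b * a) + 2 * L * b * a) * Q 0, by positivity,
    fun n x x₁ y y₁ z z₁ hx hx₁ hy hy₁ hz hz₁ hr hr₁ => ?_⟩
  set δ : ℝ := N n (y₁ n - y n) + N n (z₁ n - z n) with hδ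
  have d1 := (hN n).nonneg (y₁ n - y n)
  have d2 := (hN n).nonneg (z₁ n - z n)
  have hδ0 : 0 ≤ δ := by positivity
  have gb : ∀ {x y z : ℤ → E}, IsOrbit B f x → Split B N f T P x y → Split B N f Tᶜ P x z →
      N n (x n) ≤ R → ∀ m, N m (x m - (y m + z m)) ≤ a * P (m - n) ∧
        (m - n ∈ T → N m (z m) ≤ a * P (m - n)) ∧ (m - n ∉ T → N m (y m) ≤ a * P (m - n)) := by
    intro x y z hx hy hz hr m
    have e1 := (b₁ n x y hx hy).1 m
    have e2 := (b₂ n x z hx hz).1 m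
    have hPm := (H.goodP.pos (m - n)).le
    have e3 : K₁ * N n (x n) * P (m - n) ≤ K₁ * R * P (m - n) := by gcongr
    have e4 : K₂ * N n (x n) * P (m - n) ≤ K₂ * R * P (m - n) := by gcongr
    have e5 : 0 ≤ K₁ * R * P (m - n) := by positivity
    have e6 : 0 ≤ K₂ * R * P (m - n) := by positivity
    refine ⟨?_, fun h => ?_, fun h => ?_⟩
    · have e7 := (hN m).le_of_eq_add (z := (y m + z m) - x m) (x := y m - cut T n x m)
        (y := z m - cut Tᶜ n x m) (by
          nth_rewrite 1 [← cut_add_compl T n x m]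
          abel)
      rw [(hN m).sub_comm]
      linarith
    · rw [cut_of_notMem (not_not_intro h), sub_zero] at e2
      linarith
    · rw [cut_of_notMem h, sub_zero] at e1
      linarith
  have db : ∀ m, m - n ∈ T → N m (z₁ m - z m) ≤ b * δ * P (m - n) ∧
      N m (y₁ m - y m) ≤ b * δ * W (m - n) := fun m hm => by
    have e1 := c₃ n z z₁ hz.orbit hz₁.orbit hz.mem_compl hz₁.mem_compl m (not_not_intro hm)
    have e2 := c₂ n y y₁ hy.orbit hy₁.orbit (H.mem y hy.orbit) (H.mem y₁ hy₁.orbit) m hm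
    have p1 := (H.goodP.pos (m - n)).le
    have p2 := (H.goodW.pos (m - n)).le
    refine ⟨e1.trans ?_, e2.trans ?_⟩
    · gcongr <;> linarith
    · gcongr <;> linarith
  have db' : ∀ m, m - n ∉ T → N m (y₁ m - y m) ≤ b * δ * P (m - n) ∧
      N m (z₁ m - z m) ≤ b * δ * W' (m - n) := fun m hm => by
    have e1 := c₁ n y y₁ hy.orbit hy₁.orbit hy.mem_compl hy₁.mem_compl m hm
    have e2 := c₄ n z z₁ hz.orbit hz₁.orbit (H'.mem z hz.orbit) (H'.mem z₁ hz₁.orbit) m hm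
    have p1 := (H.goodP.pos (m - n)).le
    have p2 := (H'.goodW.pos (m - n)).le
    refine ⟨e1.trans ?_, e2.trans ?_⟩
    · gcongr <;> linarith
    · gcongr <;> linarith
  have key : ∀ m,
      N (m + 1) ((f m (y₁ m) + f m (z₁ m) - f m (y₁ m + z₁ m)) -
        (f m (y m) + f m (z m) - f m (y m + z m))) ≤ (2 * η * b + L * b * a) * δ * Q (m - n) ∧
      N (m + 1) (f m (y₁ m + z₁ m + (x m - (y m + z m))) - f m (y₁ m + z₁ m) -
        (f m (y m + z m + (x m - (y m + z m))) - f m (y m + z m))) ≤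
          2 * L * b * a * δ * Q (m - n) := by
    intro m
    obtain ⟨g1, g2, g3⟩ := gb hx hy hz hr m
    have p1 := (H.goodP.pos (m - n)).le
    by_cases hm : m - n ∈ T
    · have := X.hf.glue_local hN hL hη ha0 hb0 hδ0 p1 (H.goodW.pos (m - n)).le (g2 hm) g1
        (db m hm).1 (db m hm).2 (H.P_le _ hm) (H.P_le_Q _) (H.WP_le _ hm)
      rwa [add_comm (f m (z₁ m)), add_comm (f m (z m)), add_comm (z₁ m), add_comm (z m)] at this
    · exact X.hf.glue_local hN hL hη ha0 hb0 hδ0 p1 (H'.goodW.pos (m - n)).le (g3 hm) g1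
        (db' m hm).1 (db' m hm).2 (H'.P_le _ hm) (H'.P_le_Q _) (H'.WP_le _ hm)
  have hres : ∀ {y z : ℤ → E}, IsOrbit B f y → IsOrbit B f z → ∀ m,
      y (m + 1) + z (m + 1) - B m (y m + z m) - f m (y m + z m) =
        f m (y m) + f m (z m) - f m (y m + z m) := fun hy hz m => by
    rw [hy m, hz m, map_add]
    abel
  have e := G.shadow_lip hN X.hf (hQ.shift n) (hQ.shift n)
    (D₁ := (2 * η * b + L * b * a) * δ) (D₂ := 2 * L * b * a * δ) (D₃ := a + a) (by positivity)
    (by positivity) (χ := fun m => y m + z m) (χ' := fun m => y₁ m + z₁ m) hx hx₁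
    (fun m => by
      rw [hres hy.orbit hz.orbit, hres hy₁.orbit hz₁.orbit]
      exact (key m).1) (fun m => (key m).2) (fun m => by
        have e1 := (gb hx hy hz hr m).1
        have e2 := (gb hx₁ hy₁ hz₁ hr₁ m).1
        have e3 := (hN m).sub_le (x₁ m - (y₁ m + z₁ m)) (x m - (y m + z m))
        have e4 := mul_le_mul_of_nonneg_left (H.P_le_Q (m - n)) ha0
        linarith) n
  rw [sub_self] at e
  have e1 := (hN n).le_of_eq_add (z := x₁ n - x n)
    (x := (x₁ n - (y₁ n + z₁ n)) - (x n - (y n + z n)))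
    (y := (y₁ n - y n) + (z₁ n - z n)) (by abel)
  have e2 := (hN n).add_le (y₁ n - y n) (z₁ n - z n)
  linarith

lemma Side.exists_glue (X : Ctx B N η L A κ f) (H : Side B N η κ C f T P Q W)
    (H' : Side B N η κ C f Tᶜ P Q W') {y z : ℤ → E} (hy : Cls B N f Tᶜ P W y)
    (hz : Cls B N f T P W' z) :
    ∃ x, IsOrbit B f x ∧ Split B N f T P x y ∧ Split B N f Tᶜ P x z := by
  have hN := X.hN
  have hη := X.hη
  obtain ⟨lo, hi, S, hP⟩ := H.goodP
  have G := S.toGap X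
  have hC := G.C_pos
  obtain ⟨D₁, hD₁, b₁⟩ := hy.mem
  obtain ⟨D₂, hD₂, b₂⟩ := hz.mem
  obtain ⟨x, hx, hb⟩ := G.exists_shadow hN X.hf hP (D := 2 * η * (D₁ + D₂)) (by positivity)
    (χ := fun m => y m + z m) (fun m => by
      have e0 : y (m + 1) + z (m + 1) - B m (y m + z m) - f m (y m + z m) =
          f m (y m) + f m (z m) - f m (y m + z m) := by
        rw [hy.orbit m, hz.orbit m, map_add]
        abel
      rw [e0]
      have p := (hP.pos m).le
      by_cases hm : m - 0 ∈ T
      · have e1 := b₂ m hm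
        rw [sub_zero] at e1
        have e2 := X.hf.norm_le hN m (z m)
        have e3 := X.hf.lip hN m (y m) (y m + z m)
        rw [sub_add_cancel_left, (hN m).map_neg] at e3
        have e4 := (hN (m + 1)).le_of_eq_add (z := f m (y m) + f m (z m) - f m (y m + z m))
          (x := f m (y m) - f m (y m + z m)) (y := f m (z m)) (by abel)
        have e5 := mul_le_mul_of_nonneg_left e1 hη
        have : 0 ≤ 2 * η * D₁ * P m := by positivity
        linarith
      · have e1 := b₁ m hm
        rw [sub_zero] at e1
        have e2 := X.hf.norm_le hN m (y m)
        have e3 := X.hf.lip hN m (z m) (y m + z m)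
        rw [sub_add_cancel_right, (hN m).map_neg] at e3
        have e4 := (hN (m + 1)).le_of_eq_add (z := f m (y m) + f m (z m) - f m (y m + z m))
          (x := f m (z m) - f m (y m + z m)) (y := f m (y m)) (by abel)
        have e5 := mul_le_mul_of_nonneg_left e1 hη
        have : 0 ≤ 2 * η * D₂ * P m := by positivity
        linarith)
  have hg : ∀ S, MemT N S P 0 (fun m => x m - (y m + z m)) := fun S =>
    MemT.of_full (D := 2 * C * (2 * η * (D₁ + D₂))) (by positivity) fun m => by
      rw [sub_zero]
      exact hb m
  have hz' : MemT N T P 0 z := ⟨D₂, hD₂, b₂⟩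
  have hy' : MemT N Tᶜ P 0 y := ⟨D₁, hD₁, b₁⟩
  refine ⟨x, hx, ⟨hy.orbit, ?_, hy'⟩, ⟨hz.orbit, ?_, ?_⟩⟩
  · refine (((MemT.zero hN).sub hN (hg T)).sub hN hz').congr fun m _ => ?_
    abel
  · refine (((MemT.zero hN).sub hN (hg Tᶜ)).sub hN hy').congr fun m _ => ?_
    abel
  · simpa only [compl_compl] using ⟨D₂, hD₂, b₂⟩

/-- Conjugacies on the stable and on the unstable class combine to a conjugacy on all orbits. -/
lemma Side.exists_orbitConj (X : Ctx B N η L A κ f) (H : Side B N η κ C f T P Q W)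
    (H' : Side B N η κ C f Tᶜ P Q W') (Hl : Side B N η κ C (fun _ _ => 0) T P Q W)
    (Hl' : Side B N η κ C (fun _ _ => 0) Tᶜ P Q W') {Ψ Ψ' : (ℤ → E) → (ℤ → E)}
    (hΨ : Conj B N f Tᶜ P W Ψ) (hΨ' : Conj B N f T P W' Ψ') : ∃ Φ, OrbitConj B N f Φ := by
  have hN := X.hN
  obtain ⟨lo, hi, S, hP⟩ := H.goodP
  have hex : ∀ x, ∃ y z, IsOrbit B f x → Split B N f T P x y ∧ Split B N f Tᶜ P x z := fun x => by
    by_cases hx : IsOrbit B f x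
    · obtain ⟨y, hy⟩ := exists_split X S hP H.half hx
      obtain ⟨z, hz⟩ := exists_split X S hP H'.half hx
      exact ⟨y, z, fun _ => ⟨hy, hz⟩⟩
    · exact ⟨0, 0, fun h => absurd h hx⟩
  choose y z hyz using hex
  have cy : ∀ x, IsOrbit B f x → Cls B N f Tᶜ P W (y x) := fun x hx => (hyz x hx).1.cls X H hx
  have cz : ∀ x, IsOrbit B f x → Cls B N f T P W' (z x) := fun x hx => by
    have := (hyz x hx).2.cls X H' hx
    rwa [compl_compl] at this
  have uy : ∀ x y', IsOrbit B f x → Split B N f T P x y' → y x = y' := fun x y' hx h =>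
    (hyz x hx).1.unique X S hP H.half h
  have uz : ∀ x z', IsOrbit B f x → Split B N f Tᶜ P x z' → z x = z' := fun x z' hx h =>
    (hyz x hx).2.unique X S hP H'.half h
  -- the images of the two parts are the two parts of the linear image
  have lsplit : ∀ {ψ ψ' : ℤ → E}, Cls B N (fun _ _ => 0) Tᶜ P W ψ →
      Cls B N (fun _ _ => 0) T P W' ψ' →
      Split B N (fun _ _ => 0) T P (fun m => ψ m + ψ' m) ψ ∧
        Split B N (fun _ _ => 0) Tᶜ P (fun m => ψ m + ψ' m) ψ' := fun {ψ ψ'} h h' => by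
    refine ⟨⟨h.orbit, ?_, h.mem⟩, ⟨h'.orbit, ?_, ?_⟩⟩
    · refine ((MemT.zero hN).sub hN h'.mem).congr fun m _ => ?_
      abel
    · refine ((MemT.zero hN).sub hN h.mem).congr fun m _ => ?_
      abel
    · rw [compl_compl]
      exact h'.mem
  refine ⟨fun x m => Ψ (y x) m + Ψ' (z x) m, ⟨?_, fun x hx => ?_, fun s hs => ?_, fun R hR => ?_,
    fun R hR => ?_, fun ξ x hx hd => ?_⟩⟩
  · rw [uy _ _ (isOrbit_zero X) (Split.zero X), uz _ _ (isOrbit_zero X) (Split.zero X),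
      hΨ.zero, hΨ'.zero]
    funext m
    exact add_zero _
  · exact (hΨ.maps _ (cy x hx)).orbit.add_linear (hΨ'.maps _ (cz x hx)).orbit
  · obtain ⟨ψ, hψ⟩ := exists_split X.linear S hP H.half hs
    have hc := hψ.cls X.linear Hl hs
    have hs' : Split B N (fun _ _ => 0) Tᶜ P s (fun m => s m - ψ m) := by
      refine ⟨hs.sub_linear hψ.orbit, ?_, ?_⟩
      · refine ((MemT.zero hN).sub hN hψ.mem_compl).congr fun m _ => ?_
        abel
      · rw [compl_compl]
        refine ((MemT.zero hN).sub hN hψ.mem).congr fun m _ => ?_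
        abel
    have hc' := hs'.cls X.linear Hl' hs
    rw [compl_compl] at hc'
    obtain ⟨u, hu, hu'⟩ := hΨ.surj _ hc
    obtain ⟨v, hv, hv'⟩ := hΨ'.surj _ hc'
    obtain ⟨x, hx, hxu, hxv⟩ := H.exists_glue X H' hu hv
    refine ⟨x, hx, ?_⟩
    funext m
    rw [uy _ _ hx hxu, uz _ _ hx hxv, hu', hv']
    exact add_sub_cancel _ _
  · obtain ⟨K₁, hK₁, b₁⟩ := H.upper_centre X hR
    obtain ⟨K₂, hK₂, b₂⟩ := H'.upper_centre X hR
    obtain ⟨M₁, hM₁, c₁⟩ := H.bound X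
    obtain ⟨M₂, hM₂, c₂⟩ := H'.bound X
    obtain ⟨k₁, hk₁, d₁⟩ := hΨ.upper (M₁ * R) (by positivity)
    obtain ⟨k₂, hk₂, d₂⟩ := hΨ'.upper (M₂ * R) (by positivity)
    refine ⟨k₁ * K₁ + k₂ * K₂, by positivity, fun n x x₁ hx hx₁ hr hr₁ => ?_⟩
    obtain ⟨hy, hz⟩ := hyz x hx
    obtain ⟨hy₁, hz₁⟩ := hyz x₁ hx₁
    have e1 := d₁ n _ _ (cy x hx) (cy x₁ hx₁)
      ((c₁ n x _ hx hy).2.trans (mul_le_mul_of_nonneg_left hr hM₁))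
      ((c₁ n x₁ _ hx₁ hy₁).2.trans (mul_le_mul_of_nonneg_left hr₁ hM₁))
    have e2 := d₂ n _ _ (cz x hx) (cz x₁ hx₁)
      ((c₂ n x _ hx hz).2.trans (mul_le_mul_of_nonneg_left hr hM₂))
      ((c₂ n x₁ _ hx₁ hz₁).2.trans (mul_le_mul_of_nonneg_left hr₁ hM₂))
    have e3 := mul_le_mul_of_nonneg_left (b₁ n _ _ _ _ hx hx₁ hy hy₁ hr hr₁) hk₁
    have e4 := mul_le_mul_of_nonneg_left (b₂ n _ _ _ _ hx hx₁ hz hz₁ hr hr₁) hk₂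
    have e5 := (hN n).le_of_eq_add
      (z := Ψ (y x₁) n + Ψ' (z x₁) n - (Ψ (y x) n + Ψ' (z x) n))
      (x := Ψ (y x₁) n - Ψ (y x) n) (y := Ψ' (z x₁) n - Ψ' (z x) n) (by abel)
    linarith
  · obtain ⟨M₁, hM₁, c₁⟩ := H.bound X
    obtain ⟨M₂, hM₂, c₂⟩ := H'.bound X
    obtain ⟨k₁, hk₁, d₁⟩ := hΨ.lower (M₁ * R) (by positivity)
    obtain ⟨k₂, hk₂, d₂⟩ := hΨ'.lower (M₂ * R) (by positivity)
    obtain ⟨K₁, hK₁, l₁⟩ := exists_split_lip X.linear S hP H.half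
    obtain ⟨K₂, hK₂, l₂⟩ := exists_split_lip X.linear S hP H'.half
    obtain ⟨K, hK, g⟩ := H.exists_glue_bound X H' hR
    have hP0 := (hP.pos 0).le
    refine ⟨K * (k₁ * (K₁ * P 0 + 1) + k₂ * (K₂ * P 0 + 1)), by positivity,
      fun n x x₁ hx hx₁ hr hr₁ => ?_⟩
    obtain ⟨hy, hz⟩ := hyz x hx
    obtain ⟨hy₁, hz₁⟩ := hyz x₁ hx₁
    have e1 := d₁ n _ _ (cy x hx) (cy x₁ hx₁)
      ((c₁ n x _ hx hy).2.trans (mul_le_mul_of_nonneg_left hr hM₁))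
      ((c₁ n x₁ _ hx₁ hy₁).2.trans (mul_le_mul_of_nonneg_left hr₁ hM₁))
    have e2 := d₂ n _ _ (cz x hx) (cz x₁ hx₁)
      ((c₂ n x _ hx hz).2.trans (mul_le_mul_of_nonneg_left hr hM₂))
      ((c₂ n x₁ _ hx₁ hz₁).2.trans (mul_le_mul_of_nonneg_left hr₁ hM₂))
    have m1 := hΨ.maps _ (cy x hx)
    have m2 := hΨ'.maps _ (cz x hx)
    have m3 := hΨ.maps _ (cy x₁ hx₁)
    have m4 := hΨ'.maps _ (cz x₁ hx₁)
    obtain ⟨s1, s2⟩ := lsplit m1 m2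
    obtain ⟨s3, s4⟩ := lsplit m3 m4
    have o1 := m1.orbit.add_linear m2.orbit
    have o2 := m3.orbit.add_linear m4.orbit
    have e3 := l₁ n _ _ _ _ o1 o2 s1 s3 0 le_rfl (fun m _ => by simp [(hN _).map_zero]) n
    have e4 := l₂ n _ _ _ _ o1 o2 s2 s4 0 le_rfl (fun m _ => by simp [(hN _).map_zero]) n
    rw [sub_self, add_zero] at e3 e4
    have f1 := norm_cut_le hN n (fun m => Ψ (y x) m + Ψ' (z x) m)
      (fun m => Ψ (y x₁) m + Ψ' (z x₁) m) (T := T)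
    have f2 := norm_cut_le hN n (fun m => Ψ (y x) m + Ψ' (z x) m)
      (fun m => Ψ (y x₁) m + Ψ' (z x₁) m) (T := Tᶜ)
    set c := cut T n (fun m => Ψ (y x) m + Ψ' (z x) m) n
    set c₁ := cut T n (fun m => Ψ (y x₁) m + Ψ' (z x₁) m) n
    set c' := cut Tᶜ n (fun m => Ψ (y x) m + Ψ' (z x) m) n
    set c₁' := cut Tᶜ n (fun m => Ψ (y x₁) m + Ψ' (z x₁) m) n
    have f3 := (hN n).le_of_eq_add (z := Ψ (y x₁) n - Ψ (y x) n)
      (x := (Ψ (y x₁) n - c₁) - (Ψ (y x) n - c)) (y := c₁ - c) (by abel)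
    have f4 := (hN n).le_of_eq_add (z := Ψ' (z x₁) n - Ψ' (z x) n)
      (x := (Ψ' (z x₁) n - c₁') - (Ψ' (z x) n - c')) (y := c₁' - c') (by abel)
    set δ := N n (Ψ (y x₁) n + Ψ' (z x₁) n - (Ψ (y x) n + Ψ' (z x) n))
    have f5 : N n (Ψ (y x₁) n - Ψ (y x) n) ≤ (K₁ * P 0 + 1) * δ := by linarith
    have f6 : N n (Ψ' (z x₁) n - Ψ' (z x) n) ≤ (K₂ * P 0 + 1) * δ := by linarith
    calc N n (x₁ n - x n) ≤ K * (N n (y x₁ n - y x n) + N n (z x₁ n - z x n)) :=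
          g n x x₁ _ _ _ _ hx hx₁ hy hy₁ hz hz₁ hr hr₁
      _ ≤ K * (k₁ * ((K₁ * P 0 + 1) * δ) + k₂ * ((K₂ * P 0 + 1) * δ)) := by
        have := mul_le_mul_of_nonneg_left f5 hk₁
        have := mul_le_mul_of_nonneg_left f6 hk₂
        refine mul_le_mul_of_nonneg_left ?_ hK
        linarith
      _ = _ := by ring
  · exact (hΨ.diff ξ _ (fun ζ => cy _ (hx ζ))
      (H.diff X hx (fun ζ => (hyz _ (hx ζ)).1) hd)).add
      (hΨ'.diff ξ _ (fun ζ => cz _ (hx ζ)) (H'.diff X hx (fun ζ => (hyz _ (hx ζ)).2) hd))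

end glue

/-! ### Two-sided exponential weights and the ladder of spectral gaps -/

/-- The weight growing at rate `a` in forward time and at rate `b` in backward time. -/
def wt (a b : ℝ) (l : ℤ) : ℝ := if 0 ≤ l then a ^ l else b ^ l

section wt

variable {a b a' b' lo hi : ℝ} {l : ℤ}

lemma wt_of_nonneg (h : 0 ≤ l) : wt a b l = a ^ l := if_pos h

lemma wt_of_neg (h : l < 0) : wt a b l = b ^ l := if_neg (not_le.2 h)

lemma wt_pos (ha : 0 < a) (hb : 0 < b) (l : ℤ) : 0 < wt a b l := by
  unfold wt
  split_ifs <;> positivity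

lemma wt_mul (l : ℤ) : wt a b l * wt a' b' l = wt (a * a') (b * b') l := by
  unfold wt
  split_ifs <;> rw [mul_zpow]

lemma wt_one_one (l : ℤ) : wt 1 1 l = 1 := by simp [wt]

lemma wt_le_of_nonneg (hl : 0 ≤ l) (ha : 0 ≤ a) (h : a ≤ a') : wt a b l ≤ wt a' b' l := by
  rw [wt_of_nonneg hl, wt_of_nonneg hl]
  exact zpow_le_zpow_left₀ hl ha h

lemma wt_le_of_neg (hl : l < 0) (hb : 0 < b') (h : b' ≤ b) : wt a b l ≤ wt a' b' l := by
  rw [wt_of_neg hl, wt_of_neg hl, ← neg_neg l, zpow_neg b, zpow_neg b']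
  exact inv_anti₀ (zpow_pos hb _) (zpow_le_zpow_left₀ (neg_nonneg.2 hl.le) hb.le h)

lemma wt_succ (hb : b ≠ 0) (l : ℤ) : wt a b (l + 1) = (if 0 ≤ l then a else b) * wt a b l := by
  rcases lt_trichotomy l (-1) with h | h | h
  · rw [wt_of_neg (by omega), wt_of_neg (by omega), if_neg (by omega), zpow_add_one₀ hb, mul_comm]
  · subst h
    simp [wt, hb]
  · rw [wt_of_nonneg (by omega), wt_of_nonneg (by omega), if_pos (by omega), mul_comm]
    obtain ⟨n, rfl⟩ := Int.eq_ofNat_of_zero_le (show 0 ≤ l by omega)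
    exact_mod_cast pow_succ a n

lemma adm_wt (hlo : 0 < lo) (ha : lo ≤ a) (ha' : a ≤ hi) (hb : lo ≤ b) (hb' : b ≤ hi) :
    Adm lo hi (wt a b) := by
  have ha0 := hlo.trans_le ha
  have hb0 := hlo.trans_le hb
  refine ⟨wt_pos ha0 hb0, fun m => ?_, fun m => ?_⟩ <;>
  · have := (wt_pos ha0 hb0 m).le
    rw [wt_succ hb0.ne']
    gcongr
    split_ifs <;> assumption

end wt

/-- Numerical data describing the gaps `[α i, β i]` of the spectrum, the central gap having
index `k`. -/
structure Ladder (A : ℝ) (k r : ℕ) (α β : ℕ → ℝ) : Prop where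
  k_lt : k < r
  pos : ∀ i ≤ r, 0 < α i
  le : ∀ i ≤ r, α i ≤ β i
  step : ∀ i < r, β i ≤ α (i + 1)
  le_one : α k ≤ 1
  one_le : 1 ≤ β k
  lower : ∀ i < k, α k * α (i + 1) ≤ β i
  upper : ∀ j, k ≤ j → j < r → α (j + 1) ≤ β k * β j
  first : α k ≤ β k * β 0
  last : α k * α r ≤ β k
  crude_lower : α 0 * (2 * A) ≤ 1
  crude_upper : 2 * A ≤ β r

namespace Ladder

variable {A : ℝ} {k r : ℕ} {α β : ℕ → ℝ}

lemma alpha_mono (H : Ladder A k r α β) {i j : ℕ} (hij : i ≤ j) (hj : j ≤ r) : α i ≤ α j := by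
  induction j, hij using Nat.le_induction with
  | base => exact le_rfl
  | succ j hij ih =>
    exact (ih (by omega)).trans ((H.le j (by omega)).trans (H.step j (by omega)))

lemma beta_mono (H : Ladder A k r α β) {i j : ℕ} (hij : i ≤ j) (hj : j ≤ r) : β i ≤ β j := by
  induction j, hij using Nat.le_induction with
  | base => exact le_rfl
  | succ j hij ih =>
    exact (ih (by omega)).trans ((H.step j (by omega)).trans (H.le _ hj))

lemma beta_pos (H : Ladder A k r α β) {i : ℕ} (hi : i ≤ r) : 0 < β i :=
  (H.pos i hi).trans_le (H.le i hi)

end Ladder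

lemma eventually_gt_one_le {f g : ℝ → ℝ} (hf : ContinuousAt f 1) (hg : ContinuousAt g 1)
    (h : f 1 < g 1) : ∀ᶠ c in 𝓝[>] (1 : ℝ), f c ≤ g c :=
  ((hf.eventually_lt hg h).filter_mono nhdsWithin_le_nhds).mono fun _ h => h.le

lemma exists_ladder {S : Set ℝ} {r k : ℕ} {aa bb : ℕ → ℝ} {A : ℝ} (hA : 1 ≤ A)
    (hk : 1 ≤ k) (hkr : k < r) (hab : ∀ i : ℕ, 1 ≤ i → i ≤ r → 0 < aa i ∧ aa i ≤ bb i)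
    (hord : ∀ i : ℕ, 1 ≤ i → i < r → bb i < aa (i + 1))
    (hbk : bb k < 1) (hak : 1 < aa (k + 1))
    (hgap : max (bb r) (aa 1)⁻¹ < aa (k + 1) / bb k)
    (hband₁ : ∀ i : ℕ, 1 ≤ i → i ≤ k → bb i / aa i < (bb k)⁻¹)
    (hband₂ : ∀ j : ℕ, k + 1 ≤ j → j ≤ r → bb j / aa j < aa (k + 1))
    (hS : S = ⋃ i ∈ Finset.Icc 1 r, Set.Icc (aa i) (bb i)) :
    ∃ (κ : ℝ) (α β : ℕ → ℝ), 0 < κ ∧ κ < 1 ∧ Ladder A k r α β ∧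
      ∀ i ≤ r, ∀ τ ∈ Set.Icc (κ * α i) (β i / κ), τ ∉ S := by
  have hbpos : ∀ i : ℕ, 1 ≤ i → i ≤ r → 0 < bb i := fun i h h' =>
    (hab i h h').1.trans_le (hab i h h').2
  have hbk0 := hbpos k hk hkr.le
  have ha1 := (hab 1 le_rfl (by omega)).1
  have hak0 := (hab (k + 1) (by omega) hkr).1
  have hbr0 := hbpos r (by omega) le_rfl
  obtain ⟨hg₁, hg₂⟩ := max_lt_iff.1 hgap
  rw [lt_div_iff₀ hbk0] at hg₁ hg₂
  have e₁ : ∀ᶠ c in 𝓝[>] (1 : ℝ), ∀ i ∈ Finset.Ico 1 r, c ^ 2 * bb i ≤ aa (i + 1) / c ^ 2 := by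
    rw [Filter.eventually_all_finset]
    intro i hi
    rw [Finset.mem_Ico] at hi
    exact eventually_gt_one_le (by fun_prop) (by fun_prop (disch := norm_num))
      (by simpa using hord i hi.1 hi.2)
  have e₂ : ∀ᶠ c in 𝓝[>] (1 : ℝ), c ^ 2 * bb k ≤ 1 :=
    eventually_gt_one_le (by fun_prop) (by fun_prop) (by simpa using hbk)
  have e₃ : ∀ᶠ c in 𝓝[>] (1 : ℝ), 1 ≤ aa (k + 1) / c ^ 2 :=
    eventually_gt_one_le (by fun_prop) (by fun_prop (disch := norm_num)) (by simpa using hak)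
  have e₄ : ∀ᶠ c in 𝓝[>] (1 : ℝ), ∀ i ∈ Finset.range k,
      c ^ 2 * bb k * (c ^ 2 * bb (i + 1)) ≤ aa (i + 1) / c ^ 2 := by
    rw [Filter.eventually_all_finset]
    intro i hi
    rw [Finset.mem_range] at hi
    refine eventually_gt_one_le (by fun_prop) (by fun_prop (disch := norm_num)) ?_
    have h := hband₁ (i + 1) (by omega) (by omega)
    rw [div_lt_iff₀ (hab (i + 1) (by omega) (by omega)).1, inv_mul_eq_div, lt_div_iff₀ hbk0] at h
    simpa [mul_comm] using h
  have e₅ : ∀ᶠ c in 𝓝[>] (1 : ℝ), ∀ j ∈ Finset.Ico k r,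
      c ^ 2 * bb (j + 1) ≤ aa (k + 1) / c ^ 2 * (aa (j + 1) / c ^ 2) := by
    rw [Filter.eventually_all_finset]
    intro j hj
    rw [Finset.mem_Ico] at hj
    refine eventually_gt_one_le (by fun_prop) (by fun_prop (disch := norm_num)) ?_
    have h := hband₂ (j + 1) (by omega) (by omega)
    rw [div_lt_iff₀ (hab (j + 1) (by omega) (by omega)).1] at h
    simpa using h
  have e₆ : ∀ᶠ c in 𝓝[>] (1 : ℝ), c ^ 2 * bb k ≤ aa (k + 1) / c ^ 2 * (aa 1 / c ^ 2) := by
    refine eventually_gt_one_le (by fun_prop) (by fun_prop (disch := norm_num)) ?_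
    rw [inv_mul_eq_div, div_lt_iff₀ ha1] at hg₂
    simpa using hg₂
  have e₇ : ∀ᶠ c in 𝓝[>] (1 : ℝ), c ^ 2 * bb k * (c ^ 2 * bb r) ≤ aa (k + 1) / c ^ 2 := by
    refine eventually_gt_one_le (by fun_prop) (by fun_prop (disch := norm_num)) ?_
    simpa [mul_comm] using hg₁
  have e₈ : ∀ᶠ c in 𝓝[>] (1 : ℝ), c ≤ 2 :=
    eventually_gt_one_le (by fun_prop) (by fun_prop) (by norm_num)
  obtain ⟨c, c₁, c₂, c₃, c₄, c₅, c₆, c₇, c₈, hc⟩ := (e₁.and (e₂.and (e₃.and (e₄.and (e₅.and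
    (e₆.and (e₇.and (e₈.and self_mem_nhdsWithin)))))))).exists
  have hc1 : 1 < c := hc
  have hc0 : 0 < c := by linarith
  have hc2 : 1 ≤ c ^ 2 := one_le_pow₀ hc1.le
  have hc4 : c ^ 2 ≤ 4 := by nlinarith
  set α : ℕ → ℝ := fun i => if i = 0 then min (aa 1 / 4) (1 / (2 * A)) else c ^ 2 * bb i with hα
  set β : ℕ → ℝ := fun i => if i = r then max (4 * bb r) (2 * A) else aa (i + 1) / c ^ 2 with hβ
  have α0 : α 0 = min (aa 1 / 4) (1 / (2 * A)) := if_pos rfl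
  have βr : β r = max (4 * bb r) (2 * A) := if_pos rfl
  have α1 : ∀ {i : ℕ}, 1 ≤ i → α i = c ^ 2 * bb i := fun h => if_neg (by omega)
  have β1 : ∀ {i : ℕ}, i < r → β i = aa (i + 1) / c ^ 2 := fun h => if_neg (by omega)
  have hα0 : 0 < α 0 := by
    rw [α0]
    positivity
  refine ⟨c⁻¹, α, β, by positivity, inv_lt_one_of_one_lt₀ hc1, ⟨hkr, fun i hi => ?_, fun i hi => ?_,
    fun i hi => ?_, ?_, ?_, fun i hi => ?_, fun j hj hj' => ?_, ?_, ?_, ?_, ?_⟩,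
    fun i hi τ hτ hτS => ?_⟩
  · rcases Nat.eq_zero_or_pos i with rfl | h
    · exact hα0
    · rw [α1 h]
      have := hbpos i h hi
      positivity
  · rcases Nat.eq_zero_or_pos i with rfl | h
    · rw [α0, β1 (by omega)]
      refine (min_le_left _ _).trans ?_
      gcongr
    · rcases hi.eq_or_lt with rfl | h'
      · rw [α1 h, βr]
        refine le_trans ?_ (le_max_left _ _)
        gcongr
      · rw [α1 h, β1 h']
        exact c₁ i (Finset.mem_Ico.2 ⟨h, h'⟩)
  · rw [β1 hi, α1 (by omega)]
    obtain ⟨h1, h2⟩ := hab (i + 1) (by omega) hi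
    calc aa (i + 1) / c ^ 2 ≤ aa (i + 1) := div_le_self h1.le hc2
      _ ≤ bb (i + 1) := h2
      _ ≤ _ := le_mul_of_one_le_left (h1.le.trans h2) hc2
  · rw [α1 hk]
    exact c₂
  · rw [β1 hkr]
    exact c₃
  · rw [α1 hk, α1 (by omega), β1 (by omega)]
    exact c₄ i (Finset.mem_range.2 hi)
  · rw [α1 (by omega), β1 hkr, β1 hj']
    exact c₅ j (Finset.mem_Ico.2 ⟨hj, hj'⟩)
  · rw [α1 hk, β1 hkr, β1 (by omega)]
    exact c₆
  · rw [α1 hk, α1 (by omega), β1 hkr]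
    exact c₇
  · rw [α0, ← le_div_iff₀ (by positivity)]
    exact min_le_right _ _
  · rw [βr]
    exact le_max_right _ _
  · rw [hS] at hτS
    simp only [Set.mem_iUnion, Finset.mem_Icc, exists_prop] at hτS
    obtain ⟨p, ⟨hp, hp'⟩, h1, h2⟩ := hτS
    obtain ⟨t1, t2⟩ := hτ
    have amono : ∀ {p q : ℕ}, 1 ≤ p → p ≤ q → q ≤ r → aa p ≤ aa q := by
      intro p q hp hpq
      induction q, hpq using Nat.le_induction with
      | base => exact fun _ => le_rfl
      | succ q hpq ih =>
        intro h
        have h1 := ih (by omega)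
        have h2 := (hab q (by omega) (by omega)).2
        have h3 := hord q (by omega) (by omega)
        linarith
    have bmono : ∀ {p q : ℕ}, 1 ≤ p → p ≤ q → q ≤ r → bb p ≤ bb q := by
      intro p q hp hpq
      induction q, hpq using Nat.le_induction with
      | base => exact fun _ => le_rfl
      | succ q hpq ih =>
        intro h
        have h1 := ih (by omega)
        have h2 := (hab (q + 1) (by omega) h).2
        have h3 := hord q (by omega) (by omega)
        linarith
    rcases le_or_gt p i with h | h
    · rw [α1 (by omega)] at t1
      have e := bmono hp h hi
      have e' := hbpos i (by omega) hi
      have : c⁻¹ * (c ^ 2 * bb i) = c * bb i := by field_simp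
      nlinarith
    · rw [β1 (by omega)] at t2
      have e := amono (p := i + 1) (by omega) (show i + 1 ≤ p from h) hp'
      have e' := (hab (i + 1) (by omega) (by omega)).1
      have : aa (i + 1) / c ^ 2 / c⁻¹ = aa (i + 1) / c := by field_simp
      rw [this] at t2
      have := div_lt_self e' hc1
      linarith

section chain

variable [FiniteDimensional ℝ E] {B : ℤ → (E ≃L[ℝ] E)} {N : ℤ → E → ℝ} {η L A κ C : ℝ}
  {f : ℤ → E → E} {k r : ℕ} {α β : ℕ → ℝ}

lemma Ladder.good (H : Ladder A k r α β) (hS : ∀ i ≤ r, SGap B N η κ C (α i) (β i)) {i : ℕ}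
    (hi : i ≤ r) {a b : ℝ} (ha : α i ≤ a) (ha' : a ≤ β i) (hb : α i ≤ b) (hb' : b ≤ β i) :
    Good B N η κ C (wt a b) :=
  ⟨α i, β i, hS i hi, adm_wt (H.pos i hi) ha ha' hb hb'⟩

lemma Ladder.exists_conj_stable (X : Ctx B N η L A κ f) (H : Ladder A k r α β)
    (hS : ∀ i ≤ r, SGap B N η κ C (α i) (β i)) :
    ∃ Ψ, Conj B N f {l | l < 0}ᶜ (wt (α k) (β k)) (wt (α 0) (β 0)) Ψ := by
  have hkr := H.k_lt
  suffices h : ∀ j ≤ k, ∃ Ψ,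
      Conj B N f {l | l < 0}ᶜ (wt (α k) (β k)) (wt (α (k - j)) (β (k - j))) Ψ by
    simpa using h k le_rfl
  intro j
  induction j with
  | zero =>
    intro _
    have hle := H.le k hkr.le
    exact ⟨id, Conj.of_trivial X (H.good hS hkr.le le_rfl hle hle le_rfl) fun _ _ => le_rfl⟩
  | succ j ih =>
    intro hj
    obtain ⟨Ψ, hΨ⟩ := ih (by omega)
    obtain ⟨i, hi⟩ : ∃ i, i = k - (j + 1) := ⟨_, rfl⟩
    rw [show k - j = i + 1 by omega] at hΨ
    rw [← hi]
    have lk := H.le k hkr.le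
    have li := H.le i (by omega)
    have li' := H.le (i + 1) (by omega)
    have pk := H.pos k hkr.le
    have pi := H.beta_pos (i := i) (by omega)
    have pi' := H.pos (i + 1) (by omega)
    refine StepData.exists_conj X (C := C) (V := wt (β i) (β i)) ⟨halfLine_neg.compl,
      H.good hS hkr.le le_rfl lk lk le_rfl, H.good hS (i := i + 1) (by omega) le_rfl li' li' le_rfl,
      H.good hS (i := i) (by omega) le_rfl li li le_rfl,
      H.good hS (i := i) (by omega) li le_rfl li le_rfl,
      fun l hl => ?_, fun l hl => ?_, fun l hl => ?_, fun l hl => ?_, fun l hl => ?_,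
      fun l hl => ?_, fun l hl => ?_⟩ hΨ
    · rw [← wt_one_one l]
      exact wt_le_of_nonneg (not_lt.1 hl) pk.le H.le_one
    · exact wt_le_of_nonneg (not_lt.1 hl) pi'.le (H.alpha_mono (by omega) hkr.le)
    · exact wt_le_of_nonneg (not_lt.1 hl) pi.le (H.step i (by omega))
    · rw [wt_mul]
      exact wt_le_of_nonneg (not_lt.1 hl) (by positivity) (H.lower i (by omega))
    · exact wt_le_of_neg (not_not.1 hl) pi (H.beta_mono (by omega) (by omega))
    · exact wt_le_of_neg (not_not.1 hl) pi le_rfl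
    · exact wt_le_of_neg (not_not.1 hl) pi le_rfl

lemma Ladder.exists_conj_unstable (X : Ctx B N η L A κ f) (H : Ladder A k r α β)
    (hS : ∀ i ≤ r, SGap B N η κ C (α i) (β i)) :
    ∃ Ψ, Conj B N f {l | l < 0} (wt (α k) (β k)) (wt (α r) (β r)) Ψ := by
  have hkr := H.k_lt
  suffices h : ∀ j, k ≤ j → j ≤ r → ∃ Ψ,
      Conj B N f {l | l < 0} (wt (α k) (β k)) (wt (α j) (β j)) Ψ from h r hkr.le le_rfl
  intro j hj
  induction j, hj using Nat.le_induction with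
  | base =>
    intro _
    have hle := H.le k hkr.le
    exact ⟨id, Conj.of_trivial X (H.good hS hkr.le le_rfl hle hle le_rfl) fun _ _ => le_rfl⟩
  | succ j hj ih =>
    intro hjr
    obtain ⟨Ψ, hΨ⟩ := ih (by omega)
    have lk := H.le k hkr.le
    have lj := H.le j (by omega)
    have lj' := H.le (j + 1) (by omega)
    have pk := H.beta_pos hkr.le
    have pj := H.beta_pos (i := j) (by omega)
    have qj := H.pos j (by omega)
    have pj' := H.pos (j + 1) (by omega)
    refine StepData.exists_conj X (C := C) (V := wt (α (j + 1)) (α (j + 1))) ⟨halfLine_neg,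
      H.good hS hkr.le le_rfl lk lk le_rfl, H.good hS (i := j) (by omega) le_rfl lj lj le_rfl,
      H.good hS (i := j + 1) (by omega) le_rfl lj' lj' le_rfl,
      H.good hS (i := j + 1) (by omega) le_rfl lj' le_rfl lj',
      fun l hl => ?_, fun l hl => ?_, fun l hl => ?_, fun l hl => ?_, fun l hl => ?_,
      fun l hl => ?_, fun l hl => ?_⟩ hΨ
    · rw [← wt_one_one l]
      exact wt_le_of_neg hl one_pos H.one_le
    · exact wt_le_of_neg hl pk (H.beta_mono hj (by omega))
    · exact wt_le_of_neg hl pj (H.step j (by omega))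
    · rw [wt_mul]
      exact wt_le_of_neg hl pj' (H.upper j hj (by omega))
    · exact wt_le_of_nonneg (not_lt.1 hl) qj.le (H.alpha_mono (by omega) hjr)
    · exact wt_le_of_nonneg (not_lt.1 hl) pj'.le le_rfl
    · exact wt_le_of_nonneg (not_lt.1 hl) pj'.le le_rfl

lemma IsOrbit.step_le (X : Ctx B N η L A κ f) (hA : 1 ≤ A) (hη : 2 * A * η ≤ 1) {x : ℤ → E}
    (hx : IsOrbit B f x) (m : ℤ) : N (m + 1) (x (m + 1)) ≤ 2 * A * N m (x m) := by
  have e1 := (X.hN (m + 1)).add_le (B m (x m)) (f m (x m))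
  rw [← hx m] at e1
  have e2 := X.hBA m (x m)
  have e3 := X.hf.norm_le X.hN m (x m)
  have n1 := (X.hN m).nonneg (x m)
  have : η ≤ A := by nlinarith [X.hη]
  nlinarith

lemma IsOrbit.le_step (X : Ctx B N η L A κ f) (hη : 2 * A * η ≤ 1)
    (hAB : ∀ n x, N n x ≤ A * N (n + 1) (B n x)) {x : ℤ → E} (hx : IsOrbit B f x) (m : ℤ) :
    N m (x m) ≤ 2 * A * N (m + 1) (x (m + 1)) := by
  have hA := X.hA
  have e1 := (X.hN (m + 1)).le_of_eq_sub (z := B m (x m)) (x := x (m + 1)) (y := f m (x m))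
    (by rw [hx m, add_sub_cancel_right])
  have e2 := mul_le_mul_of_nonneg_left e1 hA
  have e3 := mul_le_mul_of_nonneg_left (X.hf.norm_le X.hN m (x m)) hA
  have e4 := hAB m (x m)
  have e5 := mul_le_mul_of_nonneg_right hη ((X.hN m).nonneg (x m))
  linarith

lemma IsOrbit.residual_le (X : Ctx B N η L A κ f) {x : ℤ → E} (hx : IsOrbit B f x) (m : ℤ) :
    N (m + 1) (x (m + 1) - B m (x m)) ≤ η * N m (x m) := by
  rw [hx m, add_sub_cancel_left]
  exact X.hf.norm_le X.hN m (x m)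

lemma Ladder.side_stable (X : Ctx B N η L A κ f) (H : Ladder A k r α β)
    (hS : ∀ i ≤ r, SGap B N η κ C (α i) (β i)) (hη : 2 * A * η ≤ 1)
    (hAB : ∀ n x, N n x ≤ A * N (n + 1) (B n x)) :
    Side B N η κ C f {l | l < 0} (wt (α k) (β k)) (wt (β k) (α k)) (wt (α 0) (β 0)) := by
  have hkr := H.k_lt
  have lk := H.le k hkr.le
  have l0 := H.le 0 (by omega)
  have pk := H.pos k hkr.le
  have p0 := H.pos 0 (by omega)
  refine ⟨halfLine_neg, H.good hS hkr.le le_rfl lk lk le_rfl, H.good hS hkr.le lk le_rfl le_rfl lk,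
    H.good hS (i := 0) (by omega) le_rfl l0 l0 le_rfl, fun l => ?_, fun l hl => ?_, fun l hl => ?_,
    fun x hx => ?_⟩
  · rcases le_or_gt 0 l with h | h
    · exact wt_le_of_nonneg h pk.le lk
    · exact wt_le_of_neg h pk lk
  · exact wt_le_of_neg hl (H.beta_pos (by omega)) (H.beta_mono (by omega) hkr.le)
  · rw [wt_mul]
    exact wt_le_of_neg hl pk (H.first.trans_eq (mul_comm _ _))
  · obtain ⟨K, hK, b⟩ := exists_halfBound X (hS 0 (by omega)) (adm_wt p0 le_rfl l0 l0 le_rfl)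
      (adm_wt p0 le_rfl l0 le_rfl l0) halfLine_neg
    refine ⟨K * N 0 (x 0), mul_nonneg hK ((X.hN 0).nonneg _), b 0 0 x (hx.residual_le X)
      ⟨N 0 (x 0), (X.hN 0).nonneg _, fun m hm => ?_⟩⟩
    have hj : ∀ j : ℕ, N (-j) (x (-j)) ≤ N 0 (x 0) * (α 0 ^ j)⁻¹ := fun j => by
      induction j with
      | zero => simp
      | succ j ih =>
        have e1 := hx.le_step X hη hAB (-((j + 1 : ℕ) : ℤ))
        rw [show -((j + 1 : ℕ) : ℤ) + 1 = -j by push_cast; ring] at e1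
        have e2 : 2 * A ≤ (α 0)⁻¹ := by
          rw [← mul_one (α 0)⁻¹]
          exact (le_inv_mul_iff₀ p0).2 H.crude_lower
        calc _ ≤ 2 * A * N (-j) (x (-j)) := e1
          _ ≤ (α 0)⁻¹ * (N 0 (x 0) * (α 0 ^ j)⁻¹) := by
            have := (X.hN (-j)).nonneg (x (-j))
            gcongr
          _ = _ := by rw [pow_succ, mul_inv]; ring
    obtain ⟨j, hj'⟩ : ∃ j : ℕ, m = -j := ⟨m.natAbs, by
      have : m - 0 < 0 := hm
      omega⟩
    rw [wt_of_neg hm, sub_zero, hj', zpow_neg, zpow_natCast]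
    exact hj j

lemma Ladder.side_unstable (X : Ctx B N η L A κ f) (H : Ladder A k r α β)
    (hS : ∀ i ≤ r, SGap B N η κ C (α i) (β i)) (hA : 1 ≤ A) (hη : 2 * A * η ≤ 1) :
    Side B N η κ C f {l | l < 0}ᶜ (wt (α k) (β k)) (wt (β k) (α k)) (wt (α r) (β r)) := by
  have hkr := H.k_lt
  have lk := H.le k hkr.le
  have lr := H.le r le_rfl
  have pk := H.pos k hkr.le
  have pr := H.pos r le_rfl
  refine ⟨halfLine_neg.compl, H.good hS hkr.le le_rfl lk lk le_rfl,
    H.good hS hkr.le lk le_rfl le_rfl lk,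
    H.good hS (i := r) le_rfl le_rfl lr lr le_rfl, fun l => ?_, fun l hl => ?_, fun l hl => ?_,
    fun x hx => ?_⟩
  · rcases le_or_gt 0 l with h | h
    · exact wt_le_of_nonneg h pk.le lk
    · exact wt_le_of_neg h pk lk
  · exact wt_le_of_nonneg (not_lt.1 hl) pk.le (H.alpha_mono hkr.le le_rfl)
  · rw [wt_mul]
    exact wt_le_of_nonneg (not_lt.1 hl) (by positivity) ((mul_comm _ _).trans_le H.last)
  · obtain ⟨K, hK, b⟩ := exists_halfBound X (hS r le_rfl) (adm_wt pr le_rfl lr lr le_rfl)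
      (adm_wt pr lr le_rfl lr le_rfl) halfLine_neg.compl
    refine ⟨K * N 0 (x 0), mul_nonneg hK ((X.hN 0).nonneg _), b 0 0 x (hx.residual_le X)
      ⟨N 0 (x 0), (X.hN 0).nonneg _, fun m hm => ?_⟩⟩
    have hj : ∀ j : ℕ, N j (x j) ≤ N 0 (x 0) * β r ^ j := fun j => by
      induction j with
      | zero => simp
      | succ j ih =>
        have e1 := hx.step_le X hA hη j
        have e2 := H.crude_upper
        have e3 := H.beta_pos (i := r) le_rfl
        push_cast
        calc _ ≤ 2 * A * N j (x j) := e1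
          _ ≤ β r * (N 0 (x 0) * β r ^ j) := by
            have := (X.hN j).nonneg (x j)
            gcongr
          _ = _ := by ring
    obtain ⟨j, hj'⟩ : ∃ j : ℕ, m = j := ⟨m.natAbs, by
      have : ¬ m - 0 < 0 := hm
      omega⟩
    rw [wt_of_nonneg (not_lt.1 hm), sub_zero, hj', zpow_natCast]
    exact hj j

lemma Ladder.exists_orbitConj (X : Ctx B N η L A κ f) (H : Ladder A k r α β)
    (hS : ∀ i ≤ r, SGap B N η κ C (α i) (β i)) (hA : 1 ≤ A) (hη : 2 * A * η ≤ 1)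
    (hAB : ∀ n x, N n x ≤ A * N (n + 1) (B n x)) : ∃ Φ, OrbitConj B N f Φ := by
  obtain ⟨Ψ, hΨ⟩ := H.exists_conj_stable X hS
  obtain ⟨Ψ', hΨ'⟩ := H.exists_conj_unstable X hS
  exact Side.exists_orbitConj X (H.side_stable X hS hη hAB) (H.side_unstable X hS hA hη)
    (H.side_stable X.linear hS hη hAB) (H.side_unstable X.linear hS hA hη) hΨ hΨ'

end chain

/-! ### From orbit conjugacies to conjugating diffeomorphisms -/

section diffeo

lemma contDiff_one_of_strict {φ : E → E} (h : ∀ x, ∃ φ' : E →L[ℝ] E, HasStrictFDerivAt φ φ' x) :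
    ContDiff ℝ 1 φ := by
  choose φ' hφ using h
  rw [contDiff_one_iff_fderiv]
  refine ⟨fun x => (hφ x).hasFDerivAt.differentiableAt, continuous_iff_continuousAt.2 fun x => ?_⟩
  rw [ContinuousAt, Metric.tendsto_nhds]
  intro ε hε
  have h1 := (hφ x).isLittleO.def (half_pos hε)
  rw [nhds_prod_eq] at h1
  obtain ⟨U, hU, h2⟩ := mem_prod_self_iff.1 h1
  have h3 : ∀ᶠ y in 𝓝 x, U ∈ 𝓝 y := eventually_mem_nhds_iff.2 hU
  filter_upwards [h3] with y hy
  rw [dist_eq_norm, (hφ y).hasFDerivAt.fderiv, (hφ x).hasFDerivAt.fderiv]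
  have h4 : HasFDerivAt (fun z => φ z - φ' x z) (φ' y - φ' x) y :=
    (hφ y).hasFDerivAt.sub (φ' x).hasFDerivAt
  refine (h4.le_of_lip' (half_pos hε).le ?_).trans_lt (half_lt_self hε)
  filter_upwards [hy] with z hz
  have : ‖φ z - φ y - φ' x (z - y)‖ ≤ ε / 2 * ‖z - y‖ :=
    h2 (Set.mk_mem_prod hz (mem_of_mem_nhds hy))
  simp only [map_sub] at this
  convert this using 2
  abel

variable [FiniteDimensional ℝ E]

lemma exists_equiv_of_lower {N M : E → ℝ} (hN : IsNormOn N) (hM : IsNormOn M) {φ : E → E}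
    {φ' : E →L[ℝ] E} {x : E} (hφ : HasStrictFDerivAt φ φ' x) {c : ℝ}
    (hb : ∀ᶠ z in 𝓝 x, M (z - x) ≤ c * N (φ z - φ x)) :
    ∃ e : E ≃L[ℝ] E, HasStrictFDerivAt φ (e : E →L[ℝ] E) x := by
  have hinj : Function.Injective (φ' : E →ₗ[ℝ] E) := by
    rw [injective_iff_map_eq_zero]
    intro z hz
    refine hM.eq_zero_of_le ?_
    have := le_fderiv_norm hN hM hφ.hasFDerivAt hb z
    rwa [show φ' z = 0 from hz, hN.map_zero, mul_zero] at this
  refine ⟨(LinearEquiv.ofInjectiveEndo (φ' : E →ₗ[ℝ] E) hinj).toContinuousLinearEquiv, ?_⟩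
  convert hφ using 1
  ext z
  rfl

lemma hasStrictFDerivAt_symm (e : E ≃ E)
    (h : ∀ x, ∃ e' : E ≃L[ℝ] E, HasStrictFDerivAt e (e' : E →L[ℝ] E) x) :
    ∀ y, ∃ e' : E →L[ℝ] E, HasStrictFDerivAt e.symm e' y := by
  have : CompleteSpace E := FiniteDimensional.complete ℝ E
  intro y
  obtain ⟨e', he⟩ := h (e.symm y)
  have hc : ContinuousAt e.symm y := by
    have h1 := he.map_nhds_eq_of_equiv
    rw [e.apply_symm_apply] at h1
    rw [ContinuousAt, ← h1, tendsto_map'_iff]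
    simp only [Function.comp_def, e.symm_apply_apply]
    exact tendsto_id
  exact ⟨_, he.of_local_left_inverse hc (Eventually.of_forall e.apply_symm_apply)⟩

variable {B : ℤ → (E ≃L[ℝ] E)} {N : ℤ → E → ℝ} {η L A κ : ℝ} {f : ℤ → E → E}

lemma step_lower (X : Ctx B N η L A κ f) (hη : 2 * A * η ≤ 1)
    (hAB : ∀ n x, N n x ≤ A * N (n + 1) (B n x)) (n : ℤ) (x y : E) :
    N n (x - y) ≤ 2 * A * N (n + 1) (B n x + f n x - (B n y + f n y)) := by
  have hA := X.hA
  have e1 := hAB n (x - y)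
  rw [map_sub] at e1
  have e2 := (X.hN (n + 1)).le_of_eq_sub (z := B n x - B n y)
    (x := B n x + f n x - (B n y + f n y)) (y := f n x - f n y) (by abel)
  have e3 := mul_le_mul_of_nonneg_left e2 hA
  have e4 := mul_le_mul_of_nonneg_left (X.hf.lip X.hN n x y) hA
  have e5 := mul_le_mul_of_nonneg_right hη ((X.hN n).nonneg (x - y))
  linarith

lemma step_bijective (X : Ctx B N η L A κ f) (hη : 2 * A * η ≤ 1)
    (hAB : ∀ n x, N n x ≤ A * N (n + 1) (B n x)) (n : ℤ) :
    Function.Bijective fun x => B n x + f n x := by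
  have hA := X.hA
  refine ⟨fun x y hxy => ?_, fun y => ?_⟩
  · have h1 := step_lower X hη hAB n x y
    rw [show B n x + f n x = B n y + f n y from hxy, sub_self, (X.hN _).map_zero, mul_zero] at h1
    exact sub_eq_zero.1 ((X.hN n).eq_zero_of_le h1)
  · set g : E → E := fun x => (B n).symm (y - f n x) with hg
    have hgc : Continuous g :=
      (B n).symm.continuous.comp (continuous_const.sub (X.hf.smooth n).continuous)
    have hcon : ∀ x x', N n (g x - g x') ≤ 1 / 2 * N n (x - x') := fun x x' => by
      have e1 := hAB n (g x - g x')
      rw [hg, map_sub, ContinuousLinearEquiv.apply_symm_apply,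
        ContinuousLinearEquiv.apply_symm_apply, sub_sub_sub_cancel_left,
        (X.hN (n + 1)).sub_comm] at e1
      have e4 := mul_le_mul_of_nonneg_left (X.hf.lip X.hN n x x') hA
      have e5 := mul_le_mul_of_nonneg_right hη ((X.hN n).nonneg (x - x'))
      linarith
    have hd : ∀ j : ℕ, N n (g^[j + 1] 0 - g^[j] 0) ≤ N n (g 0 - 0) * (1 / 2) ^ j := fun j => by
      induction j with
      | zero => simp
      | succ j ih =>
        have := hcon (g^[j + 1] 0) (g^[j] 0)
        rw [← Function.iterate_succ_apply' g, ← Function.iterate_succ_apply' g] at this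
        rw [pow_succ]
        linarith
    obtain ⟨hs, -⟩ := summable_of_geom (X.hN n) (by norm_num) (by norm_num) hd
    have ht := hs.hasSum.tendsto_sum_nat
    simp only [Finset.sum_range_sub (fun j => g^[j] 0)] at ht
    have ht' : Tendsto (fun j => g^[j] 0) atTop (𝓝 (∑' j, (g^[j + 1] 0 - g^[j] 0))) := by
      simpa using ht
    have hfix := isFixedPt_of_tendsto_iterate ht' hgc.continuousAt
    refine ⟨∑' j, (g^[j + 1] 0 - g^[j] 0), ?_⟩
    set z := ∑' j, (g^[j + 1] 0 - g^[j] 0)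
    have h1 : (B n).symm (y - f n z) = z := hfix
    have h2 : B n z = y - f n z := ((B n).symm_apply_eq.1 h1).symm
    beta_reduce
    rw [h2, sub_add_cancel]

lemma StrictDiff.orb {F : ℤ → E ≃ E} (hF : ∀ n x, ∃ e : E →L[ℝ] E, HasStrictFDerivAt (F n) e x)
    (hF' : ∀ n x, ∃ e : E →L[ℝ] E, HasStrictFDerivAt (F n).symm e x) (n : ℤ) (ξ : E) :
    StrictDiff (fun ζ => orb F n ζ) ξ := fun m => by
  induction m using Int.inductionOn' (b := n) with
  | zero =>
    refine ⟨ContinuousLinearMap.id ℝ E, ?_⟩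
    simp only [orb_self]
    exact hasStrictFDerivAt_id ξ
  | succ m _ ih =>
    obtain ⟨e, he⟩ := ih
    obtain ⟨e', he'⟩ := hF m (NonautLin.orb F n ξ m)
    refine ⟨e'.comp e, ?_⟩
    simp only [orb_succ]
    exact he'.comp ξ he
  | pred m _ ih =>
    obtain ⟨e, he⟩ := ih
    obtain ⟨e', he'⟩ := hF' (m - 1) (NonautLin.orb F n ξ m)
    refine ⟨e'.comp e, ?_⟩
    have h : ∀ ζ, NonautLin.orb F n ζ (m - 1) = (F (m - 1)).symm (NonautLin.orb F n ζ m) :=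
      fun ζ => by
        rw [Equiv.eq_symm_apply, ← orb_succ, sub_add_cancel]
    simp only [h]
    exact he'.comp ξ he

lemma orb_eq_of_orbit {X : Type*} {F : ℤ → X ≃ X} {x : ℤ → X} (hx : ∀ m, x (m + 1) = F m (x m))
    (n : ℤ) : orb F n (x n) = x := by
  funext m
  induction m using Int.inductionOn' (b := n) with
  | zero => exact orb_self F n _
  | succ m _ ih => rw [orb_succ, ih, hx]
  | pred m _ ih =>
    apply (F (m - 1)).injective
    rw [← orb_succ, ← hx, sub_add_cancel, ih]

/-- An orbit conjugacy induces conjugating `C¹` diffeomorphisms. -/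
lemma OrbitConj.exists_diffeo (X : Ctx B N η L A κ f) (hη : 2 * A * η ≤ 1)
    (hAB : ∀ n x, N n x ≤ A * N (n + 1) (B n x)) {Φ : (ℤ → E) → (ℤ → E)}
    (H : OrbitConj B N f Φ) :
    ∃ h : ℤ → (E ≃ E), (∀ n : ℤ, ContDiff ℝ 1 (h n) ∧ ContDiff ℝ 1 (h n).symm) ∧
      (∀ (n : ℤ) (x : E), h (n + 1) (B n x + f n x) = B n (h n x)) ∧
      ∃ M ρ : ℝ, 0 < M ∧ 0 < ρ ∧ ∀ (n : ℤ) (v : E), N n v ≤ ρ → ∀ z : E,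
        N n (fderiv ℝ (h n) v z) ≤ M * N n z ∧ N n (fderiv ℝ (h n).symm v z) ≤ M * N n z := by
  have hN := X.hN
  set F : ℤ → E ≃ E := fun n => Equiv.ofBijective _ (step_bijective X hη hAB n) with hF
  have hFa : ∀ n x, F n x = B n x + f n x := fun _ _ => rfl
  have hFd : ∀ n x, ∃ e : E ≃L[ℝ] E, HasStrictFDerivAt (F n) (e : E →L[ℝ] E) x := fun n x =>
    exists_equiv_of_lower (hN (n + 1)) (hN n)
      ((B n).hasStrictFDerivAt.add ((X.hf.smooth n).hasStrictFDerivAt one_ne_zero))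
      (Eventually.of_forall fun z => step_lower X hη hAB n z x)
  have horb : ∀ n ξ, IsOrbit B f (orb F n ξ) := fun n ξ m => orb_succ F n ξ m
  have hXd : ∀ n ξ, StrictDiff (fun ζ => orb F n ζ) ξ := fun n ξ =>
    StrictDiff.orb (fun n x => let ⟨e, he⟩ := hFd n x; ⟨(e : E →L[ℝ] E), he⟩)
      (fun n => hasStrictFDerivAt_symm _ (hFd n)) n ξ
  have uorb : ∀ {x : ℤ → E}, IsOrbit B f x → ∀ n, orb F n (x n) = x := fun {x} hx n =>
    orb_eq_of_orbit (F := F) (fun m => hx m) n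
  set φ : ℤ → E → E := fun n ξ => Φ (orb F n ξ) n with hφ
  have hup : ∀ R : ℝ, 0 ≤ R → ∃ K : ℝ, 0 ≤ K ∧ ∀ n ξ ζ, N n ξ ≤ R → N n ζ ≤ R →
      N n (φ n ζ - φ n ξ) ≤ K * N n (ζ - ξ) := fun R hR => by
    obtain ⟨K, hK, b⟩ := H.upper R hR
    refine ⟨K, hK, fun n ξ ζ h1 h2 => ?_⟩
    have := b n _ _ (horb n ξ) (horb n ζ)
    simp only [orb_self] at this
    exact this h1 h2
  have hlow : ∀ R : ℝ, 0 ≤ R → ∃ K : ℝ, 0 ≤ K ∧ ∀ n ξ ζ, N n ξ ≤ R → N n ζ ≤ R →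
      N n (ζ - ξ) ≤ K * N n (φ n ζ - φ n ξ) := fun R hR => by
    obtain ⟨K, hK, b⟩ := H.lower R hR
    refine ⟨K, hK, fun n ξ ζ h1 h2 => ?_⟩
    have := b n _ _ (horb n ξ) (horb n ζ)
    simp only [orb_self] at this
    exact this h1 h2
  have hbij : ∀ n, Function.Bijective (φ n) := fun n => by
    refine ⟨fun ξ ζ h => ?_, fun v => ?_⟩
    · obtain ⟨K, -, b⟩ := hlow (max (N n ξ) (N n ζ)) (le_max_of_le_left ((hN n).nonneg ξ))
      have := b n ζ ξ (le_max_right _ _) (le_max_left _ _)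
      rw [h, sub_self, (hN n).map_zero, mul_zero] at this
      exact sub_eq_zero.1 ((hN n).eq_zero_of_le this)
    · obtain ⟨x, hx, hs⟩ := H.surj (orb (fun n => (B n).toEquiv) n v) fun m => by
        rw [orb_succ, add_zero]
        rfl
      refine ⟨x n, ?_⟩
      simp only [hφ]
      rw [uorb hx, hs, orb_self]
  set h : ℤ → E ≃ E := fun n => Equiv.ofBijective _ (hbij n) with hh
  have hφh : ∀ n ξ, h n ξ = φ n ξ := fun _ _ => rfl
  have near : ∀ n v, ∀ R, N n v < R → ∀ᶠ z in 𝓝 v, N n z ≤ R := fun n v R hR =>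
    ((hN n).continuous.continuousAt.eventually_lt_const hR).mono fun _ h => h.le
  have hstrict : ∀ n ξ, ∃ e : E ≃L[ℝ] E, HasStrictFDerivAt (h n) (e : E →L[ℝ] E) ξ := fun n ξ => by
    obtain ⟨e, he⟩ := H.diff ξ _ (horb n) (hXd n ξ) n
    have h0 := (hN n).nonneg ξ
    obtain ⟨K, -, b⟩ := hlow (N n ξ + 1) (by linarith)
    exact exists_equiv_of_lower (hN n) (hN n) (φ := h n) he (c := K)
      ((near n ξ _ (lt_add_one _)).mono fun z hz => b n ξ z (by linarith) hz)
  have hsymm := fun n => hasStrictFDerivAt_symm (h n) (hstrict n)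
  have hsmooth : ∀ n : ℤ, ContDiff ℝ 1 (h n) ∧ ContDiff ℝ 1 (h n).symm := fun n =>
    ⟨contDiff_one_of_strict fun x => let ⟨e, he⟩ := hstrict n x; ⟨(e : E →L[ℝ] E), he⟩,
      contDiff_one_of_strict (hsymm n)⟩
  have h0 : ∀ n, h n 0 = 0 := fun n => by
    have := uorb (isOrbit_zero X) n
    rw [hφh, hφ]
    beta_reduce at this ⊢
    rw [this, H.zero]
  have hs0 : ∀ n, (h n).symm 0 = 0 := fun n => by rw [Equiv.symm_apply_eq, h0]
  obtain ⟨K₁, hK₁, b₁⟩ := hup 2 (by norm_num)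
  obtain ⟨K₂, hK₂, b₂⟩ := hlow 2 (by norm_num)
  have hinv : ∀ n v, N n v ≤ 1 / (K₂ + 1) → N n ((h n).symm v) ≤ 1 := fun n v hv => by
    by_contra! hcon
    have hg : Continuous fun t : ℝ => N n ((h n).symm (t • v)) :=
      (hN n).continuous.comp ((hsmooth n).2.continuous.comp (by fun_prop))
    obtain ⟨t, ⟨ht, ht'⟩, hgt⟩ := intermediate_value_Icc zero_le_one hg.continuousOn
      (show (1 : ℝ) ∈ Set.Icc _ _ from ⟨by simp [hs0, (hN n).map_zero], by simpa using hcon.le⟩)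
    beta_reduce at hgt
    have e1 := b₂ n 0 ((h n).symm (t • v)) (by simp [(hN n).map_zero]) (by linarith)
    rw [← hφh, ← hφh, h0, Equiv.apply_symm_apply, sub_zero, sub_zero, hgt, (hN n).smul,
      abs_of_nonneg ht] at e1
    have e2 : t * N n v ≤ 1 / (K₂ + 1) :=
      (mul_le_of_le_one_left ((hN n).nonneg v) ht').trans hv
    have e3 : K₂ * (t * N n v) ≤ K₂ * (1 / (K₂ + 1)) := mul_le_mul_of_nonneg_left e2 hK₂
    have e4 : K₂ * (1 / (K₂ + 1)) < 1 := by
      rw [mul_one_div, div_lt_one (by linarith)]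
      linarith
    linarith
  refine ⟨h, hsmooth, fun n x => ?_, K₁ + K₂ + 1, 1 / (K₂ + 1), by linarith, by positivity,
    fun n v hv z => ⟨?_, ?_⟩⟩
  · rw [hφh, hφh, ← hFa, hφ]
    beta_reduce
    have e1 := uorb (horb n x) (n + 1)
    rw [orb_succ, orb_self] at e1
    rw [e1, H.maps _ (horb n x) n, add_zero]
  · have hv1 : N n v ≤ 1 := hv.trans ((div_le_one (by linarith)).2 (by linarith))
    have hd := ((hsmooth n).1.differentiable one_ne_zero v).hasFDerivAt
    have := fderiv_norm_le (hN n) (hN n) hd (c := K₁)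
      ((near n v 2 (by linarith)).mono fun ζ hζ => b₁ n v ζ (by linarith) hζ) z
    have := (hN n).nonneg z
    nlinarith
  · have hv1 := hinv n v hv
    have hd := ((hsmooth n).2.differentiable one_ne_zero v).hasFDerivAt
    have := fderiv_norm_le (hN n) (hN n) hd (c := K₂)
      (((hsmooth n).2.continuous.continuousAt.eventually
        (near n _ 2 (by linarith))).mono fun ζ hζ => by
        have := b₂ n ((h n).symm v) ((h n).symm ζ) (by linarith) hζ
        rwa [← hφh, ← hφh, Equiv.apply_symm_apply, Equiv.apply_symm_apply] at this) z
    have := (hN n).nonneg z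
    nlinarith

lemma Solv.mono {lo hi C C' : ℝ} (h : Solv B N lo hi C) (hC : C ≤ C') : Solv B N lo hi C' where
  ex w hw r hr := by
    obtain ⟨u, hu, hb⟩ := h.ex w hw r hr
    exact ⟨u, hu, fun m => (hb m).trans (mul_le_mul_of_nonneg_right hC (hw.pos m).le)⟩
  uniq := h.uniq

end diffeo

/-- Theorem: `C¹` linearization under exponential dichotomy, two-sided
time. -/
theorem c1_linearization_expDichotomy_twoSided {d : ℕ}
    (B : ℤ → (EuclideanSpace ℝ (Fin d) ≃L[ℝ] EuclideanSpace ℝ (Fin d)))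
    (N : ℤ → EuclideanSpace ℝ (Fin d) → ℝ)
    (hN : ∀ n : ℤ, IsNormOn (N n))
    (hdich : StrongExpDichotomyZWRT B N)
    (r k : ℕ) (aa bb : ℕ → ℝ)
    (hk : 1 ≤ k) (hkr : k < r)
    (hab : ∀ i : ℕ, 1 ≤ i → i ≤ r → 0 < aa i ∧ aa i ≤ bb i)
    (hord : ∀ i : ℕ, 1 ≤ i → i < r → bb i < aa (i + 1))
    (hbk : bb k < 1) (hak : 1 < aa (k + 1))
    (hgap : max (bb r) (aa 1)⁻¹ < aa (k + 1) / bb k)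
    (hband₁ : ∀ i : ℕ, 1 ≤ i → i ≤ k → bb i / aa i < (bb k)⁻¹)
    (hband₂ : ∀ j : ℕ, k + 1 ≤ j → j ≤ r → bb j / aa j < aa (k + 1))
    (hspec : SigmaEDZ B N = ⋃ i ∈ Finset.Icc 1 r, Set.Icc (aa i) (bb i))
    (L : ℝ) (hL : 0 < L) :
    ∃ η₀ : ℝ, 0 < η₀ ∧
      ∀ η : ℝ, 0 < η → η ≤ η₀ →
        ∀ f : ℤ → EuclideanSpace ℝ (Fin d) → EuclideanSpace ℝ (Fin d),
          (∀ n : ℤ, ContDiff ℝ 1 (f n)) →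
          (∀ n : ℤ, f n 0 = 0) →
          (∀ n : ℤ, fderiv ℝ (f n) 0 = 0) →
          (∀ (n : ℤ) (x v : EuclideanSpace ℝ (Fin d)),
            N (n + 1) (fderiv ℝ (f n) x v) ≤ η * N n v) →
          (∀ (n : ℤ) (x y v : EuclideanSpace ℝ (Fin d)),
            N (n + 1) ((fderiv ℝ (f n) x - fderiv ℝ (f n) y) v) ≤ L * N n (x - y) * N n v) →
          ∃ h : ℤ → (EuclideanSpace ℝ (Fin d) ≃ EuclideanSpace ℝ (Fin d)),
            (∀ n : ℤ, ContDiff ℝ 1 (h n) ∧ ContDiff ℝ 1 (h n).symm) ∧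
            (∀ (n : ℤ) (x : EuclideanSpace ℝ (Fin d)),
              h (n + 1) (B n x + f n x) = B n (h n x)) ∧
            ∃ M ρ : ℝ, 0 < M ∧ 0 < ρ ∧
              ∀ (n : ℤ) (v : EuclideanSpace ℝ (Fin d)), N n v ≤ ρ →
                ∀ z : EuclideanSpace ℝ (Fin d),
                  N n (fderiv ℝ (h n) v z) ≤ M * N n z ∧
                  N n (fderiv ℝ (h n).symm v z) ≤ M * N n z := by
  obtain ⟨A, hA, hBA, hAB⟩ := exists_step_bound hN hdich
  obtain ⟨κ, α, β, hκ, hκ1, H, hκS⟩ :=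
    exists_ladder hA hk hkr hab hord hbk hak hgap hband₁ hband₂ hspec
  have hsolv : ∀ i, ∃ C, i ≤ r → Solv B N (κ * α i) (β i / κ) C := fun i => by
    by_cases hi : i ≤ r
    · have hα := H.pos i hi
      have hle : κ * α i ≤ β i / κ := by
        rw [le_div_iff₀ hκ]
        have := H.le i hi
        have := mul_le_mul_of_nonneg_left hκ1.le (mul_pos hκ hα).le
        nlinarith
      obtain ⟨C, hC⟩ := exists_solv hN (mul_pos hκ hα) hle (hκS i hi)
      exact ⟨C, fun _ => hC⟩
    · exact ⟨0, fun h => absurd h hi⟩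
  choose C hC using hsolv
  set D : ℝ := 1 + ∑ i ∈ Finset.range (r + 1), |C i| with hD
  have hD0 : 0 < D := by positivity
  have hCD : ∀ i ≤ r, C i ≤ D := fun i hi => by
    have := Finset.single_le_sum (f := fun i => |C i|) (fun _ _ => abs_nonneg _)
      (Finset.mem_range.2 (Nat.lt_succ_of_le hi))
    have := le_abs_self (C i)
    linarith
  have hA0 : 0 < A := by linarith
  refine ⟨min (1 / (2 * D)) (1 / (2 * A)), by positivity, ?_⟩
  intro η hη hη' f hf h0 hd0 hb hl
  have hηD : 2 * D * η ≤ 1 := by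
    have := (le_div_iff₀ (by positivity)).1 (hη'.trans (min_le_left _ _))
    linarith
  have hηA : 2 * A * η ≤ 1 := by
    have := (le_div_iff₀ (by positivity)).1 (hη'.trans (min_le_right _ _))
    linarith
  have X : Ctx B N η L A κ f := ⟨hN, ⟨hf, h0, hd0, hb, hl⟩, hη.le, hL.le, hA0.le, hBA, hκ, hκ1⟩
  obtain ⟨Φ, hΦ⟩ := H.exists_orbitConj (C := D) X
    (fun i hi => ⟨⟨(hC i hi).mono (hCD i hi), hD0, hη.le, hηD⟩, H.pos i hi,
      (H.pos i hi).trans_le (H.le i hi)⟩) hA hηA hAB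
  exact hΦ.exists_diffeo X hηA hAB

end NonautLin
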